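/- arXiv:1403.5699 — 5 statements merged into one kernel-verified Lean document; each statement's English description precedes it below -/
import Mathlib

section
/- Suppose η_h ∈ C¹([0,T₁]; S_h) and u_h ∈ C¹([0,T₁]; S_{h,0}) satisfy the semidiscrete Galerkin equations for (SSW): (∂_t η_h, φ) + (∂_x u_h, φ) + (1/2)(∂_x(η_h u_h), φ) = 0 for all φ ∈ S_h and (∂_t u_h, χ) + (∂_x η_h, χ) + (3/2)(u_h ∂_x u_h, χ) + (1/2)(η_h ∂_x η_h, χ) = 0 for all χ ∈ S_{h,0}, for all t ∈ [0,T₁]. Then for every t ∈ [0,T₁], ‖η_h(t)‖² + ‖u_h(t)‖² = ‖η_h(0)‖² + ‖u_h(0)‖². -/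
noncomputable section
open Set

/-- The L²(0,1) inner product of two real functions. -/
def ip (f g : ℝ → ℝ) : ℝ := ∫ y in (0:ℝ)..1, f y * g y

/-- The L²(0,1) norm. -/
def nrm (f : ℝ → ℝ) : ℝ := Real.sqrt (∫ y in (0:ℝ)..1, (f y)^2)

/-- `g` is the L²(0,1)-orthogonal projection of `f` onto `S`. -/
def IsL2ProjOn (S : Set (ℝ → ℝ)) (f g : ℝ → ℝ) : Prop :=
  g ∈ S ∧ ∀ χ ∈ S, ip (fun y => f y - g y) χ = 0

/-- The space `S_h` of `C^k` piecewise polynomials of degree ≤ r-1 on the partition `x`. -/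
def Sh (N r k : ℕ) (x : ℕ → ℝ) : Set (ℝ → ℝ) :=
  {φ | ContDiffOn ℝ k φ (Icc (0:ℝ) 1) ∧
    ∀ j < N, ∃ p : Polynomial ℝ, p.natDegree ≤ r - 1 ∧
      ∀ y ∈ Icc (x j) (x (j+1)), φ y = Polynomial.eval y p}

/-- The subspace `S_{h,0}` of functions in `S_h` vanishing at 0 and 1. -/
def Sh0 (N r k : ℕ) (x : ℕ → ℝ) : Set (ℝ → ℝ) :=
  {φ | φ ∈ Sh N r k x ∧ φ 0 = 0 ∧ φ 1 = 0}

/-- `x 0 = 0 < x 1 < ⋯ < x N = 1` is a partition of `[0,1]`. -/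
def IsPartition (N : ℕ) (x : ℕ → ℝ) : Prop :=
  x 0 = 0 ∧ x N = 1 ∧ ∀ i < N, x i < x (i+1)

/-- `h` is the maximal meshlength of the partition `x`. -/
def IsMeshSize (N : ℕ) (x : ℕ → ℝ) (h : ℝ) : Prop :=
  (∀ i < N, x (i+1) - x i ≤ h) ∧ ∃ i < N, x (i+1) - x i = h

/-- The partition is quasiuniform with constant γ : `h ≤ γ · min meshlength`. -/
def QuasiUniform (N : ℕ) (x : ℕ → ℝ) (h γ : ℝ) : Prop :=
  ∀ i < N, h ≤ γ * (x (i+1) - x i)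

/-- `(ηh, uh)` (with time derivatives `dηh`, `duh`) is a `C¹` in time solution of the
standard Galerkin semidiscretization of the symmetric shallow water system in
`Sh N r k x × Sh0 N r k x` on `[0,T]`. -/
def SolvesSSWGalerkin (N r k : ℕ) (x : ℕ → ℝ) (T : ℝ)
    (ηh uh dηh duh : ℝ → ℝ → ℝ) : Prop :=
  (∀ t ∈ Icc (0:ℝ) T, ηh t ∈ Sh N r k x ∧ uh t ∈ Sh0 N r k x ∧
      dηh t ∈ Sh N r k x ∧ duh t ∈ Sh0 N r k x) ∧
  (∀ y ∈ Icc (0:ℝ) 1, ∀ t ∈ Icc (0:ℝ) T,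
      HasDerivWithinAt (fun s => ηh s y) (dηh t y) (Icc (0:ℝ) T) t ∧
      HasDerivWithinAt (fun s => uh s y) (duh t y) (Icc (0:ℝ) T) t) ∧
  (∀ y ∈ Icc (0:ℝ) 1, ContinuousOn (fun t => dηh t y) (Icc (0:ℝ) T) ∧
      ContinuousOn (fun t => duh t y) (Icc (0:ℝ) T)) ∧
  (∀ t ∈ Icc (0:ℝ) T,
      (∀ φ ∈ Sh N r k x,
        ip (dηh t) φ + ip (deriv (uh t)) φ
          + (1/2) * ip (deriv (fun y => ηh t y * uh t y)) φ = 0) ∧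
      (∀ χ ∈ Sh0 N r k x,
        ip (duh t) χ + ip (deriv (ηh t)) χ
          + (3/2) * ip (fun y => uh t y * deriv (uh t) y) χ
          + (1/2) * ip (fun y => ηh t y * deriv (ηh t) y) χ = 0))

lemma aux_interp (r : ℕ) (hr : 1 ≤ r) (a b : ℝ) (hab : a < b) (φ : ℝ → ℝ)
    (h : ∃ p : Polynomial ℝ, p.natDegree ≤ r - 1 ∧ ∀ y ∈ Icc a b, φ y = Polynomial.eval y p) :
    ∀ y ∈ Icc a b, φ y = ∑ i ∈ Finset.range r, φ (a + (b - a) * ((i:ℝ) / r)) *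
      (Lagrange.basis (Finset.range r) (fun i : ℕ => a + (b - a) * ((i:ℝ) / r)) i).eval y := by
  obtain ⟨p, hp, hpy⟩ := h
  have hr0 : (0:ℝ) < r := by exact_mod_cast hr
  have hba : 0 < b - a := sub_pos.2 hab
  have hinj : Set.InjOn (fun i : ℕ => a + (b - a) * ((i:ℝ) / r)) (Finset.range r : Set ℕ) := by
    intro i _ j _ hij
    have h1 : (b - a) * ((i:ℝ) / r) = (b - a) * ((j:ℝ) / r) := by
      simpa using hij
    have h2 := mul_left_cancel₀ hba.ne' h1
    have h3 : (i:ℝ) = j := by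
      field_simp at h2
      exact h2
    exact_mod_cast h3
  have hdeg : p.degree < (Finset.range r).card := by
    rw [Finset.card_range]
    refine lt_of_le_of_lt Polynomial.degree_le_natDegree ?_
    have : p.natDegree < r := by omega
    exact_mod_cast this
  have key := Lagrange.eq_interpolate hinj hdeg
  intro y hy
  rw [hpy y hy]
  conv_lhs => rw [key]
  rw [Lagrange.interpolate_apply, Polynomial.eval_finsetSum]
  refine Finset.sum_congr rfl fun i hi => ?_
  have hi' : (i:ℝ) / r ≤ 1 := by
    rw [div_le_one hr0]
    exact_mod_cast (Finset.mem_range.1 hi).le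
  have hi0 : 0 ≤ (i:ℝ) / r := by positivity
  rw [hpy (a + (b - a) * ((i:ℝ) / r)) ⟨by nlinarith, by nlinarith⟩]
  simp

lemma aux_bilin (r : ℕ) (a b : ℝ) (hab : a ≤ b) (φ ψ : ℝ → ℝ) (v : ℕ → ℝ)
    (L : ℕ → Polynomial ℝ)
    (hφ : ∀ y ∈ Icc a b, φ y = ∑ i ∈ Finset.range r, φ (v i) * (L i).eval y)
    (hψ : ∀ y ∈ Icc a b, ψ y = ∑ i ∈ Finset.range r, ψ (v i) * (L i).eval y) :
    ∫ y in a..b, φ y * ψ y = ∑ i ∈ Finset.range r, ∑ l ∈ Finset.range r,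
      φ (v i) * ψ (v l) * ∫ y in a..b, (L i).eval y * (L l).eval y := by
  have h1 : ∫ y in a..b, φ y * ψ y = ∫ y in a..b, ∑ i ∈ Finset.range r, ∑ l ∈ Finset.range r,
      φ (v i) * ψ (v l) * ((L i).eval y * (L l).eval y) := by
    refine intervalIntegral.integral_congr fun y hy => ?_
    rw [uIcc_of_le hab] at hy
    conv_lhs => rw [hφ y hy, hψ y hy]
    rw [Finset.sum_mul_sum]
    refine Finset.sum_congr rfl fun i _ => Finset.sum_congr rfl fun l _ => by ring
  rw [h1, intervalIntegral.integral_finsetSum]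
  · refine Finset.sum_congr rfl fun i _ => ?_
    rw [intervalIntegral.integral_finsetSum]
    · refine Finset.sum_congr rfl fun l _ => ?_
      rw [intervalIntegral.integral_const_mul]
    · intro l _
      exact Continuous.intervalIntegrable (by fun_prop) _ _
  · intro i _
    exact Continuous.intervalIntegrable (by fun_prop) _ _

lemma aux_deriv_piece (r : ℕ) (hr : 1 ≤ r) (a b : ℝ) (hab : a < b) (T : ℝ) (f f' : ℝ → ℝ → ℝ)
    (h : ∀ t ∈ Icc (0:ℝ) T, ∃ p : Polynomial ℝ, p.natDegree ≤ r - 1 ∧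
      ∀ y ∈ Icc a b, f t y = Polynomial.eval y p)
    (h' : ∀ t ∈ Icc (0:ℝ) T, ∃ p : Polynomial ℝ, p.natDegree ≤ r - 1 ∧
      ∀ y ∈ Icc a b, f' t y = Polynomial.eval y p)
    (hd : ∀ y ∈ Icc a b, ∀ t ∈ Icc (0:ℝ) T,
      HasDerivWithinAt (fun s => f s y) (f' t y) (Icc (0:ℝ) T) t)
    (t : ℝ) (ht : t ∈ Icc (0:ℝ) T) :
    HasDerivWithinAt (fun s => ∫ y in a..b, f s y * f s y)
      (2 * ∫ y in a..b, f' t y * f t y) (Icc (0:ℝ) T) t := by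
  have hr0 : (0:ℝ) < r := by exact_mod_cast hr
  have hba : 0 < b - a := sub_pos.2 hab
  set v : ℕ → ℝ := fun i : ℕ => a + (b - a) * ((i:ℝ) / r) with hv
  set L := Lagrange.basis (Finset.range r) v with hL
  have hmem : ∀ i ∈ Finset.range r, v i ∈ Icc a b := by
    intro i hi
    have hi' : (i:ℝ) / r ≤ 1 := by
      rw [div_le_one hr0]
      exact_mod_cast (Finset.mem_range.1 hi).le
    have hi0 : 0 ≤ (i:ℝ) / r := by positivity
    simp only [hv]
    exact ⟨by nlinarith, by nlinarith⟩
  have hf := fun t ht => aux_interp r hr a b hab (f t) (h t ht)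
  have hf' := fun t ht => aux_interp r hr a b hab (f' t) (h' t ht)
  have hD : HasDerivWithinAt (fun s => ∑ i ∈ Finset.range r, ∑ l ∈ Finset.range r,
      f s (v i) * f s (v l) * ∫ y in a..b, (L i).eval y * (L l).eval y)
      (∑ i ∈ Finset.range r, ∑ l ∈ Finset.range r,
      (f' t (v i) * f t (v l) + f t (v i) * f' t (v l)) *
        ∫ y in a..b, (L i).eval y * (L l).eval y) (Icc (0:ℝ) T) t := by
    refine HasDerivWithinAt.fun_sum fun i hi => HasDerivWithinAt.fun_sum fun l hl => ?_
    exact ((hd _ (hmem i hi) t ht).mul (hd _ (hmem l hl) t ht)).mul_const _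
  have e : 2 * ∫ y in a..b, f' t y * f t y = ∑ i ∈ Finset.range r, ∑ l ∈ Finset.range r,
      (f' t (v i) * f t (v l) + f t (v i) * f' t (v l)) *
        ∫ y in a..b, (L i).eval y * (L l).eval y := by
    have e1 := aux_bilin r a b hab.le (f' t) (f t) v L (hf' t ht) (hf t ht)
    have e2 := aux_bilin r a b hab.le (f t) (f' t) v L (hf t ht) (hf' t ht)
    have e3 : ∫ y in a..b, f t y * f' t y = ∫ y in a..b, f' t y * f t y := by
      congr 1; ext y; ring
    rw [e3] at e2
    rw [two_mul]
    conv_lhs => rw [e1]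
    rw [e1] at e2
    conv_lhs => arg 2; rw [e2]
    simp only [add_mul, Finset.sum_add_distrib]
  rw [e]
  refine hD.congr (fun s hs => ?_) ?_
  · exact aux_bilin r a b hab.le (f s) (f s) v L (hf s hs) (hf s hs)
  · exact aux_bilin r a b hab.le (f t) (f t) v L (hf t ht) (hf t ht)

/-- Agreement with a polynomial on every open cell. -/
def PPI (N : ℕ) (x : ℕ → ℝ) (f : ℝ → ℝ) : Prop :=
  ∀ j < N, ∃ p : Polynomial ℝ, ∀ y ∈ Ioo (x j) (x (j+1)), f y = p.eval y

lemma PPI.mul {N : ℕ} {x : ℕ → ℝ} {f g : ℝ → ℝ} (hf : PPI N x f) (hg : PPI N x g) :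
    PPI N x (fun y => f y * g y) := by
  intro j hj
  obtain ⟨p, hp⟩ := hf j hj
  obtain ⟨q, hq⟩ := hg j hj
  exact ⟨p * q, fun y hy => by simp [hp y hy, hq y hy]⟩

lemma aux_deriv_eq {a b : ℝ} {f : ℝ → ℝ} {p : Polynomial ℝ}
    (h : ∀ y ∈ Ioo a b, f y = p.eval y) : ∀ y ∈ Ioo a b, deriv f y = p.derivative.eval y := by
  intro y hy
  have : f =ᶠ[nhds y] fun z => p.eval z := by
    filter_upwards [Ioo_mem_nhds hy.1 hy.2] with z hz using h z hz
  rw [this.deriv_eq, Polynomial.deriv]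

lemma PPI.deriv {N : ℕ} {x : ℕ → ℝ} {f : ℝ → ℝ} (hf : PPI N x f) :
    PPI N x (deriv f) := by
  intro j hj
  obtain ⟨p, hp⟩ := hf j hj
  exact ⟨_, aux_deriv_eq hp⟩

lemma aux_ae {a b : ℝ} (hab : a ≤ b) {f g : ℝ → ℝ} (h : ∀ y ∈ Ioo a b, f y = g y) :
    f =ᵐ[MeasureTheory.volume.restrict (uIoc a b)] g := by
  rw [uIoc_of_le hab, ← MeasureTheory.restrict_Ioo_eq_restrict_Ioc]
  exact (MeasureTheory.ae_restrict_iff' measurableSet_Ioo).2 (Filter.Eventually.of_forall h)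

lemma PPI.piece {N : ℕ} {x : ℕ → ℝ} (hx : IsPartition N x) {f : ℝ → ℝ} (hf : PPI N x f) :
    ∀ j < N, IntervalIntegrable f MeasureTheory.volume (x j) (x (j+1)) := by
  intro j hj
  obtain ⟨p, hp⟩ := hf j hj
  have hc : IntervalIntegrable (fun y => p.eval y) MeasureTheory.volume (x j) (x (j+1)) :=
    Continuous.intervalIntegrable (by fun_prop) _ _
  exact hc.congr_ae (aux_ae (hx.2.2 j hj).le hp).symm

lemma PPI.int {N : ℕ} {x : ℕ → ℝ} (hx : IsPartition N x) {f : ℝ → ℝ} (hf : PPI N x f) :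
    IntervalIntegrable f MeasureTheory.volume 0 1 := by
  have := IntervalIntegrable.trans_iterate (hf.piece hx)
  rwa [hx.1, hx.2.1] at this

lemma PPI.sum {N : ℕ} {x : ℕ → ℝ} (hx : IsPartition N x) {f : ℝ → ℝ} (hf : PPI N x f) :
    ∫ y in (0:ℝ)..1, f y = ∑ j ∈ Finset.range N, ∫ y in (x j)..(x (j+1)), f y := by
  rw [intervalIntegral.sum_integral_adjacent_intervals (hf.piece hx), hx.1, hx.2.1]

lemma aux_ftc {N : ℕ} {x : ℕ → ℝ} (hx : IsPartition N x) {φ ψ : ℝ → ℝ}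
    (h : ∀ j < N, ∃ p : Polynomial ℝ, (∀ y ∈ Icc (x j) (x (j+1)), φ y = p.eval y) ∧
      ∀ y ∈ Ioo (x j) (x (j+1)), ψ y = p.derivative.eval y) :
    ∫ y in (0:ℝ)..1, ψ y = φ 1 - φ 0 := by
  have hψ : PPI N x ψ := fun j hj => by
    obtain ⟨p, -, hp⟩ := h j hj
    exact ⟨_, hp⟩
  rw [hψ.sum hx, ← hx.1, ← hx.2.1, ← Finset.sum_range_sub (fun j => φ (x j))]
  refine Finset.sum_congr rfl fun j hj => ?_
  rw [Finset.mem_range] at hj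
  obtain ⟨p, h1, h2⟩ := h j hj
  have hlt := hx.2.2 j hj
  rw [intervalIntegral.integral_congr_ae_restrict (aux_ae hlt.le h2),
    intervalIntegral.integral_eq_sub_of_hasDerivAt (f := fun y => p.eval y)
      (fun y _ => p.hasDerivAt y) (Continuous.intervalIntegrable (by fun_prop) _ _),
    h1 _ (left_mem_Icc.2 hlt.le), h1 _ (right_mem_Icc.2 hlt.le)]

lemma aux_mono {N : ℕ} {x : ℕ → ℝ} (hx : IsPartition N x) :
    ∀ i j, i ≤ j → j ≤ N → x i ≤ x j := by
  intro i j hij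
  induction j, hij using Nat.le_induction with
  | base => intro _; exact le_rfl
  | succ j hj ih => intro h; exact (ih (by omega)).trans (hx.2.2 j (by omega)).le

lemma Sh_PPI {N r k : ℕ} {x : ℕ → ℝ} {φ : ℝ → ℝ} (h : φ ∈ Sh N r k x) : PPI N x φ := by
  intro j hj
  obtain ⟨p, -, hp⟩ := h.2 j hj
  exact ⟨p, fun y hy => hp y (Ioo_subset_Icc_self hy)⟩

lemma aux_deriv_total {N r k : ℕ} (hr : 1 ≤ r) {x : ℕ → ℝ} (hx : IsPartition N x) (T : ℝ)
    (f f' : ℝ → ℝ → ℝ)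
    (h : ∀ t ∈ Icc (0:ℝ) T, f t ∈ Sh N r k x) (h' : ∀ t ∈ Icc (0:ℝ) T, f' t ∈ Sh N r k x)
    (hd : ∀ y ∈ Icc (0:ℝ) 1, ∀ t ∈ Icc (0:ℝ) T,
      HasDerivWithinAt (fun s => f s y) (f' t y) (Icc (0:ℝ) T) t)
    (t : ℝ) (ht : t ∈ Icc (0:ℝ) T) :
    HasDerivWithinAt (fun s => ip (f s) (f s)) (2 * ip (f' t) (f t)) (Icc (0:ℝ) T) t := by
  have hD : HasDerivWithinAt
      (fun s => ∑ j ∈ Finset.range N, ∫ y in (x j)..(x (j+1)), f s y * f s y)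
      (∑ j ∈ Finset.range N, 2 * ∫ y in (x j)..(x (j+1)), f' t y * f t y) (Icc (0:ℝ) T) t := by
    refine HasDerivWithinAt.fun_sum fun j hj => ?_
    rw [Finset.mem_range] at hj
    refine aux_deriv_piece r hr _ _ (hx.2.2 j hj) T f f' (fun t ht => (h t ht).2 j hj)
      (fun t ht => (h' t ht).2 j hj) (fun y hy => hd y ?_) t ht
    have a1 := aux_mono hx 0 j (by omega) (by omega)
    have a2 := aux_mono hx (j+1) N (by omega) (by omega)
    rw [hx.1] at a1
    rw [hx.2.1] at a2
    exact ⟨a1.trans hy.1, hy.2.trans a2⟩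
  rw [← Finset.mul_sum, ← ((Sh_PPI (h' t ht)).mul (Sh_PPI (h t ht))).sum hx] at hD
  refine hD.congr (fun s hs => ?_) ?_
  · exact ((Sh_PPI (h s hs)).mul (Sh_PPI (h s hs))).sum hx
  · exact ((Sh_PPI (h t ht)).mul (Sh_PPI (h t ht))).sum hx

lemma aux_nrm (f : ℝ → ℝ) : nrm f ^ 2 = ip f f := by
  unfold nrm ip
  rw [Real.sq_sqrt]
  · simp only [sq]
  · exact intervalIntegral.integral_nonneg zero_le_one fun y _ => sq_nonneg _

lemma aux_space {N r k : ℕ} {x : ℕ → ℝ} (hx : IsPartition N x) {η u : ℝ → ℝ}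
    (hη : η ∈ Sh N r k x) (hu : u ∈ Sh0 N r k x) :
    ip (deriv u) η + (1/2) * ip (deriv (fun y => η y * u y)) η + ip (deriv η) u
      + (3/2) * ip (fun y => u y * deriv u y) u + (1/2) * ip (fun y => η y * deriv η y) u = 0 := by
  have pη := Sh_PPI hη
  have pu := Sh_PPI hu.1
  have i1 := (pu.deriv.mul pη).int hx
  have i2 := ((pη.mul pu).deriv.mul pη).int hx
  have i3 := (pη.deriv.mul pu).int hx
  have i4 := ((pu.mul pu.deriv).mul pu).int hx
  have i5 := ((pη.mul pη.deriv).mul pu).int hx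
  have key := aux_ftc hx (φ := fun y => u y * η y + (1/2) * (η y * η y * u y)
      + (1/2) * (u y * u y * u y))
    (ψ := fun y => deriv u y * η y + (1/2) * (deriv (fun y => η y * u y) y * η y)
      + deriv η y * u y + (3/2) * (u y * deriv u y * u y) + (1/2) * (η y * deriv η y * u y)) ?_
  · simp only [hu.2.1, hu.2.2] at key
    unfold ip
    rw [← intervalIntegral.integral_const_mul, ← intervalIntegral.integral_const_mul,
      ← intervalIntegral.integral_const_mul,
      ← intervalIntegral.integral_add i1 (i2.const_mul _),
      ← intervalIntegral.integral_add (i1.add (i2.const_mul _)) i3,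
      ← intervalIntegral.integral_add ((i1.add (i2.const_mul _)).add i3) (i4.const_mul _),
      ← intervalIntegral.integral_add (((i1.add (i2.const_mul _)).add i3).add (i4.const_mul _))
        (i5.const_mul _)]
    rw [key]
    ring
  · intro j hj
    obtain ⟨p, -, hp⟩ := hη.2 j hj
    obtain ⟨q, -, hq⟩ := hu.1.2 j hj
    have hp' := fun y hy => hp y (Ioo_subset_Icc_self hy)
    have hq' := fun y hy => hq y (Ioo_subset_Icc_self hy)
    have hpq : ∀ y ∈ Ioo (x j) (x (j+1)), (fun y => η y * u y) y = (p * q).eval y := by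
      intro y hy
      simp [hp' y hy, hq' y hy]
    refine ⟨q * p + Polynomial.C (1/2) * (p * p * q) + Polynomial.C (1/2) * (q * q * q),
      fun y hy => ?_, fun y hy => ?_⟩
    · simp only [hp y hy, hq y hy, Polynomial.eval_add, Polynomial.eval_mul, Polynomial.eval_C]
    · simp only [hp' y hy, hq' y hy, aux_deriv_eq hp' y hy, aux_deriv_eq hq' y hy,
        aux_deriv_eq hpq y hy, Polynomial.eval_add, Polynomial.eval_mul, Polynomial.eval_C,
        Polynomial.derivative_add, Polynomial.derivative_mul, Polynomial.derivative_C,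
        Polynomial.eval_zero]
      ring

/-- **Discrete L² conservation for the semidiscrete Galerkin (SSW) problem.** -/
theorem stmt_1 (N r k : ℕ) (hN : 0 < N) (hr : 2 ≤ r) (hk : k ≤ r - 2)
    (x : ℕ → ℝ) (hpart : IsPartition N x) (T₁ : ℝ) (hT₁ : 0 < T₁)
    (ηh uh dηh duh : ℝ → ℝ → ℝ)
    (hgal : SolvesSSWGalerkin N r k x T₁ ηh uh dηh duh) :
    ∀ t ∈ Icc (0:ℝ) T₁,
      nrm (ηh t) ^ 2 + nrm (uh t) ^ 2 = nrm (ηh 0) ^ 2 + nrm (uh 0) ^ 2 := by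
  obtain ⟨hS, hD, -, hG⟩ := hgal
  have hE : ∀ t ∈ Icc (0:ℝ) T₁, HasDerivWithinAt
      (fun s => ip (ηh s) (ηh s) + ip (uh s) (uh s)) 0 (Icc (0:ℝ) T₁) t := by
    intro t ht
    have d1 := aux_deriv_total (k := k) (by omega : 1 ≤ r) hpart T₁ ηh dηh
      (fun t ht => (hS t ht).1) (fun t ht => (hS t ht).2.2.1)
      (fun y hy t ht => (hD y hy t ht).1) t ht
    have d2 := aux_deriv_total (k := k) (by omega : 1 ≤ r) hpart T₁ uh duh
      (fun t ht => (hS t ht).2.1.1) (fun t ht => (hS t ht).2.2.2.1)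
      (fun y hy t ht => (hD y hy t ht).2) t ht
    have s := aux_space hpart (hS t ht).1 (hS t ht).2.1
    have g1 := (hG t ht).1 _ (hS t ht).1
    have g2 := (hG t ht).2 _ (hS t ht).2.1
    have d := d1.add d2
    have e : 2 * ip (dηh t) (ηh t) + 2 * ip (duh t) (uh t) = 0 := by linarith
    rw [e] at d
    exact d
  intro t ht
  simp only [aux_nrm]
  refine (convex_Icc (0:ℝ) T₁).is_const_of_fderivWithin_eq_zero (𝕜 := ℝ)
    (f := fun s => ip (ηh s) (ηh s) + ip (uh s) (uh s))
    (fun s hs => (hE s hs).differentiableWithinAt) (fun s hs => ?_) ht ⟨le_rfl, hT₁.le⟩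
  have := (hE s hs).hasFDerivWithinAt.fderivWithin (uniqueDiffOn_Icc hT₁ s hs)
  rw [this]
  ext
  simp
end
end

section
/- Let v ∈ C²[0,1], and let u ∈ C₀⁴ with u''(0) = u''(1) = 0 and σ = u − P₀u. Then there exists a constant C, depending on v and u but not on N, such that for all N ≥ 2, max_{1≤i≤N} |∫_{I_i} v(x) σ(x) dx| ≤ C h⁵. -/
noncomputable section
open Set

/-- Continuous piecewise linear functions on the uniform mesh of `[0,1]`
with `N` subintervals. -/
def PL (N : ℕ) : Set (ℝ → ℝ) :=
  {φ | ContinuousOn φ (Icc (0:ℝ) 1) ∧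
    ∀ i < N, ∃ a b : ℝ, ∀ y ∈ Icc ((i : ℝ)/N) (((i : ℝ)+1)/N), φ y = a * y + b}

/-- Elements of `PL N` vanishing at 0 and 1. -/
def PL0 (N : ℕ) : Set (ℝ → ℝ) := {φ | φ ∈ PL N ∧ φ 0 = 0 ∧ φ 1 = 0}

lemma aux_step (f f' p p' : ℝ → ℝ) (m : ℝ) (hm : m ∈ Icc (0:ℝ) 1)
    (hf : ∀ x ∈ Icc (0:ℝ) 1, HasDerivWithinAt f (f' x) (Icc (0:ℝ) 1) x)
    (hp : ∀ x, HasDerivAt p (p' x) x) (h0 : f m = p m) (K : ℝ) (hK : 0 ≤ K) (n : ℕ)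
    (hb : ∀ x ∈ Icc (0:ℝ) 1, |f' x - p' x| ≤ K * |x - m| ^ n) :
    ∀ x ∈ Icc (0:ℝ) 1, |f x - p x| ≤ K * |x - m| ^ (n + 1) := by
  intro x hx
  have hsub : uIcc m x ⊆ Icc (0:ℝ) 1 := by
    intro y hy
    exact (ordConnected_Icc.uIcc_subset hm hx) hy
  have key := (convex_uIcc m x).norm_image_sub_le_of_norm_hasDerivWithin_le
    (f := fun y => f y - p y) (f' := fun y => f' y - p' y) (C := K * |x - m| ^ n)
    (x := m) (y := x)
    (fun y hy => ((hf y (hsub hy)).mono hsub).sub (hp y).hasDerivWithinAt)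
    (by
      intro y hy
      rw [Real.norm_eq_abs]
      refine (hb y (hsub hy)).trans ?_
      have : |y - m| ≤ |x - m| := abs_sub_left_of_mem_uIcc hy
      gcongr)
    left_mem_uIcc right_mem_uIcc
  simp only [Real.norm_eq_abs, h0, sub_self, sub_zero] at key
  calc _ ≤ _ := key
    _ = _ := by ring

lemma aux_deriv (n k : ℕ) (hk : k < n) (u : ℝ → ℝ) (hu : ContDiffOn ℝ n u (Icc (0:ℝ) 1)) :
    ∀ x ∈ Icc (0:ℝ) 1, HasDerivWithinAt (iteratedDerivWithin k u (Icc (0:ℝ) 1))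
      (iteratedDerivWithin (k + 1) u (Icc (0:ℝ) 1) x) (Icc (0:ℝ) 1) x := by
  intro x hx
  have h := hu.differentiableOn_iteratedDerivWithin (m := k) (by exact_mod_cast hk)
    (uniqueDiffOn_Icc zero_lt_one)
  rw [iteratedDerivWithin_succ]
  exact (h x hx).hasDerivWithinAt

lemma aux_bdd (n k : ℕ) (hk : k ≤ n) (u : ℝ → ℝ) (hu : ContDiffOn ℝ n u (Icc (0:ℝ) 1)) :
    ∃ K : ℝ, 0 ≤ K ∧ ∀ x ∈ Icc (0:ℝ) 1, |iteratedDerivWithin k u (Icc (0:ℝ) 1) x| ≤ K := by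
  have h := hu.continuousOn_iteratedDerivWithin (m := k) (by exact_mod_cast hk)
    (uniqueDiffOn_Icc zero_lt_one)
  obtain ⟨K, hK⟩ := isCompact_Icc.exists_bound_of_continuousOn h
  exact ⟨K, (norm_nonneg _).trans (hK 0 (by simp)), hK⟩

/-- Taylor bounds for `v`. -/
lemma aux_v (v : ℝ → ℝ) (hv : ContDiffOn ℝ 2 v (Icc (0:ℝ) 1)) :
    ∃ (v1 : ℝ → ℝ) (K : ℝ), 0 ≤ K ∧ (∀ x ∈ Icc (0:ℝ) 1, |v x| ≤ K ∧ |v1 x| ≤ K) ∧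
      ∀ m ∈ Icc (0:ℝ) 1, ∀ x ∈ Icc (0:ℝ) 1, |v x - (v m + v1 m * (x - m))| ≤ K * |x - m| ^ 2 := by
  have hv' : ContDiffOn ℝ (2:ℕ) v (Icc (0:ℝ) 1) := by exact_mod_cast hv
  obtain ⟨K0, h0, hK0⟩ := aux_bdd 2 0 (by norm_num) v hv'
  obtain ⟨K1, h1, hK1⟩ := aux_bdd 2 1 (by norm_num) v hv'
  obtain ⟨K2, h2, hK2⟩ := aux_bdd 2 2 (by norm_num) v hv'
  have d0 := aux_deriv 2 0 (by norm_num) v hv'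
  have d1 := aux_deriv 2 1 (by norm_num) v hv'
  set D1 := iteratedDerivWithin 1 v (Icc (0:ℝ) 1)
  simp only [iteratedDerivWithin_zero] at hK0 d0
  refine ⟨D1, K0 + K1 + K2, by positivity, fun x hx => ⟨?_, ?_⟩, ?_⟩
  · linarith [hK0 x hx]
  · linarith [hK1 x hx]
  intro m hm x hx
  have s1 := aux_step D1 _ (fun _ => D1 m) (fun _ => 0) m hm d1 (fun x => hasDerivAt_const _ _) rfl
    K2 h2 0 (by intro y hy; simpa using hK2 y hy)
  have s0 := aux_step v _ (fun y => v m + D1 m * (y - m)) (fun _ => D1 m) m hm d0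
    (fun x => by
      have := (((hasDerivAt_id x).sub_const m).const_mul (D1 m)).const_add (v m)
      simpa using this) (by simp) K2 h2 1 s1
  refine (s0 x hx).trans ?_
  have : 0 ≤ |x - m| ^ 2 := by positivity
  norm_num
  nlinarith

/-- Taylor bounds for `u`. -/
lemma aux_u (u : ℝ → ℝ) (hu : ContDiffOn ℝ 4 u (Icc (0:ℝ) 1)) :
    ∃ (D1 D3 : ℝ → ℝ) (K : ℝ), 0 ≤ K ∧
      (∀ x ∈ Icc (0:ℝ) 1, |iteratedDerivWithin 2 u (Icc (0:ℝ) 1) x| ≤ K ∧ |D3 x| ≤ K) ∧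
      ∀ m ∈ Icc (0:ℝ) 1, ∀ x ∈ Icc (0:ℝ) 1,
        |D3 x - D3 m| ≤ K * |x - m| ∧
        |iteratedDerivWithin 2 u (Icc (0:ℝ) 1) x
          - (iteratedDerivWithin 2 u (Icc (0:ℝ) 1) m + D3 m * (x - m))| ≤ K * |x - m| ^ 2 ∧
        |u x - (u m + D1 m * (x - m) + iteratedDerivWithin 2 u (Icc (0:ℝ) 1) m * (x - m) ^ 2 / 2
          + D3 m * (x - m) ^ 3 / 6)| ≤ K * |x - m| ^ 4 := by
  have hu' : ContDiffOn ℝ (4:ℕ) u (Icc (0:ℝ) 1) := by exact_mod_cast hu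
  obtain ⟨K2, h2, hK2⟩ := aux_bdd 4 2 (by norm_num) u hu'
  obtain ⟨K3, h3, hK3⟩ := aux_bdd 4 3 (by norm_num) u hu'
  obtain ⟨K4, h4, hK4⟩ := aux_bdd 4 4 (by norm_num) u hu'
  have d0 := aux_deriv 4 0 (by norm_num) u hu'
  have d1 := aux_deriv 4 1 (by norm_num) u hu'
  have d2 := aux_deriv 4 2 (by norm_num) u hu'
  have d3 := aux_deriv 4 3 (by norm_num) u hu'
  set D1 := iteratedDerivWithin 1 u (Icc (0:ℝ) 1)
  set D2 := iteratedDerivWithin 2 u (Icc (0:ℝ) 1)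
  set D3 := iteratedDerivWithin 3 u (Icc (0:ℝ) 1)
  simp only [iteratedDerivWithin_zero] at d0
  refine ⟨D1, D3, K2 + K3 + K4, by positivity, fun x hx => ⟨?_, ?_⟩, ?_⟩
  · linarith [hK2 x hx]
  · linarith [hK3 x hx]
  intro m hm x hx
  have s3 := aux_step D3 _ (fun _ => D3 m) (fun _ => 0) m hm d3 (fun x => hasDerivAt_const _ _) rfl
    K4 h4 0 (by intro y hy; simpa using hK4 y hy)
  have s2 := aux_step D2 _ (fun y => D2 m + D3 m * (y - m)) (fun _ => D3 m) m hm d2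
    (fun x => by
      have := (((hasDerivAt_id x).sub_const m).const_mul (D3 m)).const_add (D2 m)
      simpa using this) (by simp) K4 h4 1 s3
  have s1 := aux_step D1 _ (fun y => D1 m + D2 m * (y - m) + D3 m * (y - m) ^ 2 / 2)
    (fun y => D2 m + D3 m * (y - m)) m hm d1
    (fun x => by
      have e := (hasDerivAt_id x).sub_const m
      have := ((e.const_mul (D2 m)).const_add (D1 m)).add (((e.pow 2).const_mul (D3 m)).div_const 2)
      refine this.congr_deriv ?_
      simp; ring) (by simp) K4 h4 2 s2
  have s0 := aux_step u _
    (fun y => u m + D1 m * (y - m) + D2 m * (y - m) ^ 2 / 2 + D3 m * (y - m) ^ 3 / 6)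
    (fun y => D1 m + D2 m * (y - m) + D3 m * (y - m) ^ 2 / 2) m hm d0
    (fun x => by
      have e := (hasDerivAt_id x).sub_const m
      have := (((e.const_mul (D1 m)).const_add (u m)).add
        (((e.pow 2).const_mul (D2 m)).div_const 2)).add (((e.pow 3).const_mul (D3 m)).div_const 6)
      refine this.congr_deriv ?_
      simp; ring) (by simp) K4 h4 3 s1
  have w (n : ℕ) : K4 * |x - m| ^ n ≤ (K2 + K3 + K4) * |x - m| ^ n := by
    have : 0 ≤ |x - m| ^ n := by positivity
    gcongr; linarith
  refine ⟨?_, (s2 x hx).trans (w _), (s0 x hx).trans (w _)⟩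
  simpa using (s3 x hx).trans (w _)

/-- Integral of a polynomial on a symmetric interval. -/
lemma aux_int (m h c0 c1 c2 c3 c4 : ℝ) :
    ∫ x in (m - h/2)..(m + h/2), (c0 + c1 * (x - m) + c2 * (x - m)^2 + c3 * (x - m)^3
      + c4 * (x - m)^4) = c0 * h + c2 * h^3 / 12 + c4 * h^5 / 80 := by
  have := intervalIntegral.integral_eq_sub_of_hasDerivAt (a := m - h/2) (b := m + h/2)
    (f := fun x => c0 * (x - m) + c1 * (x-m)^2/2 + c2 * (x - m)^3/3 + c3 * (x-m)^4/4
      + c4 * (x - m)^5/5)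
    (f' := fun x => c0 + c1 * (x - m) + c2 * (x - m)^2 + c3 * (x - m)^3
      + c4 * (x - m)^4)
    (fun x _ => by
      have e := (hasDerivAt_id x).sub_const m
      have := ((((e.const_mul c0).add (((e.pow 2).const_mul c1).div_const 2)).add
        (((e.pow 3).const_mul c2).div_const 3)).add (((e.pow 4).const_mul c3).div_const 4)).add
        (((e.pow 5).const_mul c4).div_const 5)
      refine this.congr_deriv ?_
      simp; ring)
    (by apply Continuous.intervalIntegrable; fun_prop)
  rw [this]; ring

lemma aux_approx (m h B : ℝ) (hh : 0 ≤ h) (f g : ℝ → ℝ)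
    (hf : ContinuousOn f (Icc (m - h/2) (m + h/2))) (hg : Continuous g)
    (hB : ∀ x ∈ Icc (m - h/2) (m + h/2), |f x - g x| ≤ B) :
    |(∫ x in (m - h/2)..(m + h/2), f x) - ∫ x in (m - h/2)..(m + h/2), g x| ≤ B * h := by
  have hle : m - h/2 ≤ m + h/2 := by linarith
  rw [← intervalIntegral.integral_sub
    (ContinuousOn.intervalIntegrable (by rwa [uIcc_of_le hle])) (hg.intervalIntegrable _ _)]
  have := intervalIntegral.norm_integral_le_of_norm_le_const (a := m - h/2) (b := m + h/2)
    (f := fun x => f x - g x) (C := B) (by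
      intro x hx
      rw [uIoc_of_le hle] at hx
      exact hB x ⟨hx.1.le, hx.2⟩)
  rw [Real.norm_eq_abs] at this
  refine this.trans (le_of_eq ?_)
  rw [show m + h/2 - (m - h/2) = h by ring, abs_of_nonneg hh]

/-- Local error expansion. -/
lemma aux_cell (h K c0 c1 c2 c3 s ux ua ub u2a u2b px pa pb α β: ℝ) (hh : 0 < h) (hK : 0 ≤ K)
    (hs : |s| ≤ h/2)
    (hx : |ux - (c0 + c1 * s + c2 * s^2/2 + c3 * s^3/6)| ≤ K * |s|^4)
    (ha : |ua - (c0 + c1 * (-(h/2)) + c2 * (-(h/2))^2/2 + c3 * (-(h/2))^3/6)| ≤ K * (h/2)^4)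
    (hb : |ub - (c0 + c1 * (h/2) + c2 * (h/2)^2/2 + c3 * (h/2)^3/6)| ≤ K * (h/2)^4)
    (h2a : |u2a - (c2 + c3 * (-(h/2)))| ≤ K * (h/2)^2)
    (h2b : |u2b - (c2 + c3 * (h/2))| ≤ K * (h/2)^2)
    (hpx : px = α * s + β) (hpa : pa = α * (-(h/2)) + β) (hpb : pb = α * (h/2) + β) :
    |ux - px - (c2/2 * (s^2 - h^2/12) + c3 * (s^3/6 + h^2 * s/24)
      - ((pa - (ua - h^2/12 * u2a)) + (pb - (ub - h^2/12 * u2b)))/2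
      - ((pb - (ub - h^2/12 * u2b)) - (pa - (ua - h^2/12 * u2a))) * (s/h))| ≤ 2 * K * h^4 := by
  obtain ⟨t, rfl⟩ : ∃ t, s = t * h := ⟨s/h, by field_simp⟩
  have ht : |t| ≤ 1/2 := by
    rw [abs_mul, abs_of_pos hh] at hs
    by_contra hc
    push Not at hc
    nlinarith
  obtain ⟨ht1, ht2⟩ := abs_le.mp ht
  have hx' : |ux - (c0 + c1 * (t*h) + c2 * (t*h)^2/2 + c3 * (t*h)^3/6)| ≤ K * h^4 / 16 := by
    refine hx.trans ?_
    have : |t * h|^4 ≤ (h/2)^4 := by gcongr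
    nlinarith
  set rx := ux - (c0 + c1 * (t*h) + c2 * (t*h)^2/2 + c3 * (t*h)^3/6) with hrx
  set ra := ua - (c0 + c1 * (-(h/2)) + c2 * (-(h/2))^2/2 + c3 * (-(h/2))^3/6) with hra
  set rb := ub - (c0 + c1 * (h/2) + c2 * (h/2)^2/2 + c3 * (h/2)^3/6) with hrb
  set qa := u2a - (c2 + c3 * (-(h/2))) with hqa
  set qb := u2b - (c2 + c3 * (h/2)) with hqb
  have e : ux - px - (c2/2 * ((t*h)^2 - h^2/12) + c3 * ((t*h)^3/6 + h^2 * (t*h)/24)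
      - ((pa - (ua - h^2/12 * u2a)) + (pb - (ub - h^2/12 * u2b)))/2
      - ((pb - (ub - h^2/12 * u2b)) - (pa - (ua - h^2/12 * u2a))) * ((t*h)/h))
      = rx - ((1/2 - t) * (ra - h^2/12 * qa) + (1/2 + t) * (rb - h^2/12*qb)) := by
    rw [mul_div_assoc t h h, div_self hh.ne', hpx, hpa, hpb, hrx, hra, hrb, hqa, hqb]
    ring
  rw [e]
  have hM : 0 ≤ K * h^4 := by positivity
  have b1 : |ra - h^2/12 * qa| ≤ K * h^4 := by
    refine (abs_sub _ _).trans ?_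
    rw [abs_mul, abs_of_nonneg (by positivity : 0 ≤ h^2/12)]
    have : h^2/12 * |qa| ≤ h^2/12 * (K * (h/2)^2) := by gcongr
    have e1 : h^2/12 * (K * (h/2)^2) = K * h^4 / 48 := by ring
    have e2 : K * (h/2)^4 = K * h^4 / 16 := by ring
    linarith
  have b2 : |rb - h^2/12 * qb| ≤ K * h^4 := by
    refine (abs_sub _ _).trans ?_
    rw [abs_mul, abs_of_nonneg (by positivity : 0 ≤ h^2/12)]
    have : h^2/12 * |qb| ≤ h^2/12 * (K * (h/2)^2) := by gcongr
    have e1 : h^2/12 * (K * (h/2)^2) = K * h^4 / 48 := by ring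
    have e2 : K * (h/2)^4 = K * h^4 / 16 := by ring
    linarith
  obtain ⟨b11, b12⟩ := abs_le.mp b1
  obtain ⟨b21, b22⟩ := abs_le.mp b2
  obtain ⟨x1, x2⟩ := abs_le.mp hx'
  have p1 : 0 ≤ 1/2 - t := by linarith
  have p2 : 0 ≤ 1/2 + t := by linarith
  have q1 := mul_le_mul_of_nonneg_left b11 p1
  have q2 := mul_le_mul_of_nonneg_left b12 p1
  have q3 := mul_le_mul_of_nonneg_left b21 p2
  have q4 := mul_le_mul_of_nonneg_left b22 p2
  rw [abs_le]
  constructor <;> linarith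

/-- The discrete maximum principle for the mass matrix. -/
lemma aux_max (N : ℕ) (e : ℕ → ℝ) (B : ℝ) (hB : 0 ≤ B) (h0 : e 0 = 0) (hN : e N = 0)
    (h : ∀ j, j + 2 ≤ N → |e j + 4 * e (j+1) + e (j+2)| ≤ 2 * B) :
    ∀ j ≤ N, |e j| ≤ B := by
  obtain ⟨k, hk, hmax⟩ := Finset.exists_max_image (Finset.range (N+1)) (fun j => |e j|) ⟨0, by simp⟩
  simp only [Finset.mem_range] at hk hmax
  have hkB : |e k| ≤ B := by
    rcases Nat.eq_zero_or_pos k with rfl | hp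
    · simpa [h0]
    rcases (Nat.lt_succ_iff.mp hk).eq_or_lt with rfl | hlt
    · simpa [hN]
    obtain ⟨j, rfl⟩ : ∃ j, k = j + 1 := ⟨k-1, by omega⟩
    have a := h j (by omega)
    have b := hmax j (by omega)
    have c := hmax (j+2) (by omega)
    have d : 4 * |e (j+1)| ≤ |e j + 4 * e (j+1) + e (j+2)| + |e j| + |e (j+2)| := by
      rcases abs_cases (e (j+1)) with x | x <;>
      rcases abs_cases (e j + 4 * e (j+1) + e (j+2)) with z | z <;>
      rcases abs_cases (e j) with y | y <;> rcases abs_cases (e (j+2)) with w | w <;>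
      linarith
    linarith
  intro j hj
  exact (hmax j (by omega)).trans hkB

lemma aux_half (m h B A c ea eb ε : ℝ) (hh : 0 < h) (hε : |ε| ≤ 1) (f : ℝ → ℝ)
    (hf : ContinuousOn f (Icc (m - h/2) (m + h/2)))
    (hB : ∀ x ∈ Icc (m - h/2) (m + h/2), |f x - (A/2 * ((x-m)^2 - h^2/12)
      + c * ((x-m)^3/6 + h^2 * (x-m)/24) - (ea + eb)/2 - (eb - ea) * ((x-m)/h))| ≤ B) :
    |(∫ x in (m - h/2)..(m + h/2), f x * (1/2 + ε * ((x-m)/h)))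
      - (ε * c * h^4/180 - h * (ea + eb)/4 - ε * h * (eb - ea)/12)| ≤ B * h := by
  have hi := aux_int m h ((-(A * h^2/24) - (ea+eb)/2)/2)
    (c*h^2/48 - (eb-ea)/(2*h) + ε * (-(A * h^2/24) - (ea+eb)/2)/h)
    (A/4 + ε * c * h/24 - ε * (eb-ea)/h^2) (c/12 + ε * A/(2*h)) (ε * c/(6*h))
  have e : ((-(A * h^2/24) - (ea+eb)/2)/2) * h + (A/4 + ε * c * h/24 - ε * (eb-ea)/h^2) * h^3/12
      + (ε * c/(6*h)) * h^5/80 = ε * c * h^4/180 - h * (ea + eb)/4 - ε * h * (eb - ea)/12 := by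
    field_simp; ring
  rw [← e, ← hi]
  apply aux_approx m h B hh.le
  · apply hf.mul; fun_prop
  · fun_prop
  intro x hx
  have hs : |(x - m)/h| ≤ 1/2 := by
    rw [abs_div, abs_of_pos hh, div_le_iff₀ hh, abs_le]
    constructor <;> linarith [hx.1, hx.2]
  have hl : |1/2 + ε * ((x-m)/h)| ≤ 1 := by
    have : |ε * ((x-m)/h)| ≤ 1 * (1/2) := by rw [abs_mul]; gcongr
    rw [abs_le] at *
    constructor <;> linarith
  have hb := hB x hx
  calc _ = |f x - (A/2 * ((x-m)^2 - h^2/12)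
      + c * ((x-m)^3/6 + h^2 * (x-m)/24) - (ea + eb)/2 - (eb - ea) * ((x-m)/h))|
        * |1/2 + ε * ((x-m)/h)| := by
        rw [← abs_mul]; congr 1; field_simp; ring
    _ ≤ B * 1 := by
        gcongr
        exact (abs_nonneg _).trans hb
    _ = B := by ring

lemma aux_final (m h K V A c b v0 v1 : ℝ) (hh : 0 < h) (h1 : h ≤ 1) (hK : 0 ≤ K) (hV : 0 ≤ V)
    (hA : |A| ≤ K) (hc : |c| ≤ K) (hv1 : |v1| ≤ V) (v f : ℝ → ℝ)
    (hv : ContinuousOn v (Icc (m - h/2) (m + h/2)))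
    (hf : ContinuousOn f (Icc (m - h/2) (m + h/2)))
    (hb : ∀ x ∈ Icc (m - h/2) (m + h/2), |v x| ≤ V)
    (hvt : ∀ x ∈ Icc (m - h/2) (m + h/2), |v x - (v0 + v1 * (x - m))| ≤ V * |x - m|^2)
    (hB : ∀ x ∈ Icc (m - h/2) (m + h/2), |f x - (A/2 * ((x-m)^2 - h^2/12)
      + c * ((x-m)^3/6 + h^2 * (x-m)/24))| ≤ b * h^4) :
    |∫ x in (m - h/2)..(m + h/2), v x * f x| ≤ (V * b + 2 * V * K) * h^5 := by
  have hi := aux_int m h (-(v0 * A * h^2/24)) (v0 * c * h^2/24 - v1 * A * h^2/24)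
    (v0 * A/2 + v1 * c * h^2/24) (v0 * c/6 + v1 * A/2) (v1 * c/6)
  have key := aux_approx m h (V * b * h^4 + V * K * h^4) hh.le (fun x => v x * f x)
    (fun x => -(v0 * A * h^2/24) + (v0 * c * h^2/24 - v1 * A * h^2/24) * (x - m)
    + (v0 * A/2 + v1 * c * h^2/24) * (x - m)^2 + (v0 * c/6 + v1 * A/2) * (x - m)^3
    + (v1 * c/6) * (x - m)^4) (hv.mul hf) (by fun_prop) (by
      intro x hx
      have hs : |x - m| ≤ h/2 := by
        rw [abs_le]
        constructor <;> linarith [hx.1, hx.2]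
      have hs2 : |x - m|^2 ≤ h^2 := by gcongr; linarith
      have hs3 : |x - m|^3 ≤ h^3 := by gcongr; linarith
      have hq : |A/2 * ((x-m)^2 - h^2/12) + c * ((x-m)^3/6 + h^2 * (x-m)/24)| ≤ K * h^2 := by
        have q1 : |(x-m)^2 - h^2/12| ≤ h^2 := by
          have := abs_nonneg (x-m)
          rw [sq_abs] at hs2
          rw [abs_le]; constructor <;> nlinarith [sq_nonneg (x-m), sq_nonneg h]
        have q2 : |(x-m)^3/6 + h^2 * (x-m)/24| ≤ h^2/2 := by
          have a1 : |(x-m)^3/6| ≤ h^3/6 := by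
            rw [abs_div, abs_pow, abs_of_pos (by norm_num : (0:ℝ) < 6)]; gcongr
          have a2 : |h^2*(x-m)/24| ≤ h^2 * (h/2)/24 := by
            rw [abs_div, abs_mul, abs_of_pos (by norm_num : (0:ℝ) < 24),
              abs_of_pos (by positivity : 0 < h^2)]; gcongr
          have a3 : h^3 ≤ h^2 := pow_le_pow_of_le_one hh.le h1 (by norm_num)
          refine (abs_add_le _ _).trans ?_
          nlinarith
        refine (abs_add_le _ _).trans ?_
        rw [abs_mul, abs_mul, abs_div, abs_of_pos (by norm_num : (0:ℝ) < 2)]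
        calc _ ≤ K/2 * h^2 + K * (h^2/2) := by gcongr
          _ = _ := by ring
      have t1 := hb x hx
      have t2 := hvt x hx
      have t3 := hB x hx
      calc _ = |v x * (f x - (A/2 * ((x-m)^2 - h^2/12) + c * ((x-m)^3/6 + h^2 * (x-m)/24)))
            + (v x - (v0 + v1 * (x - m))) *
              (A/2 * ((x-m)^2 - h^2/12) + c * ((x-m)^3/6 + h^2 * (x-m)/24))| := by
            congr 1; ring
        _ ≤ V * (b * h^4) + (V * h^2) * (K * h^2) := by
            refine (abs_add_le _ _).trans ?_
            rw [abs_mul, abs_mul]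
            gcongr
            exact t2.trans (by gcongr)
        _ = _ := by ring)
  rw [hi] at key
  have e : -(v0 * A * h^2/24) * h + (v0 * A/2 + v1 * c * h^2/24) * h^3/12 + (v1 * c/6) * h^5/80
    = v1 * c * h^5/180 := by ring
  rw [e] at key
  have hz : |v1 * c * h^5/180| ≤ V * K * h^5 := by
    rw [abs_div, abs_mul, abs_mul, abs_of_pos (by norm_num : (0:ℝ) < 180),
      abs_of_pos (by positivity : 0 < h^5)]
    have : |v1| * |c| * h^5 ≤ V * K * h^5 := by gcongr
    have : 0 ≤ |v1| * |c| * h^5 := by positivity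
    linarith
  have e2 : (V * b * h^4 + V * K * h^4) * h = V * b * h^5 + V * K * h^5 := by ring
  rw [e2] at key
  rw [abs_le] at *
  constructor <;> linarith

/-- The hat function. -/
def hat (N j : ℕ) (y : ℝ) : ℝ := max 0 (1 - |N * y - j|)

lemma hat_cont (N j : ℕ) : Continuous (hat N j) := by unfold hat; fun_prop

lemma hat_left (N j : ℕ) (y : ℝ) (h : N * y ≤ (j:ℝ) - 1) : hat N j y = 0 := by
  unfold hat; rw [abs_of_nonpos (by linarith), max_eq_left (by linarith)]
lemma hat_right (N j : ℕ) (y : ℝ) (h : (j:ℝ) + 1 ≤ N * y) : hat N j y = 0 := by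
  unfold hat; rw [abs_of_nonneg (by linarith), max_eq_left (by linarith)]
lemma hat_ml (N j : ℕ) (y : ℝ) (h : (j:ℝ) - 1 ≤ N * y) (h' : N * y ≤ j) :
    hat N j y = N * y - (j - 1) := by
  unfold hat; rw [abs_of_nonpos (by linarith), max_eq_right (by linarith)]; ring
lemma hat_mr (N j : ℕ) (y : ℝ) (h : (j:ℝ) ≤ N * y) (h' : N * y ≤ j + 1) :
    hat N j y = (j + 1) - N * y := by
  unfold hat; rw [abs_of_nonneg (by linarith), max_eq_right (by linarith)]; ring

lemma hat_mem (N j : ℕ) (hj : j + 2 ≤ N) : hat N (j+1) ∈ PL0 N := by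
  have hN : (0:ℝ) < N := by exact_mod_cast (by omega : 0 < N)
  have hj' : (j:ℝ) + 2 ≤ N := by exact_mod_cast hj
  have hj0 : (0:ℝ) ≤ j := by positivity
  refine ⟨⟨(hat_cont _ _).continuousOn, ?_⟩, ?_, ?_⟩
  · intro i hi
    have conv : ∀ y ∈ Icc ((i : ℝ)/N) (((i : ℝ)+1)/N), (i:ℝ) ≤ N * y ∧ N * y ≤ i + 1 := by
      intro y hy
      have h1 := (div_le_iff₀ hN).mp hy.1
      have h2 := (le_div_iff₀ hN).mp hy.2
      constructor <;> linarith
    rcases lt_trichotomy i j with h | h | h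
    · refine ⟨0, 0, fun y hy => ?_⟩
      have := conv y hy
      have h' : (i:ℝ) + 1 ≤ j := by exact_mod_cast h
      rw [hat_left _ _ _ (by push_cast; linarith)]; ring
    · subst h
      refine ⟨N, -i, fun y hy => ?_⟩
      have := conv y hy
      rw [hat_ml _ _ _ (by push_cast; linarith) (by push_cast; linarith)]; push_cast; ring
    rcases (Nat.succ_le_of_lt h).eq_or_lt with h | h
    · have h' : (i:ℝ) = j + 1 := by rw [← h]; push_cast; ring
      refine ⟨-N, j + 2, fun y hy => ?_⟩
      have := conv y hy
      rw [hat_mr _ _ _ (by push_cast; linarith) (by push_cast; linarith)]; push_cast; ring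
    · refine ⟨0, 0, fun y hy => ?_⟩
      have := conv y hy
      have h' : (j:ℝ) + 1 + 1 ≤ i := by exact_mod_cast h
      rw [hat_right _ _ _ (by push_cast; linarith)]; ring
  · exact hat_left _ _ _ (by push_cast; linarith)
  · exact hat_right _ _ _ (by push_cast; linarith)

lemma hat_int (N j : ℕ) (hj : j + 2 ≤ N) (f : ℝ → ℝ) (hf : ContinuousOn f (Icc (0:ℝ) 1)) :
    ip f (hat N (j+1)) =
      (∫ y in ((j:ℝ)/N)..(((j:ℝ)+1)/N), f y * (N * y - j)) +
      ∫ y in (((j:ℝ)+1)/N)..(((j:ℝ)+2)/N), f y * (j + 2 - N * y) := by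
  have hN : (0:ℝ) < N := by exact_mod_cast (by omega : 0 < N)
  have hj' : (j:ℝ) + 2 ≤ N := by exact_mod_cast hj
  have hj0 : (0:ℝ) ≤ j := by positivity
  have m0 : (0:ℝ) ≤ j/N := by positivity
  have m1 : (j:ℝ)/N ≤ (j+1)/N := by gcongr; linarith
  have m2 : ((j:ℝ)+1)/N ≤ (j+2)/N := by gcongr; linarith
  have m3 : ((j:ℝ)+2)/N ≤ 1 := by rw [div_le_one hN]; exact hj'
  have ii (a b : ℝ) (ha : 0 ≤ a) (hab : a ≤ b) (hb : b ≤ 1) :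
      IntervalIntegrable (fun y => f y * hat N (j+1) y) MeasureTheory.volume a b := by
    apply ContinuousOn.intervalIntegrable
    rw [uIcc_of_le hab]
    exact (hf.mono (Icc_subset_Icc ha hb)).mul (hat_cont _ _).continuousOn
  unfold ip
  rw [← intervalIntegral.integral_add_adjacent_intervals (b := (j:ℝ)/N)
      (ii _ _ le_rfl m0 (by linarith)) (ii _ _ m0 (by linarith) le_rfl),
    ← intervalIntegral.integral_add_adjacent_intervals (a := (j:ℝ)/N) (b := ((j:ℝ)+1)/N)
      (ii _ _ m0 m1 (by linarith)) (ii _ _ (by linarith) (by linarith) le_rfl),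
    ← intervalIntegral.integral_add_adjacent_intervals (a := ((j:ℝ)+1)/N) (b := ((j:ℝ)+2)/N)
      (ii _ _ (by linarith) m2 (by linarith)) (ii _ _ (by linarith) (by linarith) le_rfl)]
  have z1 : ∫ y in (0:ℝ)..(j:ℝ)/N, f y * hat N (j+1) y = 0 := by
    rw [intervalIntegral.integral_congr (g := fun _ => 0), intervalIntegral.integral_zero]
    intro y hy
    rw [uIcc_of_le m0] at hy
    have := (le_div_iff₀ hN).mp hy.2
    simp only
    rw [hat_left _ _ _ (by push_cast; linarith), mul_zero]
  have z4 : ∫ y in (((j:ℝ)+2)/N)..1, f y * hat N (j+1) y = 0 := by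
    rw [intervalIntegral.integral_congr (g := fun _ => 0), intervalIntegral.integral_zero]
    intro y hy
    rw [uIcc_of_le m3] at hy
    have := (div_le_iff₀ hN).mp hy.1
    simp only
    rw [hat_right _ _ _ (by push_cast; linarith), mul_zero]
  rw [z1, z4, zero_add, add_zero]
  congr 1
  · apply intervalIntegral.integral_congr
    intro y hy
    rw [uIcc_of_le m1] at hy
    have h1 := (div_le_iff₀ hN).mp hy.1
    have h2 := (le_div_iff₀ hN).mp hy.2
    simp only
    rw [hat_ml _ _ _ (by push_cast; linarith) (by push_cast; linarith)]; push_cast; ring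
  · apply intervalIntegral.integral_congr
    intro y hy
    rw [uIcc_of_le m2] at hy
    have h1 := (div_le_iff₀ hN).mp hy.1
    have h2 := (le_div_iff₀ hN).mp hy.2
    simp only
    rw [hat_mr _ _ _ (by push_cast; linarith) (by push_cast; linarith)]; push_cast; ring

/-- **Superaccuracy of weighted cell averages of the L² projection error onto
`S_{h,0}`.** -/
theorem stmt_6 (v u : ℝ → ℝ)
    (hv : ContDiffOn ℝ 2 v (Icc (0:ℝ) 1))
    (hu : ContDiffOn ℝ 4 u (Icc (0:ℝ) 1)) (hu0 : u 0 = 0) (hu1 : u 1 = 0)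
    (hu20 : iteratedDerivWithin 2 u (Icc (0:ℝ) 1) 0 = 0)
    (hu21 : iteratedDerivWithin 2 u (Icc (0:ℝ) 1) 1 = 0) :
    ∃ C : ℝ, ∀ (N : ℕ), 2 ≤ N → ∀ Pu : ℝ → ℝ,
      IsL2ProjOn (PL0 N) u Pu →
      ∀ i < N,
        |∫ y in ((i : ℝ)/N)..(((i : ℝ)+1)/N), v y * (u y - Pu y)|
          ≤ C * ((1:ℝ)/N) ^ 5 := by
  obtain ⟨v1, V, hV, hvb, hvt⟩ := aux_v v hv
  obtain ⟨D1, D3, K, hK, hub, hut⟩ := aux_u u hu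
  set D2 := iteratedDerivWithin 2 u (Icc (0:ℝ) 1) with hD2
  refine ⟨V * (32 * K) + 2 * V * K, ?_⟩
  intro N hN2 Pu ⟨⟨⟨hPc, hPa⟩, hP0, hP1⟩, horth⟩
  have hN : (0:ℝ) < N := by exact_mod_cast (by omega : 0 < N)
  obtain ⟨h, hh⟩ : ∃ h : ℝ, h = 1/N := ⟨_, rfl⟩
  have hpos : 0 < h := by rw [hh]; positivity
  have hle : h ≤ 1 := by
    rw [hh, div_le_one hN]; exact_mod_cast (by omega : 1 ≤ N)
  have hNh : (N:ℝ) = 1/h := by rw [hh]; simp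
  obtain ⟨m, hm⟩ : ∃ m : ℕ → ℝ, ∀ i, m i = (i + 1/2) * h := ⟨_, fun _ => rfl⟩
  have hl (i : ℕ) : (i:ℝ)/N = m i - h/2 := by rw [hm, hNh]; field_simp; ring
  have hr (i : ℕ) : ((i:ℝ)+1)/N = m i + h/2 := by rw [hm, hNh]; field_simp; ring
  have hsub (i : ℕ) (hi : i < N) : Icc (m i - h/2) (m i + h/2) ⊆ Icc (0:ℝ) 1 := by
    rw [← hl, ← hr]
    apply Icc_subset_Icc
    · positivity
    · rw [div_le_one hN]; exact_mod_cast hi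
  obtain ⟨e, he⟩ : ∃ e : ℕ → ℝ, ∀ j, e j = Pu (j/N) - (u (j/N) - h^2/12 * D2 (j/N)) :=
    ⟨_, fun _ => rfl⟩
  have hσ : ContinuousOn (fun y => u y - Pu y) (Icc (0:ℝ) 1) := hu.continuousOn.sub hPc
  have hmm (i : ℕ) (hi : i < N) : m i ∈ Icc (0:ℝ) 1 :=
    hsub i hi ⟨by linarith, by linarith⟩
  -- the local expansion
  have cell : ∀ i < N, ∀ x ∈ Icc (m i - h/2) (m i + h/2),
      |u x - Pu x - (D2 (m i)/2 * ((x - m i)^2 - h^2/12)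
        + D3 (m i) * ((x - m i)^3/6 + h^2 * (x - m i)/24) - (e i + e (i+1))/2
        - (e (i+1) - e i) * ((x - m i)/h))| ≤ 2 * K * h^4 := by
    intro i hi x hx
    obtain ⟨α, β, hab⟩ := hPa i hi
    rw [hl, hr] at hab
    have ma : m i - h/2 ∈ Icc (m i - h/2) (m i + h/2) := ⟨le_rfl, by linarith⟩
    have mb : m i + h/2 ∈ Icc (m i - h/2) (m i + h/2) := ⟨by linarith, le_rfl⟩
    have tx := hut (m i) (hmm i hi) x (hsub i hi hx)
    have ta := hut (m i) (hmm i hi) _ (hsub i hi ma)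
    have tb := hut (m i) (hmm i hi) _ (hsub i hi mb)
    rw [show m i - h/2 - m i = -(h/2) by ring, abs_neg, abs_of_pos (by positivity : 0 < h/2)] at ta
    rw [show m i + h/2 - m i = h/2 by ring, abs_of_pos (by positivity : 0 < h/2)] at tb
    have := aux_cell h K (u (m i)) (D1 (m i)) (D2 (m i)) (D3 (m i)) (x - m i) (u x) (u (m i - h/2))
      (u (m i + h/2)) (D2 (m i - h/2)) (D2 (m i + h/2)) (Pu x) (Pu (m i - h/2)) (Pu (m i + h/2))
      α (α * m i + β) hpos hK
      (by rw [abs_le]; constructor <;> linarith [hx.1, hx.2])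
      tx.2.2 ta.2.2 tb.2.2 ta.2.1 tb.2.1
      (by rw [hab x hx]; ring) (by rw [hab _ ma]; ring) (by rw [hab _ mb]; ring)
    rw [he i, he (i+1)]
    push_cast
    rw [hl, hr]
    exact this
  -- nodal bounds
  have ebound : ∀ j ≤ N, |e j| ≤ 15 * K * h^4 := by
    apply aux_max N e _ (by positivity)
    · rw [he]; simp [hP0, hu0, hu20]
    · rw [he, div_self hN.ne']; simp [hP1, hu1, hu21]
    intro j hj
    have h0 := horth _ (hat_mem N j hj)
    rw [hat_int N j hj _ hσ, hl, hr] at h0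
    have e1 : ((j:ℝ)+1)/N = m (j+1) - h/2 := by rw [← hl]; push_cast; ring
    have e2 : ((j:ℝ)+2)/N = m (j+1) + h/2 := by rw [← hr]; push_cast; ring
    have e3 : m j + h/2 = m (j+1) - h/2 := by rw [← e1, hr]
    rw [e2] at h0
    nth_rewrite 2 [e3] at h0
    have A1 := aux_half (m j) h _ _ _ _ _ 1 hpos (by simp) _ (hσ.mono (hsub j (by omega)))
      (cell j (by omega))
    have A2 := aux_half (m (j+1)) h _ _ _ _ _ (-1) hpos (by simp) _
      (hσ.mono (hsub (j+1) (by omega))) (cell (j+1) (by omega))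
    have c1 : ∀ x, 1/2 + 1 * ((x - m j)/h) = N * x - j := by
      intro x; rw [hm, hNh]; field_simp; ring
    have c2 : ∀ x, 1/2 + (-1) * ((x - m (j+1))/h) = j + 2 - N * x := by
      intro x; rw [hm, hNh]; push_cast; field_simp; ring
    simp only [c1] at A1
    simp only [c2] at A2
    have hD := (hut (m j) (hmm j (by omega)) (m (j+1)) (hmm (j+1) (by omega))).1
    rw [show m (j+1) - m j = h by linarith, abs_of_pos hpos] at hD
    generalize (∫ x in (m j - h/2)..(m j + h/2), (u x - Pu x) * (N * x - j)) = I1 at *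
    generalize (∫ x in (m (j+1) - h/2)..(m (j+1) + h/2), (u x - Pu x) * (j + 2 - N * x)) = I2 at *
    have hD' : |(D3 (m (j+1)) - D3 (m j)) * h^4| ≤ K * h * h^4 := by
      rw [abs_mul, abs_of_pos (by positivity : 0 < h^4)]; gcongr
    have hn : 0 ≤ K * h^5 := by positivity
    have fin : |h * (e j + 4 * e (j+1) + e (j+2))| ≤ h * (2 * (15 * K * h^4)) := by
      have r1 : K * h * h^4 = K * h^5 := by ring
      have r2 : 2 * K * h^4 * h = 2 * (K * h^5) := by ring
      have r3 : h * (2 * (15 * K * h^4)) = 30 * (K * h^5) := by ring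
      rw [r1] at hD'
      rw [r2] at A1 A2
      rw [r3]
      rw [abs_le] at *
      have : e (j+1+1) = e (j+2) := rfl
      rw [this] at A2
      constructor <;> linarith [A1.1, A1.2, A2.1, A2.2, hD'.1, hD'.2]
    rw [abs_mul, abs_of_pos hpos] at fin
    exact le_of_mul_le_mul_left fin hpos
  intro i hi
  rw [hl, hr, ← hh]
  have hs := hsub i hi
  refine aux_final (m i) h K V (D2 (m i)) (D3 (m i)) (32 * K) (v (m i)) (v1 (m i)) hpos hle hK hV
    (hub _ (hmm i hi)).1 (hub _ (hmm i hi)).2 (hvb _ (hmm i hi)).2 v (fun y => u y - Pu y)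
    (hv.continuousOn.mono hs) (hσ.mono hs) (fun x hx => (hvb x (hs hx)).1)
    (fun x hx => hvt _ (hmm i hi) x (hs hx)) ?_
  intro x hx
  have b0 := cell i hi x hx
  have b1 := ebound i hi.le
  have b2 := ebound (i+1) hi
  have hx' : |(x - m i)/h| ≤ 1/2 := by
    rw [abs_div, abs_of_pos hpos, div_le_iff₀ hpos, abs_le]
    constructor <;> linarith [hx.1, hx.2]
  have b3 : |e (i+1) - e i| ≤ 30 * K * h^4 := by
    refine (abs_sub _ _).trans ?_
    linarith
  have b4 : |(e (i+1) - e i) * ((x - m i)/h)| ≤ 30 * K * h^4 * (1/2) := by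
    rw [abs_mul]; gcongr
  rw [abs_le] at b0 b1 b2 b4 ⊢
  constructor <;> linarith [b0.1, b0.2, b1.1, b1.2, b2.1, b2.2, b4.1, b4.2]
end
end

section
/- Let η ∈ C⁴[0,1] with η'(0) = η'(1) = 0 and η'''(0) = η'''(1) = 0, and let ρ = η − Pη. Then there exists a constant C, depending only on ‖η⁽⁴⁾‖_{L^∞(0,1)} and not on N, such that for all N ≥ 2, max_{1≤i≤N} |∫_{I_i} ρ(x) dx| ≤ C h⁵. -/
noncomputable section
open Set

lemma aux_step_s7 (g g' : ℝ → ℝ) (M a : ℝ) (k : ℕ) (ha : a ∈ Icc (0:ℝ) 1) (hM : 0 ≤ M)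
    (hd : ∀ x ∈ Icc (0:ℝ) 1, HasDerivWithinAt g (g' x) (Icc 0 1) x)
    (hg : g a = 0) (hb : ∀ x ∈ Icc (0:ℝ) 1, |g' x| ≤ M * |x - a| ^ k) :
    ∀ x ∈ Icc (0:ℝ) 1, |g x| ≤ M * |x - a| ^ (k+1) := by
  intro x hx
  have hsub : uIcc a x ⊆ Icc (0:ℝ) 1 := by
    apply Set.uIcc_subset_Icc ha hx
  have h := Convex.norm_image_sub_le_of_norm_hasDerivWithin_le (f := g) (f' := g')
    (s := uIcc a x) (C := M * |x - a| ^ k) (x := a) (y := x)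
    (fun z hz => (hd z (hsub hz)).mono hsub)
    (fun z hz => by
      refine (hb z (hsub hz)).trans ?_
      have : |z - a| ≤ |x - a| := Set.abs_sub_left_of_mem_uIcc hz
      gcongr)
    (convex_uIcc a x) left_mem_uIcc right_mem_uIcc
  rw [hg, sub_zero, Real.norm_eq_abs, Real.norm_eq_abs] at h
  rw [pow_succ, ← mul_assoc]
  exact h

lemma aux_taylor (η : ℝ → ℝ) (hη : ContDiffOn ℝ 4 η (Icc (0:ℝ) 1)) (M : ℝ)
    (hM : ∀ x ∈ Icc (0:ℝ) 1, |iteratedDerivWithin 4 η (Icc (0:ℝ) 1) x| ≤ M)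
    (a : ℝ) (ha : a ∈ Icc (0:ℝ) 1) : ∀ x ∈ Icc (0:ℝ) 1,
    |η x - (η a + iteratedDerivWithin 1 η (Icc (0:ℝ) 1) a * (x - a)
      + iteratedDerivWithin 2 η (Icc (0:ℝ) 1) a / 2 * (x - a)^2
      + iteratedDerivWithin 3 η (Icc (0:ℝ) 1) a / 6 * (x - a)^3)| ≤ M * |x - a| ^ 4 := by
  set D : ℕ → ℝ → ℝ := fun k => iteratedDerivWithin k η (Icc (0:ℝ) 1) with hD
  have hM0 : 0 ≤ M := (abs_nonneg _).trans (hM a ha)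
  have hu : UniqueDiffOn ℝ (Icc (0:ℝ) 1) := uniqueDiffOn_Icc zero_lt_one
  have hder : ∀ k : ℕ, k < 4 → ∀ x ∈ Icc (0:ℝ) 1,
      HasDerivWithinAt (D k) (D (k+1) x) (Icc 0 1) x := by
    intro k hk x hx
    have h1 := hη.differentiableOn_iteratedDerivWithin (m := k) (by exact_mod_cast hk) hu x hx
    have h2 := h1.hasDerivWithinAt
    simp only [hD, iteratedDerivWithin_succ]
    exact h2
  have hid : ∀ x, HasDerivWithinAt (fun y : ℝ => y - a) 1 (Icc 0 1) x :=
    fun x => (hasDerivWithinAt_id x _).sub_const a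
  have s3 := aux_step_s7 (fun x => D 3 x - D 3 a) (D 4) M a 0 ha hM0
    (fun x hx => (hder 3 (by norm_num) x hx).sub_const _) (by simp)
    (fun x hx => by simpa using hM x hx)
  have s2 := aux_step_s7 (fun x => D 2 x - (D 2 a + D 3 a * (x - a))) (fun x => D 3 x - D 3 a)
    M a 1 ha hM0
    (fun x hx => by
      have := (hder 2 (by norm_num) x hx).sub (((hid x).const_mul (D 3 a)).const_add (D 2 a))
      exact this.congr_deriv (by ring)) (by simp) s3
  have s1 := aux_step_s7 (fun x => D 1 x - (D 1 a + (D 2 a * (x - a) + D 3 a / 2 * (x - a)^2)))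
    (fun x => D 2 x - (D 2 a + D 3 a * (x - a)))
    M a 2 ha hM0
    (fun x hx => by
      have := (hder 1 (by norm_num) x hx).sub ((((hid x).const_mul (D 2 a)).add
        (((hid x).pow 2).const_mul (D 3 a / 2))).const_add (D 1 a))
      exact this.congr_deriv (by push_cast; ring)) (by simp) s2
  have s0 := aux_step_s7 (fun x => D 0 x - (D 0 a + (D 1 a * (x - a) + D 2 a / 2 * (x - a)^2
      + D 3 a / 6 * (x - a)^3)))
    (fun x => D 1 x - (D 1 a + (D 2 a * (x - a) + D 3 a / 2 * (x - a)^2)))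
    M a 3 ha hM0
    (fun x hx => by
      have := (hder 0 (by norm_num) x hx).sub (((((hid x).const_mul (D 1 a)).add
        (((hid x).pow 2).const_mul (D 2 a / 2))).add
        (((hid x).pow 3).const_mul (D 3 a / 6))).const_add (D 0 a))
      exact this.congr_deriv (by push_cast; ring)) (by simp) s1
  intro x hx
  have := s0 x hx
  simp only [hD, iteratedDerivWithin_zero] at this
  convert this using 2
  ring

lemma aux_moment (w : ℝ → ℝ) (hw : ContinuousOn w (Icc (0:ℝ) 1)) (α β γ δ m ε : ℝ)
    (hb : ∀ t ∈ Icc (0:ℝ) 1,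
      |w t - (α + β * (t + m) + γ * (t + m)^2 + δ * (t + m)^3)| ≤ ε) :
    |(∫ t in (0:ℝ)..1, w t) - (α + β * (1/2 + m) + γ * (1/3 + m + m^2)
      + δ * (1/4 + m + 3 * m^2/2 + m^3))| ≤ ε ∧
    |(∫ t in (0:ℝ)..1, w t * t) - (α / 2 + β * (1/3 + m/2) + γ * (1/4 + 2*m/3 + m^2/2)
      + δ * (1/5 + 3*m/4 + m^2 + m^3/2))| ≤ ε := by
  have hw' : ContinuousOn w (uIcc (0:ℝ) 1) := by rwa [uIcc_of_le zero_le_one]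
  have key : ∀ b0 b1 b2 b3 b4 : ℝ,
      ∫ t in (0:ℝ)..1, (b0 + b1 * t + b2 * t^2 + b3 * t^3 + b4 * t^4)
        = b0 + b1/2 + b2/3 + b3/4 + b4/5 := by
    intro b0 b1 b2 b3 b4
    have hder : ∀ x ∈ uIcc (0:ℝ) 1, HasDerivAt
        (fun t : ℝ => b0 * t + b1/2 * t^2 + b2/3*t^3 + b3/4*t^4 + b4/5*t^5)
        (b0 + b1 * x + b2 * x^2 + b3 * x^3 + b4 * x^4) x := by
      intro x _
      have := (((((hasDerivAt_id x).const_mul b0).add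
        (((hasDerivAt_id x).pow 2).const_mul (b1/2))).add
        (((hasDerivAt_id x).pow 3).const_mul (b2/3))).add
        (((hasDerivAt_id x).pow 4).const_mul (b3/4))).add
        (((hasDerivAt_id x).pow 5).const_mul (b4/5))
      exact this.congr_deriv (by simp only [id]; push_cast; ring)
    rw [intervalIntegral.integral_eq_sub_of_hasDerivAt hder
      (Continuous.intervalIntegrable (by fun_prop) _ _)]
    ring
  constructor
  · have e : (∫ t in (0:ℝ)..1, w t) - (α + β * (1/2 + m) + γ * (1/3 + m + m^2)
      + δ * (1/4 + m + 3 * m^2/2 + m^3)) = ∫ t in (0:ℝ)..1,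
        (w t - (α + β * (t + m) + γ * (t + m)^2 + δ * (t + m)^3)) := by
      rw [intervalIntegral.integral_sub hw'.intervalIntegrable
        (Continuous.intervalIntegrable (by fun_prop) _ _)]
      have := key (α + β * m + γ * m^2 + δ * m^3) (β + 2 * γ * m + 3 * δ * m^2)
        (γ + 3 * δ * m) δ 0
      rw [show (fun t : ℝ => (α + β * (t + m) + γ * (t + m)^2 + δ * (t + m)^3)) = fun t =>
        ((α + β * m + γ * m^2 + δ * m^3) + (β + 2 * γ * m + 3 * δ * m^2) * t +
        (γ + 3 * δ * m) * t^2 + δ * t^3 + 0 * t^4) by ext; ring, this]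
      ring
    rw [e]
    have := intervalIntegral.norm_integral_le_of_norm_le_const (a := (0:ℝ)) (b := 1) (C := ε)
      (f := fun t => w t - (α + β * (t + m) + γ * (t + m)^2 + δ * (t + m)^3))
      (fun t ht => by
        rw [uIoc_of_le zero_le_one] at ht
        exact hb t (Ioc_subset_Icc_self ht))
    simpa using this
  · have e : (∫ t in (0:ℝ)..1, w t * t) - (α / 2 + β * (1/3 + m/2) + γ * (1/4 + 2*m/3 + m^2/2)
      + δ * (1/5 + 3*m/4 + m^2 + m^3/2)) = ∫ t in (0:ℝ)..1,
        (w t * t - (α + β * (t + m) + γ * (t + m)^2 + δ * (t + m)^3) * t) := by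
      have hwi : IntervalIntegrable (fun t => w t * t) MeasureTheory.volume 0 1 :=
        (hw'.mul continuousOn_id).intervalIntegrable
      rw [intervalIntegral.integral_sub hwi
        (Continuous.intervalIntegrable (by fun_prop) _ _)]
      have := key 0 (α + β * m + γ * m^2 + δ * m^3) (β + 2 * γ * m + 3 * δ * m^2)
        (γ + 3 * δ * m) δ
      rw [show (fun t : ℝ => (α + β * (t + m) + γ * (t + m)^2 + δ * (t + m)^3) * t) = fun t =>
        (0 + (α + β * m + γ * m^2 + δ * m^3) * t + (β + 2 * γ * m + 3 * δ * m^2) * t^2 +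
        (γ + 3 * δ * m) * t^3 + δ * t^4) by ext; ring, this]
      ring
    rw [e]
    have := intervalIntegral.norm_integral_le_of_norm_le_const (a := (0:ℝ)) (b := 1) (C := ε)
      (f := fun t => w t * t - (α + β * (t + m) + γ * (t + m)^2 + δ * (t + m)^3) * t)
      (fun t ht => by
        rw [uIoc_of_le zero_le_one] at ht
        rw [← sub_mul, Real.norm_eq_abs, abs_mul, abs_of_nonneg ht.1.le]
        have := hb t (Ioc_subset_Icc_self ht)
        exact (mul_le_of_le_one_right (abs_nonneg _) ht.2).trans this)
    simpa using this

/-- Hat function at node `j`. -/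
def hatf (N j : ℕ) (y : ℝ) : ℝ := max 0 (1 - |N * y - j|)

lemma hatf_cell (N j k : ℕ) (hN : 0 < N) (t : ℝ) (ht : t ∈ Icc (0:ℝ) 1) :
    hatf N j ((k + t) / N) = (if k = j then 1 - t else 0) + (if k + 1 = j then t else 0) := by
  obtain ⟨h0, h1⟩ := ht
  have hN' : (N:ℝ) ≠ 0 := by positivity
  unfold hatf
  rw [mul_div_cancel₀ _ hN']
  rcases lt_trichotomy k j with h | h | h
  · by_cases h' : k + 1 = j
    · subst h'
      push_cast
      rw [abs_of_nonpos (by linarith)]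
      simp
      linarith
    · have : k + 2 ≤ j := by omega
      have : (k:ℝ) + 2 ≤ j := by exact_mod_cast this
      rw [if_neg (by omega), if_neg h', abs_of_nonpos (by linarith), max_eq_left (by linarith)]
      simp
  · subst h
    rw [if_pos rfl, if_neg (by omega), abs_of_nonneg (by linarith), max_eq_right (by linarith)]
    ring
  · have : (j:ℝ) + 1 ≤ k := by exact_mod_cast h
    rw [if_neg (by omega), if_neg (by omega), abs_of_nonneg (by linarith),
      max_eq_left (by linarith)]
    simp

lemma hatf_mem (N j : ℕ) (hN : 0 < N) : hatf N j ∈ PL N := by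
  have hN' : (0:ℝ) < N := by positivity
  constructor
  · apply Continuous.continuousOn
    unfold hatf
    fun_prop
  · intro k hk
    refine ⟨(if k = j then -(N:ℝ) else 0) + (if k + 1 = j then (N:ℝ) else 0),
      (if k = j then 1 + (k:ℝ) else 0) + (if k + 1 = j then -(k:ℝ) else 0), ?_⟩
    intro y hy
    have h1 := (div_le_iff₀ hN').1 hy.1
    have h2 := (le_div_iff₀ hN').1 hy.2
    have := hatf_cell N j k hN (y * N - k) ⟨by linarith, by linarith⟩
    rw [show ((k:ℝ) + (y * N - k)) / N = y by field_simp; ring] at this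
    rw [this]
    split_ifs <;> ring

lemma cell_subst (N : ℕ) (hN : 0 < N) (k : ℕ) (f : ℝ → ℝ) :
    ∫ y in ((k:ℝ)/N)..(((k:ℝ)+1)/N), f y
      = (1/(N:ℝ)) * ∫ t in (0:ℝ)..1, f ((k + t)/N) := by
  have hN' : (N:ℝ) ≠ 0 := by positivity
  have := intervalIntegral.integral_comp_add_div (a := 0) (b := 1) f hN' ((k:ℝ)/N)
  simp only [zero_div, add_zero, smul_eq_mul] at this
  simp only [add_div]
  rw [this]
  field_simp

lemma sum_cells (N : ℕ) (hN : 0 < N) (f : ℝ → ℝ) (hf : ContinuousOn f (Icc (0:ℝ) 1)) :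
    ∫ y in (0:ℝ)..1, f y
      = (1/(N:ℝ)) * ∑ k ∈ Finset.range N, ∫ t in (0:ℝ)..1, f ((k + t)/N) := by
  have hN' : (0:ℝ) < N := by positivity
  have h := intervalIntegral.sum_integral_adjacent_intervals (f := f) (μ := MeasureTheory.volume)
    (a := fun k : ℕ => (k:ℝ)/N) (n := N) (by
      intro k hk
      apply ContinuousOn.intervalIntegrable
      apply hf.mono
      have hk' : (k:ℝ) + 1 ≤ N := by exact_mod_cast hk
      apply Set.uIcc_subset_Icc
      · exact ⟨by positivity, by rw [div_le_one hN']; linarith⟩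
      · exact ⟨by positivity, by rw [div_le_one hN']; push_cast; linarith⟩)
  simp only [Nat.cast_zero, zero_div, div_self hN'.ne'] at h
  rw [← h, Finset.mul_sum]
  apply Finset.sum_congr rfl
  intro k _
  push_cast
  exact cell_subst N hN k f

lemma node_mem (N k : ℕ) (hk : k < N) (t : ℝ) (ht : t ∈ Icc (0:ℝ) 1) :
    ((k:ℝ) + t)/N ∈ Icc (0:ℝ) 1 := by
  have hN' : (0:ℝ) < N := by exact_mod_cast (by omega : 0 < N)
  have hk' : (k:ℝ) + 1 ≤ N := by exact_mod_cast hk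
  have := ht.1
  refine ⟨by positivity, ?_⟩
  rw [div_le_one hN']
  linarith [ht.2]

lemma cell_cont (N k : ℕ) (hk : k < N) (f : ℝ → ℝ) (hf : ContinuousOn f (Icc (0:ℝ) 1)) :
    ContinuousOn (fun t : ℝ => f (((k:ℝ) + t)/N)) (Icc (0:ℝ) 1) :=
  hf.comp (by fun_prop) (fun t ht => node_mem N k hk t ht)

lemma orth (N j : ℕ) (hN : 0 < N) (ρ : ℝ → ℝ) (hρ : ContinuousOn ρ (Icc (0:ℝ) 1))
    (h : ip ρ (hatf N j) = 0) (D E : ℕ → ℝ)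
    (hD : D = fun k : ℕ => ∫ t in (0:ℝ)..1, ρ (((k:ℝ) + t)/N))
    (hE : E = fun k : ℕ => ∫ t in (0:ℝ)..1, ρ (((k:ℝ) + t)/N) * t) :
    ∑ k ∈ Finset.range N, ((if k = j then D k - E k else 0) + (if k + 1 = j then E k else 0))
      = 0 := by
  have hN' : (0:ℝ) < N := by positivity
  unfold ip at h
  rw [sum_cells N hN (fun y => ρ y * hatf N j y) (hρ.mul (hatf_mem N j hN).1)] at h
  have h' := (mul_eq_zero.1 h).resolve_left (by positivity)
  refine Eq.trans ?_ h'
  apply Finset.sum_congr rfl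
  intro k hk
  have hk := Finset.mem_range.1 hk
  have c := cell_cont N k hk ρ hρ
  have c' : ContinuousOn (fun t : ℝ => ρ (((k:ℝ) + t)/N)) (uIcc (0:ℝ) 1) := by
    rwa [uIcc_of_le zero_le_one]
  have e : ∫ t in (0:ℝ)..1, ρ (((k:ℝ) + t)/N) * hatf N j (((k:ℝ) + t)/N) =
     ∫ t in (0:ℝ)..1, ρ (((k:ℝ) + t)/N) * 
      ((if k = j then 1 - t else 0) + (if k + 1 = j then t else 0)) := by
    apply intervalIntegral.integral_congr
    intro t ht
    rw [uIcc_of_le zero_le_one] at ht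
    simp only
    rw [hatf_cell N j k hN t ht]
  rw [e, hD, hE]
  by_cases h1 : k = j
  · simp only [h1, if_true]
    subst h1
    simp only [if_neg (show ¬ (k + 1 = k) by omega), add_zero, mul_sub, mul_one]
    have hci : IntervalIntegrable (fun t => ρ (((k:ℝ) + t)/N) * t) MeasureTheory.volume 0 1 :=
      (c'.mul continuousOn_id).intervalIntegrable
    rw [intervalIntegral.integral_sub c'.intervalIntegrable hci]
  · by_cases h2 : k + 1 = j
    · simp [h1, h2]
    · simp [h1, h2]

lemma cell_taylor (η : ℝ → ℝ) (hη : ContDiffOn ℝ 4 η (Icc (0:ℝ) 1)) (M : ℝ)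
    (hM : ∀ x ∈ Icc (0:ℝ) 1, |iteratedDerivWithin 4 η (Icc (0:ℝ) 1) x| ≤ M)
    (N j : ℕ) (hN : 0 < N) (hj : j ≤ N) (A B : ℕ → ℝ)
    (hA : A = fun k : ℕ => ∫ t in (0:ℝ)..1, η (((k:ℝ) + t)/N))
    (hB : B = fun k : ℕ => ∫ t in (0:ℝ)..1, η (((k:ℝ) + t)/N) * t) :
    ∃ α β γ δ : ℝ,
      (iteratedDerivWithin 1 η (Icc (0:ℝ) 1) ((j:ℝ)/N) = 0 → β = 0) ∧
      (iteratedDerivWithin 3 η (Icc (0:ℝ) 1) ((j:ℝ)/N) = 0 → δ = 0) ∧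
      ∀ k < N, ∀ m : ℝ, (k:ℝ) - j = m → -2 ≤ m → m ≤ 1 →
      |A k - (α + β * (1/2 + m) + γ * (1/3 + m + m^2)
        + δ * (1/4 + m + 3 * m^2/2 + m^3))| ≤ 16 * M * (1/(N:ℝ))^4 ∧
      |B k - (α / 2 + β * (1/3 + m/2) + γ * (1/4 + 2*m/3 + m^2/2)
        + δ * (1/5 + 3*m/4 + m^2 + m^3/2))| ≤ 16 * M * (1/(N:ℝ))^4 := by
  have hN' : (0:ℝ) < N := by positivity
  have hj' : (j:ℝ) ≤ N := by exact_mod_cast hj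
  have ha : (j:ℝ)/N ∈ Icc (0:ℝ) 1 := ⟨by positivity, by rw [div_le_one hN']; exact hj'⟩
  have hM0 : 0 ≤ M := (abs_nonneg _).trans (hM _ ha)
  have T := aux_taylor η hη M hM _ ha
  refine ⟨η ((j:ℝ)/N), iteratedDerivWithin 1 η (Icc (0:ℝ) 1) ((j:ℝ)/N) / N,
    iteratedDerivWithin 2 η (Icc (0:ℝ) 1) ((j:ℝ)/N) / 2 / N^2,
    iteratedDerivWithin 3 η (Icc (0:ℝ) 1) ((j:ℝ)/N) / 6 / N^3,
    fun h => by rw [h]; simp, fun h => by rw [h]; simp, ?_⟩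
  intro k hk m hm hm1 hm2
  rw [hA, hB]
  apply aux_moment _ (cell_cont N k hk η hη.continuousOn)
  intro t ht
  have := T _ (node_mem N k hk t ht)
  have e : ((k:ℝ) + t)/N - (j:ℝ)/N = (t + m)/N := by rw [← hm]; field_simp; ring
  rw [e] at this
  have e2 : |(t + m)/(N:ℝ)| ^ 4 ≤ 16 * (1/(N:ℝ))^4 := by
    rw [abs_div, abs_of_pos hN', div_pow, one_div, inv_pow, ← div_eq_mul_inv]
    have : |t + m| ≤ 2 := abs_le.2 ⟨by linarith [ht.1], by linarith [ht.2]⟩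
    have h4 : |t + m|^4 ≤ 2^4 := by gcongr
    norm_num at h4 ⊢
    gcongr
  calc _ = _ := ?_
    _ ≤ _ := this
    _ ≤ M * (16 * (1/(N:ℝ))^4) := by gcongr
    _ = _ := by ring
  congr 1
  field_simp

lemma proj_moments (N : ℕ) (p η : ℝ → ℝ) (hp : p ∈ PL N)
    (hη : ContinuousOn η (Icc (0:ℝ) 1)) (k : ℕ) (hk : k < N) :
    (∫ t in (0:ℝ)..1, (η (((k:ℝ) + t)/N) - p (((k:ℝ) + t)/N)))
      = (∫ t in (0:ℝ)..1, η (((k:ℝ) + t)/N)) - (p ((k:ℝ)/N) + p (((k+1:ℕ):ℝ)/N)) / 2 ∧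
    (∫ t in (0:ℝ)..1, (η (((k:ℝ) + t)/N) - p (((k:ℝ) + t)/N)) * t)
      = (∫ t in (0:ℝ)..1, η (((k:ℝ) + t)/N) * t)
        - (p ((k:ℝ)/N) / 6 + p (((k+1:ℕ):ℝ)/N) / 3) := by
  have hN' : (0:ℝ) < N := by exact_mod_cast (by omega : 0 < N)
  obtain ⟨a, b, hab⟩ := hp.2 k hk
  have hv : ∀ t ∈ Icc (0:ℝ) 1, p (((k:ℝ) + t)/N)
      = p ((k:ℝ)/N) + (p (((k+1:ℕ):ℝ)/N) - p ((k:ℝ)/N)) * t := by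
    intro t ht
    rw [hab _ ⟨by gcongr; linarith [ht.1], by gcongr; exact ht.2⟩,
      hab ((k:ℝ)/N) ⟨le_rfl, by gcongr; linarith⟩,
      hab (((k+1:ℕ):ℝ)/N) ⟨by gcongr; push_cast; linarith, by push_cast; exact le_rfl⟩]
    push_cast
    field_simp
    ring
  have hpc := cell_cont N k hk p hp.1
  have hηc := cell_cont N k hk η hη
  have hm := aux_moment _ hpc (p ((k:ℝ)/N)) (p (((k+1:ℕ):ℝ)/N) - p ((k:ℝ)/N)) 0 0 0 0
    (fun t ht => by rw [hv t ht]; simp)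
  obtain ⟨h1, h2⟩ := hm
  have h1 := abs_nonpos_iff.1 h1
  have h2 := abs_nonpos_iff.1 h2
  rw [← uIcc_of_le zero_le_one] at hpc hηc
  have i1 : IntervalIntegrable (fun t => η (((k:ℝ) + t)/N) * t) MeasureTheory.volume 0 1 :=
      (hηc.mul continuousOn_id).intervalIntegrable
  have i2 : IntervalIntegrable (fun t => p (((k:ℝ) + t)/N) * t) MeasureTheory.volume 0 1 :=
      (hpc.mul continuousOn_id).intervalIntegrable
  simp only [sub_mul]
  rw [intervalIntegral.integral_sub hηc.intervalIntegrable hpc.intervalIntegrable,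
    intervalIntegral.integral_sub i1 i2]
  constructor <;> linarith

/-- **Superaccuracy of cell averages of the L² projection error onto `S_h`.** -/
theorem stmt_7 :
    ∃ C : ℝ → ℝ,
      ∀ (η Pη : ℝ → ℝ) (N : ℕ), 2 ≤ N →
        ContDiffOn ℝ 4 η (Icc (0:ℝ) 1) →
        iteratedDerivWithin 1 η (Icc (0:ℝ) 1) 0 = 0 →
        iteratedDerivWithin 1 η (Icc (0:ℝ) 1) 1 = 0 →
        iteratedDerivWithin 3 η (Icc (0:ℝ) 1) 0 = 0 →
        iteratedDerivWithin 3 η (Icc (0:ℝ) 1) 1 = 0 →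
        IsL2ProjOn (PL N) η Pη →
        ∀ i < N,
          |∫ y in ((i : ℝ)/N)..(((i : ℝ)+1)/N), (η y - Pη y)|
            ≤ C (sSup ((fun y => |iteratedDerivWithin 4 η (Icc (0:ℝ) 1) y|) '' Icc (0:ℝ) 1))
                * ((1:ℝ)/N) ^ 5 := by
  refine ⟨fun M => 80 * M, ?_⟩
  intro η p N hN hη h10 h11 h30 h31 hproj
  have hN0 : 0 < N := by omega
  have hN' : (0:ℝ) < N := by positivity
  have hηc := hη.continuousOn
  have hpc := hproj.1.1
  set M := sSup ((fun y => |iteratedDerivWithin 4 η (Icc (0:ℝ) 1) y|) '' Icc (0:ℝ) 1) with hMdef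
  have hM : ∀ x ∈ Icc (0:ℝ) 1, |iteratedDerivWithin 4 η (Icc (0:ℝ) 1) x| ≤ M := by
    intro x hx
    apply le_csSup
    · apply IsCompact.bddAbove_image isCompact_Icc
      exact (hη.continuousOn_iteratedDerivWithin (m := 4) le_rfl
        (uniqueDiffOn_Icc zero_lt_one)).abs
    · exact ⟨x, hx, rfl⟩
  have hM0 : 0 ≤ M := (abs_nonneg _).trans (hM 0 (by simp))
  obtain ⟨A, hA⟩ : ∃ A : ℕ → ℝ, A = fun k : ℕ => ∫ t in (0:ℝ)..1, η (((k:ℝ) + t)/N) := ⟨_, rfl⟩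
  obtain ⟨B, hB⟩ : ∃ B : ℕ → ℝ, B = fun k : ℕ => ∫ t in (0:ℝ)..1, η (((k:ℝ) + t)/N) * t :=
    ⟨_, rfl⟩
  obtain ⟨D, hD⟩ : ∃ D : ℕ → ℝ, D = fun k : ℕ => ∫ t in (0:ℝ)..1,
    (fun y => η y - p y) (((k:ℝ) + t)/N) := ⟨_, rfl⟩
  obtain ⟨E, hE⟩ : ∃ E : ℕ → ℝ, E = fun k : ℕ => ∫ t in (0:ℝ)..1,
    (fun y => η y - p y) (((k:ℝ) + t)/N) * t := ⟨_, rfl⟩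
  obtain ⟨c, hc⟩ : ∃ c : ℕ → ℝ, c = fun k : ℕ => p ((k:ℝ)/N) := ⟨_, rfl⟩
  have hDA : ∀ k < N, D k = A k - (c k + c (k+1)) / 2 := by
    intro k hk
    rw [hD, hA, hc]
    exact (proj_moments N p η hproj.1 hηc k hk).1
  have hEB : ∀ k < N, E k = B k - (c k / 6 + c (k+1) / 3) := by
    intro k hk
    rw [hE, hB, hc]
    exact (proj_moments N p η hproj.1 hηc k hk).2
  have horth : ∀ j, ∑ k ∈ Finset.range N,
      ((if k = j then D k - E k else 0) + (if k + 1 = j then E k else 0)) = 0 := fun j =>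
    orth N j hN0 (fun y => η y - p y) (hηc.sub hpc) (hproj.2 _ (hatf_mem N j hN0)) D E hD hE
  have o0 : D 0 - E 0 = 0 := by
    have := horth 0
    simpa [hN0, Finset.sum_ite_eq'] using this
  have oI : ∀ j, j + 1 < N → D (j+1) - E (j+1) + E j = 0 := by
    intro j hj
    have := horth (j+1)
    simpa [Finset.sum_add_distrib, Finset.sum_ite_eq', hj, (by omega : j < N)] using this
  have oN : ∀ j, j + 1 = N → E j = 0 := by
    intro j hj
    have := horth (j+1)
    simpa [Finset.sum_add_distrib, Finset.sum_ite_eq', (by omega : j < N),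
      if_neg (by omega : ¬ (j + 1 < N))] using this
  obtain ⟨ε, hε⟩ : ∃ ε : ℝ, ε = 16 * M * (1/(N:ℝ))^4 := ⟨_, rfl⟩
  have hε0 : 0 ≤ ε := by rw [hε]; positivity
  have hT := fun j hj => cell_taylor η hη M hM N j hN0 hj A B hA hB
  rw [← hε] at hT
  obtain ⟨i, hi, hmax⟩ := Finset.exists_max_image (Finset.range N) (fun k => |D k|)
    ⟨0, Finset.mem_range.2 hN0⟩
  have hi := Finset.mem_range.1 hi
  have hmax : ∀ k < N, |D k| ≤ |D i| := fun k hk => hmax k (Finset.mem_range.2 hk)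
  have main : |D i| ≤ 5 * ε := by
    rcases Nat.eq_zero_or_pos i with h0 | h0
    · subst h0
      obtain ⟨α, β, γ, δ, hβ, hδ, hk⟩ := hT 0 (by omega)
      have hβ := hβ (by simpa using h10)
      have hδ := hδ (by simpa using h30)
      subst hβ hδ
      obtain ⟨a0, b0⟩ := hk 0 (by omega) 0 (by simp) (by norm_num) (by norm_num)
      obtain ⟨a1, b1⟩ := hk 1 (by omega) 1 (by simp) (by norm_num) (by norm_num)
      have m1 := hmax 1 (by omega)
      have d0 := hDA 0 (by omega)
      have d1 := hDA 1 (by omega)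
      have e0 := hEB 0 (by omega)
      have e1 := hEB 1 (by omega)
      have o1 := oI 0 (by omega)
      simp only [zero_add, Nat.reduceAdd] at d0 d1 e0 e1 o1
      rw [abs_le] at a0 b0 a1 b1
      have key : 5 * D 0 + D 1 = - A 0 + 3 * B 0 - 2 * A 1 + 3 * B 1 := by linarith
      have m1' := abs_le.1 m1
      rcases abs_cases (D 0) with h | h <;> linarith [h.1, h.2, m1'.1, m1'.2, a0.1, a0.2, b0.1, b0.2, a1.1, a1.2, b1.1, b1.2]
    · obtain ⟨l, rfl⟩ : ∃ l, i = l + 1 := ⟨i - 1, by omega⟩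
      have ml := abs_le.1 (hmax l (by omega))
      have d0 := hDA l (by omega)
      have e0 := hEB l (by omega)
      have d1 := hDA (l+1) (by omega)
      have e1 := hEB (l+1) (by omega)
      have o1 := oI l (by omega)
      by_cases hlast : l + 2 = N
      · obtain ⟨α, β, γ, δ, hβ, hδ, hk⟩ := hT N le_rfl
        have hβ := hβ (by rw [div_self hN'.ne']; exact h11)
        have hδ := hδ (by rw [div_self hN'.ne']; exact h31)
        subst hβ hδ
        have hlN : (N:ℝ) = l + 2 := by rw [← hlast]; push_cast; ring
        obtain ⟨a0, b0⟩ := hk l (by omega) (-2) (by rw [hlN]; ring) (by norm_num) (by norm_num)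
        obtain ⟨a1, b1⟩ := hk (l+1) (by omega) (-1) (by rw [hlN]; push_cast; ring)
          (by norm_num) (by norm_num)
        have o2 := oN (l+1) (by omega)
        rw [abs_le] at a0 b0 a1 b1
        have key : D l + 5 * D (l+1) = A l - 3 * B l + 2 * A (l+1) - 3 * B (l+1) := by linarith
        rcases abs_cases (D (l+1)) with h | h <;> linarith [h.1, h.2, ml.1, ml.2, a0.1, a0.2, b0.1, b0.2, a1.1, a1.2, b1.1, b1.2]
      · obtain ⟨α, β, γ, δ, -, -, hk⟩ := hT (l+1) (by omega)
        obtain ⟨a0, b0⟩ := hk l (by omega) (-1) (by push_cast; ring) (by norm_num) (by norm_num)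
        obtain ⟨a1, b1⟩ := hk (l+1) (by omega) 0 (by push_cast; ring)
          (by norm_num) (by norm_num)
        obtain ⟨a2, b2⟩ := hk (l+2) (by omega) 1 (by push_cast; ring)
          (by norm_num) (by norm_num)
        have mr := abs_le.1 (hmax (l+2) (by omega))
        have d2 := hDA (l+2) (by omega)
        have e2 := hEB (l+2) (by omega)
        have o2 := oI (l+1) (by omega)
        simp only [add_assoc, Nat.reduceAdd] at d0 d1 d2 e0 e1 e2 o1 o2 a0 a1 a2 b0 b1 b2 ml mr ⊢
        rw [abs_le] at a0 b0 a1 b1 a2 b2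
        have key : D l + 4 * D (l+1) + D (l+2)
          = A l + A (l+1) - 2 * A (l+2) - 3 * B l + 3 * B (l+2) := by linarith
        rcases abs_cases (D (l+1)) with h | h <;> linarith [h.1, h.2, ml.1, ml.2, mr.1, mr.2, a0.1, a0.2, b0.1, b0.2, a1.1, a1.2, b1.1, b1.2, a2.1, a2.2, b2.1, b2.2]
  intro k hk
  rw [cell_subst N hN0 k (fun y => η y - p y)]
  have hDk : ∫ t in (0:ℝ)..1, (fun y => η y - p y) (((k:ℝ) + t)/N) = D k := by rw [hD]
  rw [hDk, abs_mul, abs_of_pos (by positivity)]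
  have : |D k| ≤ 5 * ε := (hmax k hk).trans main
  calc 1 / (N:ℝ) * |D k| ≤ 1 / (N:ℝ) * (5 * ε) := by gcongr
    _ = _ := by rw [hε]; ring
end
end

section
/- Let w ∈ C²[0,1], and let η ∈ C⁴[0,1] with η'(0) = η'(1) = 0 and η'''(0) = η'''(1) = 0, and set ρ = η − Pη. Then there exists a constant C, depending on w and η but not on N, such that for all N ≥ 2, max_{1≤i≤N} |∫_{I_i} w(x) ρ(x) dx| ≤ C h⁵. -/
noncomputable section
open Set

lemma taylor_step {f f' : ℝ → ℝ} {K c x : ℝ} (n : ℕ) (hK : 0 ≤ K)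
    (hf : ∀ y ∈ Icc (0:ℝ) 1, HasDerivWithinAt f (f' y) (Icc (0:ℝ) 1) y)
    (hc : c ∈ Icc (0:ℝ) 1) (hx : x ∈ Icc (0:ℝ) 1)
    (hb : ∀ y ∈ Icc (0:ℝ) 1, |f' y| ≤ K * |y - c| ^ n) (h0 : f c = 0) :
    |f x| ≤ K * |x - c| ^ (n + 1) := by
  have hsub : uIcc c x ⊆ Icc (0:ℝ) 1 := by
    rw [← uIcc_of_le (zero_le_one' ℝ)] at *
    exact uIcc_subset_uIcc hc hx
  have := Convex.norm_image_sub_le_of_norm_hasDerivWithin_le (f := f) (f' := f') (s := uIcc c x)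
    (C := K * |x - c| ^ n) (x := c) (y := x)
    (fun y hy => (hf y (hsub hy)).mono hsub)
    (fun y hy => by
      refine (hb y (hsub hy)).trans ?_
      have : |y - c| ≤ |x - c| := abs_sub_left_of_mem_uIcc hy
      gcongr)
    (convex_uIcc c x) left_mem_uIcc right_mem_uIcc
  rw [h0, sub_zero, Real.norm_eq_abs, Real.norm_eq_abs] at this
  rw [pow_succ, ← mul_assoc]; exact this

lemma taylor1 {f f' : ℝ → ℝ} {K : ℝ} (hK : 0 ≤ K)
    (hf : ∀ y ∈ Icc (0:ℝ) 1, HasDerivWithinAt f (f' y) (Icc (0:ℝ) 1) y)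
    (hb : ∀ y ∈ Icc (0:ℝ) 1, |f' y| ≤ K) {c x : ℝ}
    (hc : c ∈ Icc (0:ℝ) 1) (hx : x ∈ Icc (0:ℝ) 1) :
    |f x - f c| ≤ K * |x - c| := by
  have := taylor_step (f := fun y => f y - f c) (f' := f') 0 hK
    (fun y hy => (hf y hy).sub_const _) hc hx (by simpa using hb) (by simp)
  simpa using this

lemma taylor2 {f f' f'' : ℝ → ℝ} {K : ℝ} (hK : 0 ≤ K)
    (hf : ∀ y ∈ Icc (0:ℝ) 1, HasDerivWithinAt f (f' y) (Icc (0:ℝ) 1) y)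
    (hf' : ∀ y ∈ Icc (0:ℝ) 1, HasDerivWithinAt f' (f'' y) (Icc (0:ℝ) 1) y)
    (hb : ∀ y ∈ Icc (0:ℝ) 1, |f'' y| ≤ K) {c x : ℝ}
    (hc : c ∈ Icc (0:ℝ) 1) (hx : x ∈ Icc (0:ℝ) 1) :
    |f x - f c - f' c * (x - c)| ≤ K * |x - c| ^ 2 := by
  refine taylor_step (f := fun y => f y - f c - f' c * (y - c)) (f' := fun y => f' y - f' c) 1 hK
    (fun y hy => ?_) hc hx (fun y hy => by simpa using taylor1 hK hf' hb hc hy) (by simp)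
  have h1 := ((hf y hy).sub_const (f c)).sub
    (((hasDerivWithinAt_id y _).sub_const c).const_mul (f' c))
  exact h1.congr_deriv (by simp)

lemma taylor4 {f f1 f2 f3 f4 : ℝ → ℝ} {K : ℝ} (hK : 0 ≤ K)
    (h0 : ∀ y ∈ Icc (0:ℝ) 1, HasDerivWithinAt f (f1 y) (Icc (0:ℝ) 1) y)
    (h1 : ∀ y ∈ Icc (0:ℝ) 1, HasDerivWithinAt f1 (f2 y) (Icc (0:ℝ) 1) y)
    (h2 : ∀ y ∈ Icc (0:ℝ) 1, HasDerivWithinAt f2 (f3 y) (Icc (0:ℝ) 1) y)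
    (h3 : ∀ y ∈ Icc (0:ℝ) 1, HasDerivWithinAt f3 (f4 y) (Icc (0:ℝ) 1) y)
    (hb : ∀ y ∈ Icc (0:ℝ) 1, |f4 y| ≤ K) {c x : ℝ}
    (hc : c ∈ Icc (0:ℝ) 1) (hx : x ∈ Icc (0:ℝ) 1) :
    |f x - (f c + f1 c * (x - c) + f2 c / 2 * (x - c) ^ 2 + f3 c / 6 * (x - c) ^ 3)|
      ≤ K * |x - c| ^ 4 := by
  have key : ∀ y ∈ Icc (0:ℝ) 1,
      |f1 y - (f1 c + f2 c * (y - c) + f3 c / 2 * (y - c) ^ 2)| ≤ K * |y - c| ^ 3 := by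
    intro y hy
    refine taylor_step (f := fun y => f1 y - (f1 c + f2 c * (y - c) + f3 c / 2 * (y - c) ^ 2))
      (f' := fun y => f2 y - f2 c - f3 c * (y - c)) 2 hK
      (fun y hy => ?_) hc hy (fun y hy => taylor2 hK h2 h3 hb hc hy) (by simp)
    have hp : HasDerivAt (fun y => f1 c + f2 c * (y - c) + f3 c / 2 * (y - c) ^ 2)
        (f2 c + f3 c * (y - c)) y := by
      have e := (hasDerivAt_id y).sub_const c
      have := ((e.const_mul (f2 c)).const_add (f1 c)).add ((e.pow 2).const_mul (f3 c / 2))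
      refine this.congr_deriv ?_
      simp; ring
    refine ((h1 y hy).sub hp.hasDerivWithinAt).congr_deriv (by ring)
  refine taylor_step (f := fun x => f x - (f c + f1 c * (x - c) + f2 c / 2 * (x - c) ^ 2
      + f3 c / 6 * (x - c) ^ 3))
      (f' := fun y => f1 y - (f1 c + f2 c * (y - c) + f3 c / 2 * (y - c) ^ 2)) 3 hK
      (fun y hy => ?_) hc hx key (by simp)
  have hp : HasDerivAt (fun x => f c + f1 c * (x - c) + f2 c / 2 * (x - c) ^ 2
      + f3 c / 6 * (x - c) ^ 3)
      (f1 c + f2 c * (y - c) + f3 c / 2 * (y - c) ^ 2) y := by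
    have e := (hasDerivAt_id y).sub_const c
    have := (((e.const_mul (f1 c)).const_add (f c)).add ((e.pow 2).const_mul (f2 c / 2))).add
      ((e.pow 3).const_mul (f3 c / 6))
    refine this.congr_deriv ?_
    simp; ring
  exact (h0 y hy).sub hp.hasDerivWithinAt

lemma poly_int (p h c0 c1 c2 c3 : ℝ) (hh : h ≠ 0) :
    ∫ y in p..(p + h), (c0 + c1 * (y - p) + c2 / 2 * (y - p) ^ 2 + c3 / 6 * (y - p) ^ 3)
        * ((p + h - y) / h)
      = h * (c0 / 2 + h * c1 / 6 + h ^ 2 * c2 / 24 + h ^ 3 * c3 / 120) := by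
  have hd : ∀ y ∈ uIcc p (p + h), HasDerivAt (fun y => c0 * ((y - p) - (y - p) ^ 2 / (2 * h))
      + c1 * ((y - p) ^ 2 / 2 - (y - p) ^ 3 / (3 * h))
      + c2 / 2 * ((y - p) ^ 3 / 3 - (y - p) ^ 4 / (4 * h))
      + c3 / 6 * ((y - p) ^ 4 / 4 - (y - p) ^ 5 / (5 * h)))
      ((c0 + c1 * (y - p) + c2 / 2 * (y - p) ^ 2 + c3 / 6 * (y - p) ^ 3)
        * ((p + h - y) / h)) y := by
    intro y _
    have e := (hasDerivAt_id y).sub_const p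
    have := (((((e.sub ((e.pow 2).div_const (2 * h))).const_mul c0).add
      ((((e.pow 2).div_const 2).sub ((e.pow 3).div_const (3 * h))).const_mul c1)).add
      ((((e.pow 3).div_const 3).sub ((e.pow 4).div_const (4 * h))).const_mul (c2 / 2))).add
      ((((e.pow 4).div_const 4).sub ((e.pow 5).div_const (5 * h))).const_mul (c3 / 6)))
    refine this.congr_deriv ?_
    simp
    field_simp
    ring
  rw [intervalIntegral.integral_eq_sub_of_hasDerivAt hd
    (Continuous.intervalIntegrable (by fun_prop) _ _)]
  field_simp
  ring

lemma cell {f f1 f2 f3 f4 : ℝ → ℝ} {K : ℝ} (hK : 0 ≤ K)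
    (h0 : ∀ y ∈ Icc (0:ℝ) 1, HasDerivWithinAt f (f1 y) (Icc (0:ℝ) 1) y)
    (h1 : ∀ y ∈ Icc (0:ℝ) 1, HasDerivWithinAt f1 (f2 y) (Icc (0:ℝ) 1) y)
    (h2 : ∀ y ∈ Icc (0:ℝ) 1, HasDerivWithinAt f2 (f3 y) (Icc (0:ℝ) 1) y)
    (h3 : ∀ y ∈ Icc (0:ℝ) 1, HasDerivWithinAt f3 (f4 y) (Icc (0:ℝ) 1) y)
    (hb : ∀ y ∈ Icc (0:ℝ) 1, |f4 y| ≤ K) {p h : ℝ} (hh : h ≠ 0)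
    (hc : p ∈ Icc (0:ℝ) 1) (hx : p + h ∈ Icc (0:ℝ) 1) :
    |(∫ y in p..(p + h), f y * ((p + h - y) / h)) - h * (f p / 3 + f (p + h) / 6)
      + h ^ 3 / 12 * (f2 p / 3 + f2 (p + h) / 6) + h ^ 4 * f3 p / 180| ≤ 2 * K * |h| ^ 5 := by
  have hsub : uIcc p (p + h) ⊆ Icc (0:ℝ) 1 := by
    rw [← uIcc_of_le (zero_le_one' ℝ)] at *
    exact uIcc_subset_uIcc hc hx
  have hcont : ContinuousOn f (uIcc p (p + h)) :=
    fun y hy => ((h0 y (hsub hy)).continuousWithinAt).mono hsub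
  have hT := poly_int p h (f p) (f1 p) (f2 p) (f3 p) hh
  have hR : |(∫ y in p..(p + h), f y * ((p + h - y) / h)) -
      h * (f p / 2 + h * f1 p / 6 + h ^ 2 * f2 p / 24 + h ^ 3 * f3 p / 120)| ≤ K * |h| ^ 5 := by
    rw [← hT, ← intervalIntegral.integral_sub]
    rotate_left
    · exact (hcont.mul (by fun_prop)).intervalIntegrable
    · exact (Continuous.intervalIntegrable (by fun_prop) _ _)
    have := intervalIntegral.norm_integral_le_of_norm_le_const (a := p) (b := p + h)
      (C := K * |h| ^ 4) (f := fun y => f y * ((p + h - y) / h) -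
        (f p + f1 p * (y - p) + f2 p / 2 * (y - p) ^ 2 + f3 p / 6 * (y - p) ^ 3)
        * ((p + h - y) / h)) ?_
    · rw [Real.norm_eq_abs, add_sub_cancel_left, mul_assoc, ← pow_succ] at this
      exact this
    · intro y hy
      have hy' := uIoc_subset_uIcc hy
      have t := taylor4 hK h0 h1 h2 h3 hb hc (hsub hy')
      have e1 : |y - p| ≤ |h| := by simpa using abs_sub_left_of_mem_uIcc hy'
      have e2 : |p + h - y| ≤ |h| := by simpa using abs_sub_right_of_mem_uIcc hy'
      rw [← sub_mul, Real.norm_eq_abs, abs_mul, abs_div]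
      have e3 : |p + h - y| / |h| ≤ 1 := (div_le_one (abs_pos.2 hh)).2 e2
      calc _ ≤ (K * |y - p| ^ 4) * 1 := by gcongr
        _ ≤ _ := by rw [mul_one]; gcongr
  have hA := taylor4 hK h0 h1 h2 h3 hb hc hx
  have hB := taylor2 hK h2 h3 hb hc hx
  simp only [add_sub_cancel_left] at hA hB
  set I := ∫ y in p..(p + h), f y * ((p + h - y) / h)
  set A := f (p + h) - (f p + f1 p * h + f2 p / 2 * h ^ 2 + f3 p / 6 * h ^ 3) with hAd
  set B := f2 (p + h) - f2 p - f3 p * h with hBd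
  set R := I - h * (f p / 2 + h * f1 p / 6 + h ^ 2 * f2 p / 24 + h ^ 3 * f3 p / 120) with hRd
  have e : I - h * (f p / 3 + f (p + h) / 6)
      + h ^ 3 / 12 * (f2 p / 3 + f2 (p + h) / 6) + h ^ 4 * f3 p / 180
      = R - h / 6 * A + h ^ 3 / 72 * B := by
    rw [hRd, hAd, hBd]; ring
  rw [e]
  have b1 : |h / 6 * A| ≤ |h| / 6 * (K * |h| ^ 4) := by
    rw [abs_mul, abs_div]; norm_num; gcongr
  have b2 : |h ^ 3 / 72 * B| ≤ |h| ^ 3 / 72 * (K * |h| ^ 2) := by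
    rw [abs_mul, abs_div, abs_pow, abs_of_pos (by norm_num : (0:ℝ) < 72)]; gcongr
  have b3 : 0 ≤ K * |h| ^ 5 := by positivity
  calc _ ≤ |R| + |h / 6 * A| + |h ^ 3 / 72 * B| :=
        (abs_add_le _ _).trans (by gcongr; exact abs_sub _ _)
    _ ≤ K * |h| ^ 5 + |h| / 6 * (K * |h| ^ 4) + |h| ^ 3 / 72 * (K * |h| ^ 2) := by gcongr
    _ ≤ _ := by nlinarith

lemma max_arg (N : ℕ) (hN : 1 ≤ N) (e : ℕ → ℝ) (D : ℝ) (h0 : |2 * e 0 + e 1| ≤ D)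
    (hi : ∀ i, i + 1 < N → |e i + 4 * e (i + 1) + e (i + 2)| ≤ D)
    (hl : |e (N - 1) + 2 * e N| ≤ D) : ∀ j ≤ N, |e j| ≤ D := by
  obtain ⟨m, hm, hmax⟩ := Finset.exists_max_image (Finset.range (N + 1)) (fun j => |e j|) ⟨0, by simp⟩
  have hmax' : ∀ j ≤ N, |e j| ≤ |e m| := fun j hj => hmax j (by simp; omega)
  have hmN : m ≤ N := by simp at hm; omega
  suffices |e m| ≤ D from fun j hj => (hmax' j hj).trans this
  rcases Nat.eq_zero_or_pos m with rfl | hpos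
  · have := hmax' 1 hN
    rw [abs_le] at h0 this
    rcases abs_cases (e 0) with ⟨h, _⟩ | ⟨h, _⟩ <;> rw [h] at this ⊢ <;> linarith
  · rcases eq_or_lt_of_le hmN with rfl | hlt
    · have := hmax' (m - 1) (by omega)
      rw [abs_le] at hl this
      rcases abs_cases (e m) with ⟨h, _⟩ | ⟨h, _⟩ <;> rw [h] at this ⊢ <;> linarith
    · obtain ⟨k, rfl⟩ : ∃ k, m = k + 1 := ⟨m - 1, by omega⟩
      have q := hi k hlt
      have a1 := hmax' k (by omega)
      have a2 := hmax' (k + 2) (by omega)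
      rw [abs_le] at q a1 a2
      rcases abs_cases (e (k + 1)) with ⟨h, _⟩ | ⟨h, _⟩ <;> rw [h] at a1 a2 ⊢ <;> linarith

lemma cell_rho {f f1 f2 f3 f4 g : ℝ → ℝ} {K : ℝ} (hK : 0 ≤ K)
    (h0 : ∀ y ∈ Icc (0:ℝ) 1, HasDerivWithinAt f (f1 y) (Icc (0:ℝ) 1) y)
    (h1 : ∀ y ∈ Icc (0:ℝ) 1, HasDerivWithinAt f1 (f2 y) (Icc (0:ℝ) 1) y)
    (h2 : ∀ y ∈ Icc (0:ℝ) 1, HasDerivWithinAt f2 (f3 y) (Icc (0:ℝ) 1) y)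
    (h3 : ∀ y ∈ Icc (0:ℝ) 1, HasDerivWithinAt f3 (f4 y) (Icc (0:ℝ) 1) y)
    (hb : ∀ y ∈ Icc (0:ℝ) 1, |f4 y| ≤ K) {p h : ℝ} (hh : h ≠ 0)
    (hc : p ∈ Icc (0:ℝ) 1) (hx : p + h ∈ Icc (0:ℝ) 1)
    (hg : ∀ y ∈ uIcc p (p + h), g y = g p + (g (p + h) - g p) / h * (y - p)) :
    |(∫ y in p..(p + h), (f y - g y) * ((p + h - y) / h))
      + h * ((g p - f p + h ^ 2 / 12 * f2 p) / 3
        + (g (p + h) - f (p + h) + h ^ 2 / 12 * f2 (p + h)) / 6)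
      + h ^ 4 * f3 p / 180| ≤ 2 * K * |h| ^ 5 := by
  have hsub : uIcc p (p + h) ⊆ Icc (0:ℝ) 1 := by
    rw [← uIcc_of_le (zero_le_one' ℝ)] at *
    exact uIcc_subset_uIcc hc hx
  have hcont : ContinuousOn f (uIcc p (p + h)) :=
    fun y hy => ((h0 y (hsub hy)).continuousWithinAt).mono hsub
  have hT := poly_int p h (g p) ((g (p + h) - g p) / h) 0 0 hh
  have hC := cell hK h0 h1 h2 h3 hb hh hc hx
  have e : (∫ y in p..(p + h), (f y - g y) * ((p + h - y) / h)) =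
      (∫ y in p..(p + h), f y * ((p + h - y) / h)) - h * (g p / 3 + g (p + h) / 6) := by
    have : h * (g p / 3 + g (p + h) / 6) = h * (g p / 2 + h * ((g (p + h) - g p) / h) / 6
        + h ^ 2 * 0 / 24 + h ^ 3 * 0 / 120) := by field_simp; ring
    rw [this, ← hT, ← intervalIntegral.integral_sub]
    rotate_left
    · exact (hcont.mul (by fun_prop)).intervalIntegrable
    · exact (Continuous.intervalIntegrable (by fun_prop) _ _)
    refine intervalIntegral.integral_congr (fun y hy => ?_)
    simp only [hg y hy]
    ring
  rw [e]
  convert hC using 2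
  ring

lemma hat_mem_s9 (N : ℕ) (hN : 0 < N) (j : ℕ) :
    (fun y : ℝ => max 0 (1 - |(N:ℝ) * y - j|)) ∈ PL N := by
  have hN' : (0:ℝ) < N := by exact_mod_cast hN
  refine ⟨by fun_prop, fun i hi => ?_⟩
  have hy : ∀ y ∈ Icc ((i : ℝ)/N) (((i : ℝ)+1)/N), (i:ℝ) ≤ N * y ∧ N * y ≤ i + 1 := by
    intro y hy
    rw [mem_Icc, div_le_iff₀ hN', le_div_iff₀ hN'] at hy
    constructor <;> linarith [hy.1, hy.2]
  rcases lt_trichotomy i j with h | h | h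
  · rcases eq_or_lt_of_le (Nat.succ_le_of_lt h) with h' | h'
    · refine ⟨N, 1 - j, fun y hyy => ?_⟩
      have h'' : (j:ℝ) = i + 1 := by rw [← h']; push_cast; rfl
      have := hy y hyy
      simp only
      rw [abs_of_nonpos (by linarith), max_eq_right (by linarith)]; ring
    · refine ⟨0, 0, fun y hyy => ?_⟩
      have h'' : (i:ℝ) + 2 ≤ j := by exact_mod_cast h'
      have := hy y hyy
      simp only
      rw [abs_of_nonpos (by linarith), max_eq_left (by linarith)]; ring
  · subst h
    refine ⟨-N, 1 + i, fun y hyy => ?_⟩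
    have := hy y hyy
    simp only
    rw [abs_of_nonneg (by linarith), max_eq_right (by linarith)]; ring
  · refine ⟨0, 0, fun y hyy => ?_⟩
    have h'' : (j:ℝ) + 1 ≤ i := by exact_mod_cast h
    have := hy y hyy
    simp only
    rw [abs_of_nonneg (by linarith), max_eq_left (by linarith)]; ring

lemma cell_mem (N : ℕ) (hN : 0 < N) (i : ℕ) (hi : i < N) :
    Icc ((i : ℝ)/N) (((i : ℝ)+1)/N) ⊆ Icc (0:ℝ) 1 := by
  have hN' : (0:ℝ) < N := by exact_mod_cast hN
  have : (i:ℝ) + 1 ≤ N := by exact_mod_cast hi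
  exact Icc_subset_Icc (by positivity) (by rw [div_le_one hN']; exact this)

lemma hat_int_s9 (N : ℕ) (hN : 0 < N) (j : ℕ) (ρ : ℝ → ℝ) (hρ : ContinuousOn ρ (Icc (0:ℝ) 1)) :
    ∫ y in (0:ℝ)..1, ρ y * max 0 (1 - |(N:ℝ) * y - j|) =
      ∑ i ∈ Finset.range N,
        ((if i = j then ∫ y in ((i : ℝ)/N)..(((i : ℝ)+1)/N), ρ y * (i + 1 - N * y) else 0) +
        (if i + 1 = j then ∫ y in ((i : ℝ)/N)..(((i : ℝ)+1)/N), ρ y * (N * y - i) else 0)) := by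
  have hN' : (0:ℝ) < N := by exact_mod_cast hN
  have hs := intervalIntegral.sum_integral_adjacent_intervals (μ := MeasureTheory.volume)
    (f := fun y => ρ y * max 0 (1 - |(N:ℝ) * y - j|)) (a := fun i : ℕ => (i:ℝ) / N) (n := N)
    (fun k hk => by
      push_cast
      refine ContinuousOn.intervalIntegrable ?_
      rw [uIcc_of_le (by gcongr; linarith)]
      exact (hρ.mono (cell_mem N hN k hk)).mul (by fun_prop))
  simp only [Nat.cast_zero, zero_div, div_self hN'.ne'] at hs
  rw [← hs]
  refine Finset.sum_congr rfl (fun i hi => ?_)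
  push_cast
  have hle : (i : ℝ)/N ≤ ((i : ℝ)+1)/N := by gcongr; linarith
  have hy : ∀ y ∈ uIcc ((i : ℝ)/N) (((i : ℝ)+1)/N), (i:ℝ) ≤ N * y ∧ N * y ≤ i + 1 := by
    intro y hy
    rw [uIcc_of_le hle, mem_Icc, div_le_iff₀ hN', le_div_iff₀ hN'] at hy
    constructor <;> linarith [hy.1, hy.2]
  rcases lt_trichotomy i j with h | h | h
  · rw [if_neg h.ne, zero_add]
    rcases eq_or_lt_of_le (Nat.succ_le_of_lt h) with h' | h'
    · rw [if_pos h']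
      refine intervalIntegral.integral_congr (fun y hyy => ?_)
      have h'' : (j:ℝ) = i + 1 := by rw [← h']; push_cast; rfl
      have := hy y hyy
      rw [abs_of_nonpos (by linarith), max_eq_right (by linarith), h'']; ring
    · rw [if_neg h'.ne, intervalIntegral.integral_congr (g := fun _ => 0)]
      · simp
      intro y hyy
      have h'' : (i:ℝ) + 2 ≤ j := by exact_mod_cast h'
      have := hy y hyy
      simp only
      rw [abs_of_nonpos (by linarith), max_eq_left (by linarith)]; ring
  · subst h
    rw [if_pos rfl, if_neg (by omega), add_zero]
    refine intervalIntegral.integral_congr (fun y hyy => ?_)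
    have := hy y hyy
    rw [abs_of_nonneg (by linarith), max_eq_right (by linarith)]; ring
  · rw [if_neg h.ne', if_neg (by omega), intervalIntegral.integral_congr (g := fun _ => 0)]
    · simp
    intro y hyy
    have h'' : (j:ℝ) + 1 ≤ i := by exact_mod_cast h
    have := hy y hyy
    simp only
    rw [abs_of_nonneg (by linarith), max_eq_left (by linarith)]; ring

lemma ortho (N : ℕ) (hN : 0 < N) (f g : ℝ → ℝ) (hf : ContinuousOn f (Icc (0:ℝ) 1))
    (hg : IsL2ProjOn (PL N) f g) (A B : ℕ → ℝ)
    (hA : ∀ i, A i = ∫ y in ((i : ℝ)/N)..(((i : ℝ)+1)/N), (f y - g y) * (i + 1 - N * y))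
    (hB : ∀ i, B i = ∫ y in ((i : ℝ)/N)..(((i : ℝ)+1)/N), (f y - g y) * (N * y - i)) :
    A 0 = 0 ∧ B (N - 1) = 0 ∧ ∀ i, i + 1 < N → B i + A (i + 1) = 0 := by
  have key : ∀ j, ∑ i ∈ Finset.range N,
      ((if i = j then A i else 0) + (if i + 1 = j then B i else 0)) = 0 := by
    intro j
    have := hat_int_s9 N hN j (fun y => f y - g y) (hf.sub hg.1.1)
    have h2 := hg.2 _ (hat_mem_s9 N hN j)
    unfold ip at h2
    rw [h2] at this
    simp only [hA, hB]
    exact this.symm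
  have keyB : ∀ k, k < N → ∑ i ∈ Finset.range N, (if i + 1 = k + 1 then B i else 0) = B k := by
    intro k hk
    simp [hk]
  refine ⟨?_, ?_, fun i hi => ?_⟩
  · have := key 0
    simpa [Finset.sum_add_distrib, hN] using this
  · have := key (N - 1 + 1)
    rw [Finset.sum_add_distrib, keyB _ (by omega)] at this
    simpa [Nat.sub_add_cancel hN] using this
  · have := key (i + 1)
    rw [Finset.sum_add_distrib, keyB _ (by omega)] at this
    simp [hi] at this
    linarith

lemma pl_repr (N : ℕ) (hN : 0 < N) (g : ℝ → ℝ) (hg : g ∈ PL N) (i : ℕ) (hi : i < N)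
    (x z : ℝ) (hx : x ∈ Icc ((i : ℝ)/N) (((i : ℝ)+1)/N))
    (hz : z ∈ Icc ((i : ℝ)/N) (((i : ℝ)+1)/N)) (hxz : z ≠ x)
    (y : ℝ) (hy : y ∈ Icc ((i : ℝ)/N) (((i : ℝ)+1)/N)) :
    g y = g x + (g z - g x) / (z - x) * (y - x) := by
  obtain ⟨a, b, hab⟩ := hg.2 i hi
  rw [hab y hy, hab x hx, hab z hz]
  have : z - x ≠ 0 := sub_ne_zero.2 hxz
  field_simp
  ring

set_option maxHeartbeats 1600000 in
lemma main_bound {f f1 f2 f3 f4 g : ℝ → ℝ} {K : ℝ} (hK : 0 ≤ K)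
    (h0 : ∀ y ∈ Icc (0:ℝ) 1, HasDerivWithinAt f (f1 y) (Icc (0:ℝ) 1) y)
    (h1 : ∀ y ∈ Icc (0:ℝ) 1, HasDerivWithinAt f1 (f2 y) (Icc (0:ℝ) 1) y)
    (h2 : ∀ y ∈ Icc (0:ℝ) 1, HasDerivWithinAt f2 (f3 y) (Icc (0:ℝ) 1) y)
    (h3 : ∀ y ∈ Icc (0:ℝ) 1, HasDerivWithinAt f3 (f4 y) (Icc (0:ℝ) 1) y)
    (b2 : ∀ y ∈ Icc (0:ℝ) 1, |f2 y| ≤ K)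
    (b3 : ∀ y ∈ Icc (0:ℝ) 1, |f3 y| ≤ K)
    (b4 : ∀ y ∈ Icc (0:ℝ) 1, |f4 y| ≤ K)
    (z0 : f3 0 = 0) (z1 : f3 1 = 0) (N : ℕ) (hN : 0 < N)
    (hg : IsL2ProjOn (PL N) f g) (i : ℕ) (hi : i < N) :
    |∫ y in ((i : ℝ)/N)..(((i : ℝ)+1)/N), (f y - g y)| ≤ 30 * K * (1 / (N:ℝ)) ^ 5 ∧
    |∫ y in ((i : ℝ)/N)..(((i : ℝ)+1)/N), (f y - g y) * (N * y - i)|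
      ≤ 15 * K * (1 / (N:ℝ)) ^ 4 ∧
    ∀ y ∈ Icc ((i : ℝ)/N) (((i : ℝ)+1)/N), |f y - g y| ≤ 27 * K * (1 / (N:ℝ)) ^ 2 := by
  have hN' : (0:ℝ) < N := by exact_mod_cast hN
  have hfc : ContinuousOn f (Icc (0:ℝ) 1) := fun y hy => (h0 y hy).continuousWithinAt
  have hNne : (N:ℝ) ≠ 0 := hN'.ne'
  obtain ⟨h, hh⟩ : ∃ h : ℝ, h = 1 / (N:ℝ) := ⟨_, rfl⟩
  have hpos : 0 < h := by rw [hh]; positivity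
  have hle1 : h ≤ 1 := by
    rw [hh, div_le_one hN']; exact_mod_cast hN
  have hNh : (N:ℝ) * h = 1 := by rw [hh]; field_simp
  set A : ℕ → ℝ := fun i => ∫ y in ((i : ℝ)/N)..(((i : ℝ)+1)/N), (f y - g y) * (i + 1 - N * y)
    with hA
  set B : ℕ → ℝ := fun i => ∫ y in ((i : ℝ)/N)..(((i : ℝ)+1)/N), (f y - g y) * (N * y - i)
    with hB
  obtain ⟨o1, o2, o3⟩ := ortho N hN f g hfc hg A B (fun _ => rfl) (fun _ => rfl)
  set E : ℝ → ℝ := fun x => g x - f x + h ^ 2 / 12 * f2 x with hE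
  set e : ℕ → ℝ := fun i => E ((i:ℝ) / N) with he
  have cle : ∀ i : ℕ, (i:ℝ)/N ≤ ((i:ℝ)+1)/N := fun i => by gcongr; linarith
  have mL : ∀ i : ℕ, i < N → (i:ℝ)/N ∈ Icc (0:ℝ) 1 := fun i hi =>
    cell_mem N hN i hi (left_mem_Icc.2 (cle i))
  have mR : ∀ i : ℕ, i < N → ((i:ℝ)+1)/N ∈ Icc (0:ℝ) 1 := fun i hi =>
    cell_mem N hN i hi (right_mem_Icc.2 (cle i))
  have pR : ∀ i : ℕ, (i:ℝ)/N + h = ((i:ℝ)+1)/N := fun i => by rw [hh]; ring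
  have pL : ∀ i : ℕ, ((i:ℝ)+1)/N + -h = (i:ℝ)/N := fun i => by rw [hh]; ring
  have hh1 : (1:ℝ) / N = h := hh.symm
  have eA : ∀ i < N, |A i + h * (e i / 3 + e (i + 1) / 6) + h ^ 4 * f3 ((i:ℝ)/N) / 180|
      ≤ 2 * K * h ^ 5 := by
    intro i hi
    have := cell_rho (g := g) hK h0 h1 h2 h3 b4 hpos.ne' (mL i hi) (by rw [pR]; exact mR i hi)
      (by
        rw [pR, uIcc_of_le (cle i)]
        intro y hy
        have := pl_repr N hN g hg.1 i hi _ _ (left_mem_Icc.2 (cle i)) (right_mem_Icc.2 (cle i))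
          (by rw [← pR]; linarith) y hy
        rw [this, show ((i:ℝ)+1)/N - (i:ℝ)/N = h by rw [← pR]; ring])
    rw [abs_of_pos hpos] at this
    convert this using 2
    rw [pR]
    congr 2
    · rw [hA]
      refine intervalIntegral.integral_congr (fun y _ => ?_)
      congr 1
      rw [hh]; field_simp
    · simp only [he, hE]; push_cast; rfl
  have eB : ∀ i < N, |B i + h * (e i / 6 + e (i + 1) / 3) - h ^ 4 * f3 (((i:ℝ)+1)/N) / 180|
      ≤ 2 * K * h ^ 5 := by
    intro i hi
    have := cell_rho (g := g) hK h0 h1 h2 h3 b4 (neg_ne_zero.2 hpos.ne') (mR i hi)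
      (by rw [pL]; exact mL i hi)
      (by
        rw [pL, uIcc_of_ge (cle i)]
        intro y hy
        have := pl_repr N hN g hg.1 i hi _ _ (right_mem_Icc.2 (cle i)) (left_mem_Icc.2 (cle i))
          (by rw [← pR]; linarith) y hy
        rw [this, show (i:ℝ)/N - ((i:ℝ)+1)/N = -h by rw [← pR]; ring])
    rw [abs_neg h, abs_of_pos hpos, ← abs_neg] at this
    convert this using 2
    rw [pL, intervalIntegral.integral_symm]
    have : B i = ∫ y in ((i : ℝ)/N)..(((i : ℝ)+1)/N), (f y - g y) * (((i:ℝ)/N - y) / -h) := by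
      rw [hB]
      refine intervalIntegral.integral_congr (fun y _ => ?_)
      congr 1
      rw [hh]; field_simp; ring
    rw [← this]
    simp only [he, hE]; push_cast; ring
  have cancel : ∀ X c : ℝ, |h * X| ≤ c * h ^ 5 → |X| ≤ c * h ^ 4 := by
    intro X c hX
    rw [abs_mul, abs_of_pos hpos] at hX
    refine le_of_mul_le_mul_left ?_ hpos
    linarith
  have hKh : 0 ≤ K * h ^ 4 := by positivity
  have hKh5 : 0 ≤ K * h ^ 5 := by positivity
  have ebd : ∀ j ≤ N, |e j| ≤ 24 * K * h ^ 4 := by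
    refine max_arg N hN e _ ?_ ?_ ?_
    · refine cancel _ _ ?_
      have := eA 0 hN
      rw [o1] at this
      simp only [Nat.cast_zero, zero_div, z0] at this
      rw [abs_le] at this ⊢
      constructor <;> linarith [this.1, this.2]
    · intro i hi
      refine cancel _ _ ?_
      have t1 := eA (i + 1) hi
      have t2 := eB i (by omega)
      have t3 := o3 i hi
      push_cast at t1
      rw [abs_le] at t1 t2 ⊢
      constructor <;> linarith [t1.1, t2.1, t1.2, t2.2]
    · refine cancel _ _ ?_
      have := eB (N - 1) (by omega)
      have hc1 : ((N - 1 : ℕ) : ℝ) + 1 = N := by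
        rw [← Nat.cast_succ, Nat.succ_eq_add_one, Nat.sub_add_cancel hN]
      rw [o2, hc1, div_self hNne, z1, Nat.sub_add_cancel hN] at this
      rw [abs_le] at this ⊢
      constructor <;> linarith [this.1, this.2]
  have e1 := abs_le.1 (ebd i hi.le)
  have e2 := abs_le.1 (ebd (i + 1) hi)
  have tA := abs_le.1 (eA i hi)
  have tB := abs_le.1 (eB i hi)
  have m1 : ∀ X : ℝ, |X| ≤ 24 * K * h ^ 4 → |h * X| ≤ 24 * K * h ^ 5 := by
    intro X hX
    rw [abs_mul, abs_of_pos hpos]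
    calc h * |X| ≤ h * (24 * K * h ^ 4) := by gcongr
      _ = _ := by ring
  have he1 := abs_le.1 (m1 _ (ebd i hi.le))
  have he2 := abs_le.1 (m1 _ (ebd (i + 1) hi))
  have h54 : K * h ^ 5 ≤ K * h ^ 4 := by
    have : h ^ 5 ≤ h ^ 4 := pow_le_pow_of_le_one hpos.le hle1 (by norm_num)
    gcongr
  have hcell := cell_mem N hN i hi
  have hgc : ContinuousOn (fun y => f y - g y) (uIcc ((i : ℝ)/N) (((i : ℝ)+1)/N)) := by
    rw [uIcc_of_le (cle i)]
    exact (hfc.sub hg.1.1).mono hcell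
  rw [hh1]
  refine ⟨?_, ?_, ?_⟩
  · have hsum : (∫ y in ((i : ℝ)/N)..(((i : ℝ)+1)/N), (f y - g y)) = A i + B i := by
      rw [hA, hB]
      simp only
      rw [← intervalIntegral.integral_add]
      rotate_left
      · exact (hgc.mul (by fun_prop)).intervalIntegrable
      · exact (hgc.mul (by fun_prop)).intervalIntegrable
      refine intervalIntegral.integral_congr (fun y _ => ?_)
      ring
    rw [hsum]
    have t := taylor1 hK h3 b4 (mL i hi) (mR i hi)
    rw [show ((i:ℝ)+1)/N - (i:ℝ)/N = h by rw [← pR]; ring, abs_of_pos hpos] at t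
    have t' : |h ^ 4 * (f3 (((i:ℝ)+1)/N) - f3 ((i:ℝ)/N))| ≤ K * h ^ 5 := by
      rw [abs_mul, abs_of_pos (by positivity : 0 < h ^ 4)]
      calc _ ≤ h ^ 4 * (K * h) := by gcongr
        _ = _ := by ring
    rw [abs_le] at t' ⊢
    constructor <;> linarith [t'.1, t'.2, tA.1, tA.2, tB.1, tB.2, he1.1, he1.2, he2.1, he2.2]
  · change |B i| ≤ _
    have t' : |h ^ 4 * f3 (((i:ℝ)+1)/N)| ≤ K * h ^ 4 := by
      rw [abs_mul, abs_of_pos (by positivity : 0 < h ^ 4), mul_comm]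
      gcongr
      exact b3 _ (mR i hi)
    rw [abs_le] at t' ⊢
    constructor <;> linarith [t'.1, t'.2, tB.1, tB.2, he1.1, he1.2, he2.1, he2.2]
  · intro y hy
    have hr := pl_repr N hN g hg.1 i hi _ _ (left_mem_Icc.2 (cle i)) (right_mem_Icc.2 (cle i))
          (by rw [← pR]; linarith) y hy
    rw [show ((i:ℝ)+1)/N - (i:ℝ)/N = h by rw [← pR]; ring] at hr
    have t1 := taylor2 hK h0 h1 b2 (mL i hi) (hcell hy)
    have t2 := taylor2 hK h0 h1 b2 (mL i hi) (mR i hi)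
    rw [show ((i:ℝ)+1)/N - (i:ℝ)/N = h by rw [← pR]; ring, abs_of_pos hpos] at t2
    obtain ⟨θ, hθ⟩ : ∃ θ : ℝ, θ = (y - (i:ℝ)/N) / h := ⟨_, rfl⟩
    have hyθ : y - (i:ℝ)/N = θ * h := by rw [hθ]; field_simp
    have θ0 : 0 ≤ θ := by rw [hθ]; exact div_nonneg (by linarith [hy.1]) hpos.le
    have θ1 : θ ≤ 1 := by
      rw [hθ, div_le_one hpos]; linarith [hy.2, pR i]
    have hg1 : g y = (1 - θ) * g ((i:ℝ)/N) + θ * g (((i:ℝ)+1)/N) := by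
      rw [hr, hyθ]; field_simp; ring
    rw [hyθ] at t1
    have t1' : |f y - f ((i:ℝ)/N) - f1 ((i:ℝ)/N) * (θ * h)| ≤ K * h ^ 2 := by
      refine t1.trans ?_
      rw [abs_of_nonneg (by positivity)]
      have : θ * h ≤ h := mul_le_of_le_one_left hpos.le θ1
      gcongr
    have h42 : K * h ^ 4 ≤ K * h ^ 2 := by
      have : h ^ 4 ≤ h ^ 2 := pow_le_pow_of_le_one hpos.le hle1 (by norm_num)
      gcongr
    have q : ∀ x ∈ Icc (0:ℝ) 1, |h ^ 2 * f2 x| ≤ K * h ^ 2 := by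
      intro x hx
      rw [abs_mul, abs_of_pos (by positivity : 0 < h ^ 2), mul_comm]
      gcongr
      exact b2 x hx
    have q1 := q _ (mL i hi)
    have q2 := q _ (mR i hi)
    have d1 : |g ((i:ℝ)/N) - f ((i:ℝ)/N)| ≤ 25 * (K * h ^ 2) := by
      have : e i = g ((i:ℝ)/N) - f ((i:ℝ)/N) + h ^ 2 / 12 * f2 ((i:ℝ)/N) := rfl
      rw [this] at e1
      rw [abs_le] at q1 ⊢
      constructor <;> linarith [e1.1, e1.2, q1.1, q1.2]
    have d2 : |g (((i:ℝ)+1)/N) - f (((i:ℝ)+1)/N)| ≤ 25 * (K * h ^ 2) := by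
      have : e (i + 1) = g (((i:ℝ)+1)/N) - f (((i:ℝ)+1)/N) + h ^ 2 / 12 * f2 (((i:ℝ)+1)/N) := by
        simp only [he, hE]; push_cast; rfl
      rw [this] at e2
      rw [abs_le] at q2 ⊢
      constructor <;> linarith [e2.1, e2.2, q2.1, q2.2]
    have hid : f y - g y = (f y - f ((i:ℝ)/N) - f1 ((i:ℝ)/N) * (θ * h))
        - θ * (f (((i:ℝ)+1)/N) - f ((i:ℝ)/N) - f1 ((i:ℝ)/N) * h)
        - (1 - θ) * (g ((i:ℝ)/N) - f ((i:ℝ)/N))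
        - θ * (g (((i:ℝ)+1)/N) - f (((i:ℝ)+1)/N)) := by
      rw [hg1]; ring
    have sm : ∀ (s X c : ℝ), 0 ≤ s → |X| ≤ c → |s * X| ≤ s * c := by
      intro s X c hs hX
      rw [abs_mul, abs_of_nonneg hs]; gcongr
    have w1 := sm θ _ _ θ0 t2
    have w2 := sm (1 - θ) _ _ (by linarith) d1
    have w3 := sm θ _ _ θ0 d2
    have w4 : θ * (K * h ^ 2) ≤ K * h ^ 2 := by
      exact mul_le_of_le_one_left (by positivity) θ1
    rw [hid]
    rw [abs_le] at t1' w1 w2 w3 ⊢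
    constructor <;> linarith [t1'.1, w1.1, w2.1, w3.1, t1'.2, w1.2, w2.2, w3.2]

lemma deriv_chain {f : ℝ → ℝ} {n : ℕ} (hf : ContDiffOn ℝ n f (Icc (0:ℝ) 1)) (k : ℕ) (hk : k < n) :
    ∀ y ∈ Icc (0:ℝ) 1, HasDerivWithinAt (iteratedDerivWithin k f (Icc (0:ℝ) 1))
      (iteratedDerivWithin (k + 1) f (Icc (0:ℝ) 1) y) (Icc (0:ℝ) 1) y := by
  intro y hy
  rw [iteratedDerivWithin_succ]
  exact ((hf.differentiableOn_iteratedDerivWithin (by exact_mod_cast hk)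
    (uniqueDiffOn_Icc one_pos)) y hy).hasDerivWithinAt

lemma deriv_bdd {f : ℝ → ℝ} {n : ℕ} (hf : ContDiffOn ℝ n f (Icc (0:ℝ) 1)) (k : ℕ) (hk : k ≤ n) :
    ∃ K : ℝ, 0 ≤ K ∧ ∀ y ∈ Icc (0:ℝ) 1, |iteratedDerivWithin k f (Icc (0:ℝ) 1) y| ≤ K := by
  obtain ⟨C, hC⟩ := isCompact_Icc.exists_bound_of_continuousOn
    (hf.continuousOn_iteratedDerivWithin (m := k) (by exact_mod_cast hk) (uniqueDiffOn_Icc one_pos))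
  exact ⟨C, (norm_nonneg _).trans (hC 0 (by simp)), hC⟩

/-- **Superaccuracy of weighted cell averages of the L² projection error onto
`S_h`.** -/
theorem stmt_9 (w η : ℝ → ℝ)
    (hw : ContDiffOn ℝ 2 w (Icc (0:ℝ) 1))
    (hη : ContDiffOn ℝ 4 η (Icc (0:ℝ) 1))
    (hη10 : iteratedDerivWithin 1 η (Icc (0:ℝ) 1) 0 = 0)
    (hη11 : iteratedDerivWithin 1 η (Icc (0:ℝ) 1) 1 = 0)
    (hη30 : iteratedDerivWithin 3 η (Icc (0:ℝ) 1) 0 = 0)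
    (hη31 : iteratedDerivWithin 3 η (Icc (0:ℝ) 1) 1 = 0) :
    ∃ C : ℝ, ∀ (N : ℕ), 2 ≤ N → ∀ Pη : ℝ → ℝ,
      IsL2ProjOn (PL N) η Pη →
      ∀ i < N,
        |∫ y in ((i : ℝ)/N)..(((i : ℝ)+1)/N), w y * (η y - Pη y)|
          ≤ C * ((1:ℝ)/N) ^ 5 := by
  have hη' : ContDiffOn ℝ (4 : ℕ) η (Icc (0:ℝ) 1) := by exact_mod_cast hη
  have hw' : ContDiffOn ℝ (2 : ℕ) w (Icc (0:ℝ) 1) := by exact_mod_cast hw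
  obtain ⟨K2, p2, k2⟩ := deriv_bdd hη' 2 (by norm_num)
  obtain ⟨K3, p3, k3⟩ := deriv_bdd hη' 3 (by norm_num)
  obtain ⟨K4, p4, k4⟩ := deriv_bdd hη' 4 (by norm_num)
  obtain ⟨W0, q0, w0⟩ := deriv_bdd hw' 0 (by norm_num)
  obtain ⟨W1, q1, w1⟩ := deriv_bdd hw' 1 (by norm_num)
  obtain ⟨W2, q2, w2⟩ := deriv_bdd hw' 2 (by norm_num)
  have c0 := deriv_chain hη' 0 (by norm_num)
  have d0 := deriv_chain hw' 0 (by norm_num)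
  have d1 := deriv_chain hw' 1 (by norm_num)
  rw [iteratedDerivWithin_zero] at c0 d0 w0
  set K := K2 + K3 + K4 with hKd
  have hK : 0 ≤ K := by positivity
  refine ⟨30 * K * W0 + 15 * K * W1 + 27 * K * W2, fun N hN Pη hP i hi => ?_⟩
  have hN0 : 0 < N := by omega
  have hN' : (0:ℝ) < N := by exact_mod_cast hN0
  obtain ⟨r1, r2, r3⟩ := main_bound hK c0 (deriv_chain hη' 1 (by norm_num))
    (deriv_chain hη' 2 (by norm_num)) (deriv_chain hη' 3 (by norm_num))
    (fun y hy => (k2 y hy).trans (by linarith)) (fun y hy => (k3 y hy).trans (by linarith))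
    (fun y hy => (k4 y hy).trans (by linarith)) hη30 hη31 N hN0 hP i hi
  obtain ⟨h, hh⟩ : ∃ h : ℝ, h = 1 / (N:ℝ) := ⟨_, rfl⟩
  have hpos : 0 < h := by rw [hh]; positivity
  rw [← hh] at r1 r2 r3 ⊢
  have cle : (i:ℝ)/N ≤ ((i:ℝ)+1)/N := by gcongr; linarith
  have hcell := cell_mem N hN0 i hi
  have hlen : ((i:ℝ)+1)/N - (i:ℝ)/N = h := by rw [hh]; ring
  set p := (i:ℝ)/N with hp
  set p' := ((i:ℝ)+1)/N with hp'
  have hpm : p ∈ Icc (0:ℝ) 1 := hcell (left_mem_Icc.2 cle)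
  set ww := iteratedDerivWithin 1 w (Icc (0:ℝ) 1) with hww
  have hc : ContinuousOn (fun y => η y - Pη y) (uIcc p p') := by
    rw [uIcc_of_le cle]
    exact (hη.continuousOn.sub hP.1.1).mono hcell
  have hcw : ContinuousOn w (uIcc p p') := by
    rw [uIcc_of_le cle]
    exact hw.continuousOn.mono hcell
  have hsplit : (∫ y in p..p', w y * (η y - Pη y)) =
      (∫ y in p..p', (w y - w p - ww p * (y - p)) * (η y - Pη y))
      + w p * (∫ y in p..p', (η y - Pη y))
      + ww p * h * (∫ y in p..p', (η y - Pη y) * (N * y - i)) := by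
    rw [← intervalIntegral.integral_const_mul, ← intervalIntegral.integral_const_mul,
      ← intervalIntegral.integral_add, ← intervalIntegral.integral_add]
    · refine intervalIntegral.integral_congr (fun y _ => ?_)
      have : h * (N * y - i) = y - p := by rw [hh, hp]; field_simp
      linear_combination (- ww p * (η y - Pη y)) * this
    · apply ContinuousOn.intervalIntegrable; fun_prop
    · apply ContinuousOn.intervalIntegrable; fun_prop
    · apply ContinuousOn.intervalIntegrable; fun_prop
    · apply ContinuousOn.intervalIntegrable; fun_prop
  have s1 : |∫ y in p..p', (w y - w p - ww p * (y - p)) * (η y - Pη y)|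
      ≤ 27 * K * W2 * h ^ 5 := by
    have := intervalIntegral.norm_integral_le_of_norm_le_const (a := p) (b := p')
      (C := (W2 * h ^ 2) * (27 * K * h ^ 2))
      (f := fun y => (w y - w p - ww p * (y - p)) * (η y - Pη y)) (fun y hy => by
        have hy' := uIoc_subset_uIcc hy
        rw [uIcc_of_le cle] at hy'
        rw [norm_mul, Real.norm_eq_abs, Real.norm_eq_abs]
        have t := taylor2 q2 d0 d1 w2 hpm (hcell hy')
        have hyp : |y - p| ≤ h := by
          rw [abs_of_nonneg (by linarith [hy'.1])]; linarith [hy'.2]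
        have t' : W2 * |y - p| ^ 2 ≤ W2 * h ^ 2 := by gcongr
        exact mul_le_mul (t.trans t') (r3 y hy') (abs_nonneg _) (by positivity))
    rw [hlen, abs_of_pos hpos, Real.norm_eq_abs] at this
    linarith
  have s2 : |w p * (∫ y in p..p', (η y - Pη y))| ≤ W0 * (30 * K * h ^ 5) := by
    rw [abs_mul]
    exact mul_le_mul (w0 p hpm) r1 (abs_nonneg _) q0
  have s3 : |ww p * h * (∫ y in p..p', (η y - Pη y) * (N * y - i))|
      ≤ W1 * h * (15 * K * h ^ 4) := by
    rw [abs_mul, abs_mul, abs_of_pos hpos]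
    have := w1 p hpm
    gcongr
  rw [hsplit]
  refine (abs_add_three _ _ _).trans ?_
  linarith
end
end

section
/- Let w ∈ C₀², v ∈ C²[0,1], η ∈ C⁴[0,1] with η'(0) = η'(1) = 0 and η'''(0) = η'''(1) = 0, and u ∈ C₀⁴ with u''(0) = u''(1) = 0. Set ρ = η − Pη and σ = u − P₀u. Then there exist constants independent of N such that for all N ≥ 2: (i) the element ζ₁ ∈ S_{h,0} with (ζ₁, χ) = (ρ', χ) for all χ ∈ S_{h,0} satisfies ‖ζ₁‖ ≤ C h³; (ii) the element ζ₂ ∈ S_h with (ζ₂, φ) = (σ', φ) for all φ ∈ S_h satisfies ‖ζ₂‖ ≤ C h³; (iii) the element ζ₃ ∈ S_h with (ζ₃, φ) = ((wρ)', φ) for all φ ∈ S_h satisfies ‖ζ₃‖ ≤ C h³; (iv) the element ζ₄ ∈ S_h with (ζ₄, φ) = ((vσ)', φ) for all φ ∈ S_h satisfies ‖ζ₄‖ ≤ C h³; (v) the element ζ₅ ∈ S_{h,0} with (ζ₅, χ) = ((vσ)', χ) for all χ ∈ S_{h,0} satisfies ‖ζ₅‖ ≤ C h³; (vi) the element ζ₆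 ∈ S_{h,0} with (ζ₆, χ) = ((vρ)', χ) for all χ ∈ S_{h,0} satisfies ‖ζ₆‖ ≤ C h³. -/
noncomputable section
open Set

lemma hdw {n : ℕ} {f : ℝ → ℝ} (hf : ContDiffOn ℝ n f (Icc (0:ℝ) 1)) {k : ℕ} (hk : k < n) :
    ∀ x ∈ Icc (0:ℝ) 1, HasDerivWithinAt (iteratedDerivWithin k f (Icc (0:ℝ) 1))
      (iteratedDerivWithin (k+1) f (Icc (0:ℝ) 1) x) (Icc (0:ℝ) 1) x := by
  intro x hx
  have h1 := hf.differentiableOn_iteratedDerivWithin (m := k) (by exact_mod_cast hk)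
    (uniqueDiffOn_Icc (by norm_num))
  have := (h1 x hx).hasDerivWithinAt
  rwa [← iteratedDerivWithin_succ] at this

lemma bdd_it {n : ℕ} {f : ℝ → ℝ} (hf : ContDiffOn ℝ n f (Icc (0:ℝ) 1)) {k : ℕ} (hk : k ≤ n) :
    ∃ M, 0 ≤ M ∧ ∀ x ∈ Icc (0:ℝ) 1, |iteratedDerivWithin k f (Icc (0:ℝ) 1) x| ≤ M := by
  have h1 := hf.continuousOn_iteratedDerivWithin (m := k) (by exact_mod_cast hk)
    (uniqueDiffOn_Icc (by norm_num))
  obtain ⟨M, hM⟩ := isCompact_Icc.exists_bound_of_continuousOn h1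
  exact ⟨M, le_trans (abs_nonneg _) (hM 0 (by simp)), fun x hx => hM x hx⟩

/-- one step of the Taylor estimate -/
lemma step {g g' : ℝ → ℝ} {x K : ℝ} {n : ℕ} (hx : x ∈ Icc (0:ℝ) 1) (hK : 0 ≤ K)
    (hg : ∀ y ∈ Icc x 1, HasDerivWithinAt g (g' y) (Icc x 1) y) (h0 : g x = 0)
    (hb : ∀ y ∈ Icc x 1, |g' y| ≤ K * (y - x) ^ n) :
    ∀ y ∈ Icc x 1, |g y| ≤ K * (y - x) ^ (n+1) := by
  intro y hy
  have h := (convex_Icc x y).norm_image_sub_le_of_norm_hasDerivWithin_le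
    (f := g) (f' := g') (C := K * (y-x)^n) (x := x) (y := y)
    (fun z hz => (hg z ⟨hz.1, hz.2.trans hy.2⟩).mono (Icc_subset_Icc_right hy.2))
    (fun z hz => by
      refine (hb z ⟨hz.1, hz.2.trans hy.2⟩).trans ?_
      have := hz.1
      have := hz.2
      gcongr)
    ⟨le_rfl, hy.1⟩ ⟨hy.1, le_rfl⟩
  rw [h0, sub_zero, Real.norm_eq_abs, Real.norm_eq_abs,
    abs_of_nonneg (show (0:ℝ) ≤ y - x by linarith [hy.1])] at h
  calc _ ≤ _ := h
    _ = _ := by ring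

lemma taylor2_s11 {g g1 g2 : ℝ → ℝ} {M : ℝ} (hM : 0 ≤ M)
    (h0 : ∀ x ∈ Icc (0:ℝ) 1, HasDerivWithinAt g (g1 x) (Icc (0:ℝ) 1) x)
    (h1 : ∀ x ∈ Icc (0:ℝ) 1, HasDerivWithinAt g1 (g2 x) (Icc (0:ℝ) 1) x)
    (hb : ∀ x ∈ Icc (0:ℝ) 1, |g2 x| ≤ M) {x : ℝ} (hx : x ∈ Icc (0:ℝ) 1) :
    (∀ y ∈ Icc x 1, |g1 y - g1 x| ≤ M * (y-x)) ∧
    (∀ y ∈ Icc x 1, |g y - g x - g1 x * (y-x)| ≤ M * (y-x)^2) := by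
  have hs : Icc x 1 ⊆ Icc (0:ℝ) 1 := Icc_subset_Icc_left hx.1
  have A := step (n := 0) (g := fun y => g1 y - g1 x) (g' := g2) hx hM
    (fun y hy => ((h1 y (hs hy)).mono hs).sub_const _) (by simp)
    (fun y hy => by simpa using hb y (hs hy))
  have B := step (n := 1) (g := fun y => g y - g x - g1 x * (y-x)) (g' := fun y => g1 y - g1 x) hx hM
    (fun y hy => by
      have := (((h0 y (hs hy)).mono hs).sub_const (g x)).sub
        (((hasDerivWithinAt_id y (Icc x 1)).sub_const x).const_mul (g1 x))
      refine this.congr_deriv ?_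
      simp) (by simp)
    (fun y hy => by simpa using A y hy)
  exact ⟨fun y hy => by simpa using A y hy, B⟩

lemma taylor4_s11 {g g1 g2 g3 g4 : ℝ → ℝ} {M : ℝ} (hM : 0 ≤ M)
    (h0 : ∀ x ∈ Icc (0:ℝ) 1, HasDerivWithinAt g (g1 x) (Icc (0:ℝ) 1) x)
    (h1 : ∀ x ∈ Icc (0:ℝ) 1, HasDerivWithinAt g1 (g2 x) (Icc (0:ℝ) 1) x)
    (h2 : ∀ x ∈ Icc (0:ℝ) 1, HasDerivWithinAt g2 (g3 x) (Icc (0:ℝ) 1) x)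
    (h3 : ∀ x ∈ Icc (0:ℝ) 1, HasDerivWithinAt g3 (g4 x) (Icc (0:ℝ) 1) x)
    (hb : ∀ x ∈ Icc (0:ℝ) 1, |g4 x| ≤ M) {x : ℝ} (hx : x ∈ Icc (0:ℝ) 1) :
    (∀ y ∈ Icc x 1, |g y - g x - g1 x * (y-x) - g2 x * (y-x)^2 / 2 - g3 x * (y-x)^3/6|
      ≤ M * (y-x)^4) := by
  have hs : Icc x 1 ⊆ Icc (0:ℝ) 1 := Icc_subset_Icc_left hx.1
  have A := (taylor2_s11 hM h2 h3 hb hx).2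
  have B := step (n := 2) (g := fun y => g1 y - g1 x - g2 x * (y-x) - g3 x * (y-x)^2/2)
    (g' := fun y => g2 y - g2 x - g3 x * (y-x)) hx hM
    (fun y hy => by
      have := ((((h1 y (hs hy)).mono hs).sub_const (g1 x)).sub
        (((hasDerivWithinAt_id y (Icc x 1)).sub_const x).const_mul (g2 x))).sub
        (((((hasDerivWithinAt_id y (Icc x 1)).sub_const x).pow 2).const_mul (g3 x)).div_const 2)
      refine this.congr_deriv ?_
      simp; ring) (by simp) A
  exact step (n := 3) (g := fun y => g y - g x - g1 x * (y-x) - g2 x * (y-x)^2/2 - g3 x * (y-x)^3/6)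
    (g' := fun y => g1 y - g1 x - g2 x * (y-x) - g3 x * (y-x)^2/2) hx hM
    (fun y hy => by
      have := (((((h0 y (hs hy)).mono hs).sub_const (g x)).sub
        (((hasDerivWithinAt_id y (Icc x 1)).sub_const x).const_mul (g1 x))).sub
        (((((hasDerivWithinAt_id y (Icc x 1)).sub_const x).pow 2).const_mul (g2 x)).div_const 2)).sub
        (((((hasDerivWithinAt_id y (Icc x 1)).sub_const x).pow 3).const_mul (g3 x)).div_const 6)
      refine this.congr_deriv ?_
      simp; ring) (by simp) B

/-- polynomial integral on a cell -/
lemma int_poly (c h c0 c1 c2 c3 c4 : ℝ) :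
    ∫ y in c..(c+h), (c0 + c1*(y-c) + c2*(y-c)^2 + c3*(y-c)^3 + c4*(y-c)^4)
      = c0*h + c1*h^2/2 + c2*h^3/3 + c3*h^4/4 + c4*h^5/5 := by
  have := intervalIntegral.integral_eq_sub_of_hasDerivAt (a := c) (b := c+h)
    (f := fun y => c0*(y-c) + c1*(y-c)^2/2 + c2*(y-c)^3/3 + c3*(y-c)^4/4 + c4*(y-c)^5/5)
    (f' := fun y => (c0 + c1*(y-c) + c2*(y-c)^2 + c3*(y-c)^3 + c4*(y-c)^4))
    (fun y _ => by
      have hd : HasDerivAt (fun y => y - c) 1 y := (hasDerivAt_id y).sub_const c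
      have := ((((hd.const_mul c0).add (((hd.pow 2).const_mul c1).div_const 2)).add
        (((hd.pow 3).const_mul c2).div_const 3)).add (((hd.pow 4).const_mul c3).div_const 4)).add
        (((hd.pow 5).const_mul c4).div_const 5)
      refine this.congr_deriv ?_
      simp; ring)
    (Continuous.intervalIntegrable (by fun_prop) _ _)
  rw [this]; ring

/-- comparing integrals on a cell -/
lemma int_close {c h K : ℝ} (hh : 0 ≤ h) {g1 g2 : ℝ → ℝ} (h1 : ContinuousOn g1 (Icc c (c+h)))
    (h2 : ContinuousOn g2 (Icc c (c+h))) (hb : ∀ y ∈ Icc c (c+h), |g1 y - g2 y| ≤ K) :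
    |(∫ y in c..(c+h), g1 y) - ∫ y in c..(c+h), g2 y| ≤ K * h := by
  have hle : c ≤ c + h := by linarith
  rw [← intervalIntegral.integral_sub (h1.intervalIntegrable_of_Icc hle)
    (h2.intervalIntegrable_of_Icc hle)]
  have := intervalIntegral.norm_integral_le_of_norm_le_const (a := c) (b := c+h) (C := K)
    (f := fun y => g1 y - g2 y) (fun y hy => by
      rw [uIoc_of_le hle] at hy
      exact hb y ⟨hy.1.le, hy.2⟩)
  rwa [add_sub_cancel_left, abs_of_nonneg hh] at this

/-- mesh nodes -/
def X (N i : ℕ) : ℝ := (i:ℝ) / N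

lemma X_succ (N i : ℕ) : X N (i+1) = X N i + 1 / N := by
  simp [X, add_div]

lemma X_zero (N : ℕ) : X N 0 = 0 := by simp [X]

lemma X_N {N : ℕ} (hN : 0 < N) : X N N = 1 := by
  have : (N:ℝ) ≠ 0 := by positivity
  simp [X, this]

lemma X_mem {N i : ℕ} (hN : 0 < N) (hi : i ≤ N) : X N i ∈ Icc (0:ℝ) 1 := by
  have : (0:ℝ) < N := by positivity
  refine ⟨by unfold X; positivity, ?_⟩
  unfold X
  rw [div_le_one this]
  exact_mod_cast hi

lemma cell_sub {N i : ℕ} (hN : 0 < N) (hi : i < N) :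
    Icc (X N i) (X N i + 1/N) ⊆ Icc (0:ℝ) 1 := by
  rw [← X_succ]
  exact Icc_subset_Icc (X_mem hN hi.le).1 (X_mem hN (Nat.succ_le_of_lt hi)).2

lemma sum_cells_s11 {N : ℕ} (hN : 0 < N) {g : ℝ → ℝ}
    (hg : ∀ i < N, IntervalIntegrable g MeasureTheory.volume (X N i) (X N i + 1/N)) :
    ∫ y in (0:ℝ)..1, g y = ∑ i ∈ Finset.range N, ∫ y in (X N i)..(X N i + 1/N), g y := by
  have := intervalIntegral.sum_integral_adjacent_intervals (a := X N) (n := N) (f := g)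
    (μ := MeasureTheory.volume) (fun k hk => by rw [X_succ]; exact hg k hk)
  rw [X_zero, X_N hN] at this
  rw [← this]
  simp only [X_succ]

lemma sum_cells_c {N : ℕ} (hN : 0 < N) {g : ℝ → ℝ} (hg : ContinuousOn g (Icc (0:ℝ) 1)) :
    ∫ y in (0:ℝ)..1, g y = ∑ i ∈ Finset.range N, ∫ y in (X N i)..(X N i + 1/N), g y :=
  sum_cells_s11 hN (fun i hi => (hg.mono (cell_sub hN hi)).intervalIntegrable_of_Icc
    (by linarith [show (0:ℝ) ≤ 1/N by positivity]))

/-- cell increments -/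
def D (N : ℕ) (φ : ℝ → ℝ) (i : ℕ) : ℝ := φ (X N (i+1)) - φ (X N i)

lemma PL_rep {N : ℕ} (hN : 0 < N) {φ : ℝ → ℝ} (hφ : φ ∈ PL N) {i : ℕ} (hi : i < N) :
    ∀ y ∈ Icc (X N i) (X N i + 1/N), φ y = φ (X N i) + D N φ i * N * (y - X N i) := by
  obtain ⟨a, b, hab⟩ := hφ.2 i hi
  have hp : (0:ℝ) < N := by positivity
  have e : ((i:ℝ)+1)/N = X N i + 1/N := by simp [X, add_div]
  rw [e] at hab
  change ∀ y ∈ Icc (X N i) _, _ at hab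
  have hh : (0:ℝ) ≤ 1/N := by positivity
  have h1 := hab (X N i) ⟨le_rfl, by linarith⟩
  have h2 := hab (X N i + 1/N) ⟨by linarith, le_rfl⟩
  intro y hy
  rw [hab y hy, D, X_succ, h2, h1]
  field_simp
  ring

lemma PL_sub {N : ℕ} {φ ψ : ℝ → ℝ} (hφ : φ ∈ PL N) (hψ : ψ ∈ PL N) :
    (fun y => φ y - ψ y) ∈ PL N := by
  refine ⟨hφ.1.sub hψ.1, fun i hi => ?_⟩
  obtain ⟨a, b, h⟩ := hφ.2 i hi
  obtain ⟨a', b', h'⟩ := hψ.2 i hi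
  exact ⟨a - a', b - b', fun y hy => by
    change φ y - ψ y = _
    rw [h y hy, h' y hy]; ring⟩

/-- the cell size of a piecewise linear function -/
def E (N : ℕ) (φ : ℝ → ℝ) (i : ℕ) : ℝ := |φ (X N i)| + |D N φ i|

lemma E_nonneg (N : ℕ) (φ : ℝ → ℝ) (i : ℕ) : 0 ≤ E N φ i := by unfold E; positivity

lemma nrm_sq (φ : ℝ → ℝ) : nrm φ ^ 2 = ∫ y in (0:ℝ)..1, φ y ^ 2 := by
  unfold nrm
  rw [Real.sq_sqrt]
  exact intervalIntegral.integral_nonneg (by norm_num) (fun y _ => sq_nonneg _)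

lemma nrm_nonneg (φ : ℝ → ℝ) : 0 ≤ nrm φ := Real.sqrt_nonneg _

lemma sum_E_sq {N : ℕ} (hN : 0 < N) {φ : ℝ → ℝ} (hφ : φ ∈ PL N) :
    ∑ i ∈ Finset.range N, E N φ i ^ 2 ≤ 32 * N * nrm φ ^ 2 := by
  have hp : (0:ℝ) < N := by positivity
  have hh : (0:ℝ) ≤ 1/N := by positivity
  rw [nrm_sq, sum_cells_c hN (g := fun y => φ y ^ 2) (hφ.1.pow 2), Finset.mul_sum]
  refine Finset.sum_le_sum fun i hi => ?_
  have hi := Finset.mem_range.1 hi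
  have : ∫ y in (X N i)..(X N i + 1/N), φ y ^ 2 =
      (φ (X N i) ^ 2 + φ (X N i) * D N φ i + D N φ i ^ 2 / 3) / N := by
    rw [intervalIntegral.integral_congr (g := fun y => φ (X N i) ^ 2
      + (2 * φ (X N i) * (D N φ i * N)) * (y - X N i) + (D N φ i * N)^2 * (y - X N i)^2
      + 0 * (y - X N i)^3 + 0 * (y - X N i)^4), int_poly]
    · field_simp
      ring
    · intro y hy
      rw [uIcc_of_le (by linarith)] at hy
      simp only []
      rw [PL_rep hN hφ hi y hy]
      ring
  rw [this]
  set p := φ (X N i)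
  set d := D N φ i
  have e : 32 * (N:ℝ) * ((p^2 + p * d + d^2/3) / N) = 32 * (p^2 + p*d + d^2/3) := by
    field_simp
  rw [e]
  have : E N φ i ^ 2 ≤ 2 * (p^2 + d^2) := by
    unfold E
    rw [← sq_abs p, ← sq_abs d]
    nlinarith [sq_nonneg (|p| - |d|)]
  nlinarith [sq_nonneg (2*p + d), sq_nonneg (3*p+2*d)]

lemma sum_E {N : ℕ} (hN : 0 < N) {φ : ℝ → ℝ} (hφ : φ ∈ PL N) :
    ∑ i ∈ Finset.range N, E N φ i ≤ 6 * N * nrm φ := by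
  have h1 := sum_E_sq hN hφ
  have h2 := sq_sum_le_card_mul_sum_sq (s := Finset.range N) (f := E N φ)
  rw [Finset.card_range] at h2
  have hn := nrm_nonneg φ
  refine abs_le_of_sq_le_sq' (b := 6 * N * nrm φ) ?_ (by positivity) |>.2
  calc _ ≤ _ := h2
    _ ≤ (N:ℝ) * (32 * N * nrm φ ^ 2) := by gcongr
    _ ≤ _ := by nlinarith [mul_nonneg (sq_nonneg (N:ℝ)) (sq_nonneg (nrm φ))]

lemma sum_EE {N : ℕ} (hN : 0 < N) {φ ψ : ℝ → ℝ} (hφ : φ ∈ PL N) (hψ : ψ ∈ PL N) :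
    ∑ i ∈ Finset.range N, E N φ i * E N ψ i ≤ 32 * N * nrm φ * nrm ψ := by
  have h1 := sum_E_sq hN hφ
  have h2 := sum_E_sq hN hψ
  have h3 := Finset.sum_mul_sq_le_sq_mul_sq (Finset.range N) (E N φ) (E N ψ)
  have hn := nrm_nonneg φ
  have hn' := nrm_nonneg ψ
  refine abs_le_of_sq_le_sq' (b := 32 * N * nrm φ * nrm ψ) ?_ (by positivity) |>.2
  calc _ ≤ _ := h3
    _ ≤ (32 * N * nrm φ ^ 2) * (32 * N * nrm ψ ^ 2) := by
      gcongr
    _ = _ := by ring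

/-- interpolant -/
def interp (N : ℕ) (g : ℝ → ℝ) (y : ℝ) : ℝ :=
  g 0 + ∑ i ∈ Finset.range N, D N g i * N * max 0 (min (1/(N:ℝ)) (y - X N i))

lemma X_mono (N : ℕ) {i j : ℕ} (h : i ≤ j) : X N i ≤ X N j := by
  unfold X; gcongr

lemma interp_cell {N : ℕ} (hN : 0 < N) (g : ℝ → ℝ) {j : ℕ} (hj : j < N) :
    ∀ y ∈ Icc (X N j) (X N j + 1/N), interp N g y = g (X N j) + D N g j * N * (y - X N j) := by
  intro y hy
  have hp : (0:ℝ) < N := by positivity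
  have hh : (0:ℝ) ≤ 1/N := by positivity
  unfold interp
  have e : N = j + (1 + (N - j - 1)) := by omega
  have hs : ∑ i ∈ Finset.range N, D N g i * N * max 0 (min (1/(N:ℝ)) (y - X N i))
     = (∑ i ∈ Finset.range j, D N g i) + D N g j * N * (y - X N j) := by
    conv_lhs => rw [show Finset.range N = Finset.range (j + (1 + (N - j - 1))) by rw [← e]]
    rw [Finset.sum_range_add, Finset.sum_range_add]
    have h1 : ∀ i ∈ Finset.range j, D N g i * N * max 0 (min (1/(N:ℝ)) (y - X N i)) = D N g i := by
      intro i hi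
      have := X_mono N (Nat.succ_le_of_lt (Finset.mem_range.1 hi))
      rw [Nat.succ_eq_add_one, X_succ] at this
      rw [min_eq_left (by linarith [hy.1]), max_eq_right hh]
      field_simp
    have h3 : ∀ i ∈ Finset.range (N - j - 1), D N g (j + (1 + i)) * N *
        max 0 (min (1/(N:ℝ)) (y - X N (j + (1 + i)))) = 0 := by
      intro i hi
      have := X_mono N (show j + 1 ≤ j + (1 + i) by omega)
      rw [X_succ] at this
      rw [max_eq_left, mul_zero]
      exact (min_le_right _ _).trans (by linarith [hy.2])
    rw [Finset.sum_congr rfl h1, Finset.sum_congr rfl h3]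
    simp only [Finset.range_one, Finset.sum_singleton, Finset.sum_const_zero, add_zero]
    rw [min_eq_right (by linarith [hy.2]), max_eq_right (by linarith [hy.1])]
  rw [hs]
  simp only [D]
  rw [Finset.sum_range_sub (fun i => g (X N i)), X_zero]
  ring

lemma interp_PL {N : ℕ} (hN : 0 < N) (g : ℝ → ℝ) : interp N g ∈ PL N := by
  refine ⟨Continuous.continuousOn ?_, fun i hi => ?_⟩
  · unfold interp; fun_prop
  · refine ⟨D N g i * N, g (X N i) - D N g i * N * X N i, fun y hy => ?_⟩
    rw [interp_cell hN g hi y]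
    · ring
    · have e : ((i:ℝ)+1)/N = X N i + 1/N := by simp [X, add_div]
      rw [← e]; exact hy

lemma interp_zero {N : ℕ} (hN : 0 < N) (g : ℝ → ℝ) : interp N g 0 = g 0 := by
  have hh : (0:ℝ) ≤ 1/N := by positivity
  have := interp_cell hN g hN (X N 0) ⟨le_rfl, by linarith⟩
  simpa [X_zero] using this

lemma interp_one {N : ℕ} (hN : 0 < N) (g : ℝ → ℝ) : interp N g 1 = g 1 := by
  have hh : (0:ℝ) ≤ 1/N := by positivity
  have hp : (N:ℝ) ≠ 0 := by positivity
  have e : X N (N - 1) + 1/N = 1 := by rw [← X_succ, Nat.sub_add_cancel hN, X_N hN]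
  have := interp_cell hN g (j := N - 1) (by omega) (X N (N-1) + 1/N) ⟨by linarith, le_rfl⟩
  rw [D, X_succ, e, ← e, add_sub_cancel_left, mul_assoc, mul_one_div_cancel hp, e] at this
  rw [this]; ring

structure Data4 (f f1 f2 f3 : ℝ → ℝ) (M : ℝ) : Prop where
  nonneg : 0 ≤ M
  hd : ∀ x ∈ Icc (0:ℝ) 1, HasDerivWithinAt f (f1 x) (Icc (0:ℝ) 1) x
  c1 : ContinuousOn f1 (Icc (0:ℝ) 1)
  b2 : ∀ x ∈ Icc (0:ℝ) 1, |f2 x| ≤ M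
  b3 : ∀ x ∈ Icc (0:ℝ) 1, |f3 x| ≤ M
  t4 : ∀ x ∈ Icc (0:ℝ) 1, ∀ y ∈ Icc x 1,
    |f y - f x - f1 x * (y-x) - f2 x * (y-x)^2 / 2 - f3 x * (y-x)^3/6| ≤ M * (y-x)^4
  t2 : ∀ x ∈ Icc (0:ℝ) 1, ∀ y ∈ Icc x 1, |f2 y - f2 x - f3 x * (y-x)| ≤ M * (y-x)^2
  t1 : ∀ x ∈ Icc (0:ℝ) 1, ∀ y ∈ Icc x 1, |f3 y - f3 x| ≤ M * (y-x)

structure Data2 (v v1 : ℝ → ℝ) (K : ℝ) : Prop where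
  nonneg : 0 ≤ K
  hd : ∀ x ∈ Icc (0:ℝ) 1, HasDerivWithinAt v (v1 x) (Icc (0:ℝ) 1) x
  c1 : ContinuousOn v1 (Icc (0:ℝ) 1)
  b0 : ∀ x ∈ Icc (0:ℝ) 1, |v x| ≤ K
  b1 : ∀ x ∈ Icc (0:ℝ) 1, |v1 x| ≤ K
  t2 : ∀ x ∈ Icc (0:ℝ) 1, ∀ y ∈ Icc x 1, |v y - v x - v1 x * (y-x)| ≤ K * (y-x)^2

lemma exists_data4 {f : ℝ → ℝ} (hf : ContDiffOn ℝ 4 f (Icc (0:ℝ) 1)) :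
    ∃ M, Data4 f (iteratedDerivWithin 1 f (Icc (0:ℝ) 1)) (iteratedDerivWithin 2 f (Icc (0:ℝ) 1))
      (iteratedDerivWithin 3 f (Icc (0:ℝ) 1)) M := by
  have hf' : ContDiffOn ℝ (4:ℕ) f (Icc (0:ℝ) 1) := hf
  obtain ⟨M2, p2, h2⟩ := bdd_it hf' (k := 2) (by norm_num)
  obtain ⟨M3, p3, h3⟩ := bdd_it hf' (k := 3) (by norm_num)
  obtain ⟨M4, p4, h4⟩ := bdd_it hf' (k := 4) (by norm_num)
  have d0 := hdw hf' (k := 0) (by norm_num)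
  rw [iteratedDerivWithin_zero] at d0
  have d1 := hdw hf' (k := 1) (by norm_num)
  have d2 := hdw hf' (k := 2) (by norm_num)
  have d3 := hdw hf' (k := 3) (by norm_num)
  have hM : 0 ≤ M2 + M3 + M4 := by positivity
  have b4 : ∀ x ∈ Icc (0:ℝ) 1, |iteratedDerivWithin (3+1) f (Icc (0:ℝ) 1) x| ≤ M2 + M3 + M4 :=
    fun x hx => (h4 x hx).trans (by linarith)
  exact ⟨M2 + M3 + M4, hM, d0, fun x hx => (d1 x hx).continuousWithinAt,
    fun x hx => (h2 x hx).trans (by linarith), fun x hx => (h3 x hx).trans (by linarith),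
    fun x hx => taylor4_s11 hM d0 d1 d2 d3 b4 hx,
    fun x hx => (taylor2_s11 hM d2 d3 b4 hx).2, fun x hx => (taylor2_s11 hM d2 d3 b4 hx).1⟩

lemma exists_data2 {f : ℝ → ℝ} (hf : ContDiffOn ℝ 2 f (Icc (0:ℝ) 1)) :
    ∃ M, Data2 f (iteratedDerivWithin 1 f (Icc (0:ℝ) 1)) M := by
  have hf' : ContDiffOn ℝ (2:ℕ) f (Icc (0:ℝ) 1) := hf
  obtain ⟨M2, p2, h2⟩ := bdd_it hf' (k := 0) (by norm_num)
  obtain ⟨M3, p3, h3⟩ := bdd_it hf' (k := 1) (by norm_num)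
  obtain ⟨M4, p4, h4⟩ := bdd_it hf' (k := 2) (by norm_num)
  have d0 := hdw hf' (k := 0) (by norm_num)
  rw [iteratedDerivWithin_zero] at d0 h2
  have d1 := hdw hf' (k := 1) (by norm_num)
  have hM : 0 ≤ M2 + M3 + M4 := by positivity
  have b4 : ∀ x ∈ Icc (0:ℝ) 1, |iteratedDerivWithin (1+1) f (Icc (0:ℝ) 1) x| ≤ M2 + M3 + M4 :=
    fun x hx => (h4 x hx).trans (by linarith)
  exact ⟨M2 + M3 + M4, hM, d0, fun x hx => (d1 x hx).continuousWithinAt,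
    fun x hx => (h2 x hx).trans (by linarith), fun x hx => (h3 x hx).trans (by linarith),
    fun x hx => (taylor2_s11 hM d0 d1 b4 hx).2⟩

/-- nodal values of the quasi-interpolant -/
def gq (N : ℕ) (f f2 : ℝ → ℝ) (y : ℝ) : ℝ := f y - (1/(N:ℝ))^2/12 * f2 y

/-- leading error on a cell -/
def r0 (h a b s : ℝ) : ℝ := a * (s^2/2 - h*s/2 + h^2/12) + b * (s^3/6 - h^2*s/12)

lemma r0_bound {h a b s M : ℝ} (ha : |a| ≤ M) (hb : |b| ≤ M) (hs : s ∈ Icc 0 h) (hh : h ≤ 1) :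
    |r0 h a b s| ≤ M * h^2 := by
  obtain ⟨h0, h1⟩ := hs
  have hM : 0 ≤ M := (abs_nonneg _).trans ha
  have hh0 : 0 ≤ h := h0.trans h1
  have hA : |s^2/2 - h*s/2 + h^2/12| ≤ h^2/2 := by
    rw [abs_le]; constructor <;> nlinarith [mul_nonneg h0 (sub_nonneg.2 h1), sq_nonneg h]
  have hB : |s^3/6 - h^2*s/12| ≤ h^2/2 := by
    have e : s^3/6 - h^2*s/12 = s * (s^2/6 - h^2/12) := by ring
    have : |s^2/6 - h^2/12| ≤ h^2/2 := by
      have : s^2 ≤ h^2 := by gcongr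
      rw [abs_le]; constructor <;> nlinarith [sq_nonneg s]
    rw [e, abs_mul, abs_of_nonneg h0]
    calc s * |s^2/6 - h^2/12| ≤ 1 * (h^2/2) := by
          gcongr
          linarith
      _ = _ := one_mul _
  unfold r0
  calc _ ≤ |a| * |s^2/2 - h*s/2 + h^2/12| + |b| * |s^3/6 - h^2*s/12| := by
        rw [← abs_mul, ← abs_mul]; exact abs_add_le _ _
    _ ≤ M * (h^2/2) + M * (h^2/2) := by gcongr
    _ = _ := by ring

lemma cell_approx {f f1 f2 f3 : ℝ → ℝ} {M : ℝ} (hf : Data4 f f1 f2 f3 M) {N i : ℕ} (hN : 0 < N)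
    (hi : i < N) : ∀ y ∈ Icc (X N i) (X N i + 1/N),
    |f y - interp N (gq N f f2) y - r0 (1/N) (f2 (X N i)) (f3 (X N i)) (y - X N i)|
      ≤ 3 * M * (1/(N:ℝ))^4 := by
  intro y hy
  have hM := hf.nonneg
  have hp : (0:ℝ) < N := by positivity
  have hx := X_mem hN hi.le
  have hx1 := X_mem hN (Nat.succ_le_of_lt hi)
  rw [Nat.succ_eq_add_one, X_succ] at hx1
  rw [interp_cell hN _ hi y hy, D, X_succ]
  have hNh : (N:ℝ) * (1/N) = 1 := by field_simp
  set x := X N i with hxdef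
  set h : ℝ := 1/N with hh
  have h0 : 0 ≤ h := by positivity
  obtain ⟨hy1, hy2⟩ := hy
  have R := hf.t4 x hx y ⟨hy1, hy2.trans hx1.2⟩
  have R' := hf.t4 x hx (x+h) ⟨by linarith, hx1.2⟩
  have Q := hf.t2 x hx (x+h) ⟨by linarith, hx1.2⟩
  rw [add_sub_cancel_left] at R' Q
  set s := y - x with hs
  have s0 : 0 ≤ s := by linarith
  have s1 : s ≤ h := by linarith
  set t := N * s with ht
  have t0 : 0 ≤ t := by positivity
  have t1 : t ≤ 1 := by have := mul_le_mul_of_nonneg_left s1 hp.le; linarith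
  have st : s = h * t := by rw [ht, ← mul_assoc, mul_comm h, hNh, one_mul]
  have R2 : |f y - f x - f1 x * s - f2 x * s^2 / 2 - f3 x * s^3/6| ≤ M * h^4 :=
    R.trans (by gcongr)
  set ra := f y - f x - f1 x * s - f2 x * s^2 / 2 - f3 x * s^3/6 with hra
  set rb := f (x+h) - f x - f1 x * h - f2 x * h^2 / 2 - f3 x * h^3/6 with hrb
  set rc := f2 (x+h) - f2 x - f3 x * h with hrc
  have key : f y - (gq N f f2 x + (gq N f f2 (x+h) - gq N f f2 x) * N * s)
      - r0 h (f2 x) (f3 x) s = ra - rb * t + h^2/12 * rc * t := by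
    rw [mul_assoc, ← ht, hra, hrb, hrc, st]
    simp only [gq, r0, ← hh]
    ring
  rw [key]
  calc |ra - rb * t + h^2/12 * rc * t| ≤ |ra| + |rb| * t + h^2/12 * |rc| * t := by
        refine (abs_add_le _ _).trans (add_le_add ((abs_sub _ _).trans ?_) ?_)
        · rw [abs_mul, abs_of_nonneg t0]
        · rw [abs_mul, abs_mul, abs_of_nonneg t0, abs_of_nonneg (by positivity : 0 ≤ h^2/12)]
    _ ≤ M * h^4 + (M * h^4) * 1 + h^2/12 * (M * h^2) * 1 := by gcongr
    _ ≤ _ := by nlinarith [mul_nonneg hM (pow_nonneg h0 4)]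

lemma Data4.cont {f f1 f2 f3 : ℝ → ℝ} {M : ℝ} (hf : Data4 f f1 f2 f3 M) :
    ContinuousOn f (Icc (0:ℝ) 1) := fun x hx => (hf.hd x hx).continuousWithinAt

lemma Data2.cont {v v1 : ℝ → ℝ} {M : ℝ} (hf : Data2 v v1 M) :
    ContinuousOn v (Icc (0:ℝ) 1) := fun x hx => (hf.hd x hx).continuousWithinAt

lemma cell_int {f f1 f2 f3 : ℝ → ℝ} {M : ℝ} (hf : Data4 f f1 f2 f3 M) {N i : ℕ} (hN : 0 < N)
    (hi : i < N) {ω : ℝ → ℝ} {α β W δ : ℝ} (hω : ContinuousOn ω (Icc (X N i) (X N i + 1/N)))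
    (hW : ∀ y ∈ Icc (X N i) (X N i + 1/N), |ω y| ≤ W)
    (hδ : ∀ y ∈ Icc (X N i) (X N i + 1/N), |ω y - (α + β * (y - X N i))| ≤ δ) :
    |(∫ y in (X N i)..(X N i + 1/N), (f y - interp N (gq N f f2) y) * ω y)
      - β * f3 (X N i) * (1/(N:ℝ))^5/180| ≤ (3 * M * (1/(N:ℝ))^4 * W + M * (1/(N:ℝ))^2 * δ) * (1/N) := by
  have hM := hf.nonneg
  have hp : (0:ℝ) < N := by positivity
  have h1 : (1:ℝ)/N ≤ 1 := by
    rw [div_le_one hp]; exact_mod_cast hN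
  have h0 : (0:ℝ) ≤ 1/N := by positivity
  have hx := X_mem hN hi.le
  have hpol : ∫ y in (X N i)..(X N i + 1/N), r0 (1/N) (f2 (X N i)) (f3 (X N i)) (y - X N i)
      * (α + β * (y - X N i)) = β * f3 (X N i) * (1/(N:ℝ))^5/180 := by
    generalize (1:ℝ)/N = h
    generalize X N i = x
    rw [intervalIntegral.integral_congr (g := fun y => (f2 x * h^2/12*α)
      + (f2 x * (h^2/12*β - h/2*α) - f3 x * h^2/12*α) * (y - x)
      + (f2 x * (α/2 - h/2*β) - f3 x * h^2/12 * β) * (y - x)^2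
      + (f2 x * β/2 + f3 x * α/6) * (y - x)^3 + (f3 x * β/6) * (y - x)^4), int_poly]
    · ring
    · intro y _
      simp only [r0]
      ring
  rw [← hpol]
  have hs := cell_sub hN hi
  refine int_close h0 (((hf.cont.mono hs).sub ((interp_PL hN _).1.mono hs)).mul hω)
    (Continuous.continuousOn (by unfold r0; fun_prop)) fun y hy => ?_
  have A := cell_approx hf hN hi y hy
  have B := r0_bound (hf.b2 _ hx) (hf.b3 _ hx) (s := y - X N i) (h := 1/N)
    ⟨by linarith [hy.1], by linarith [hy.2]⟩ h1
  set R := r0 (1/N) (f2 (X N i)) (f3 (X N i)) (y - X N i)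
  set q := interp N (gq N f f2) y
  have e : (f y - q) * ω y - R * (α + β * (y - X N i)) =
    (f y - q - R) * ω y + R * (ω y - (α + β * (y - X N i))) := by ring
  rw [e]
  refine (abs_add_le _ _).trans ?_
  rw [abs_mul, abs_mul]
  have := hW y hy
  have := hδ y hy
  gcongr

lemma PL_bound {N : ℕ} (hN : 0 < N) {φ : ℝ → ℝ} (hφ : φ ∈ PL N) {i : ℕ} (hi : i < N) :
    ∀ y ∈ Icc (X N i) (X N i + 1/N), |φ y| ≤ E N φ i := by
  intro y hy
  have hp : (0:ℝ) < N := by positivity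
  have hNh : (N:ℝ) * (1/N) = 1 := by field_simp
  rw [PL_rep hN hφ hi y hy, E, mul_assoc]
  refine (abs_add_le _ _).trans ?_
  rw [abs_mul]
  have t0 : 0 ≤ (N:ℝ) * (y - X N i) := mul_nonneg hp.le (by linarith [hy.1])
  have t1 : (N:ℝ) * (y - X N i) ≤ 1 := by
    have := mul_le_mul_of_nonneg_left (show y - X N i ≤ 1/N by linarith [hy.2]) hp.le
    linarith
  rw [abs_of_nonneg t0]
  have := mul_le_mul_of_nonneg_left t1 (abs_nonneg (D N φ i))
  linarith

lemma by_parts (e a : ℕ → ℝ) (n : ℕ) : ∑ i ∈ Finset.range n, (e (i+1) - e i) * a i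
    = e n * a n - e 0 * a 0 - ∑ i ∈ Finset.range n, e (i+1) * (a (i+1) - a i) := by
  induction n with
  | zero => simp
  | succ k ih => rw [Finset.sum_range_succ, Finset.sum_range_succ, ih]; ring

lemma proj_err {f f1 f2 f3 : ℝ → ℝ} {M : ℝ} (hf : Data4 f f1 f2 f3 M) {N : ℕ} (hN : 0 < N)
    {P e : ℝ → ℝ} (hP : P ∈ PL N) (he : e = fun y => P y - interp N (gq N f f2) y)
    (ho : ip (fun y => f y - P y) e = 0) (b0 : e 0 * f3 0 = 0) (b1 : e 1 * f3 1 = 0) :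
    nrm e ≤ 19 * M * (1/(N:ℝ))^4 := by
  have hM := hf.nonneg
  have hp : (0:ℝ) < N := by positivity
  have hNh : (N:ℝ) * (1/N) = 1 := by field_simp
  have hq := interp_PL hN (gq N f f2)
  have heP : e ∈ PL N := by rw [he]; exact PL_sub hP hq
  set q := interp N (gq N f f2) with hqdef
  have h01 : uIcc (0:ℝ) 1 = Icc 0 1 := uIcc_of_le (by norm_num)
  have hn := nrm_nonneg e
  have E1 : nrm e ^ 2 = ∫ y in (0:ℝ)..1, (f y - q y) * e y := by
    have : ∫ y in (0:ℝ)..1, (f y - q y) * e y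
        = (∫ y in (0:ℝ)..1, (f y - P y) * e y) + ∫ y in (0:ℝ)..1, e y ^ 2 := by
      rw [← intervalIntegral.integral_add]
      · refine intervalIntegral.integral_congr fun y _ => ?_
        simp only [he]; ring
      · exact (((hf.cont.sub hP.1).mul heP.1).intervalIntegrable_of_Icc (by norm_num))
      · exact ((heP.1.pow 2).intervalIntegrable_of_Icc (by norm_num))
    rw [nrm_sq, this]
    unfold ip at ho
    rw [ho, zero_add]
  rw [sum_cells_c hN (g := fun y => (f y - q y) * e y) ((hf.cont.sub hq.1).mul heP.1)] at E1
  set h : ℝ := 1/N with hh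
  have h0 : 0 ≤ h := by positivity
  have C1 : ∀ i ∈ Finset.range N, ∫ y in (X N i)..(X N i + h), (f y - q y) * e y
      ≤ (D N e i * f3 (X N i)) * (h^4/180) + E N e i * (3 * M * h^5) := by
    intro i hi
    have hi := Finset.mem_range.1 hi
    have := cell_int hf hN hi (ω := e) (α := e (X N i)) (β := D N e i * N) (W := E N e i) (δ := 0)
      (heP.1.mono (cell_sub hN hi)) (PL_bound hN heP hi)
      (fun y hy => by rw [PL_rep hN heP hi y hy]; simp)
    have := (abs_le.1 this).2
    rw [← hh, ← hqdef] at this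
    have e2 : D N e i * N * f3 (X N i) * h^5/180 = (D N e i * f3 (X N i)) * (h^4/180) := by
      linear_combination (D N e i * f3 (X N i) * h^4/180) * hNh
    rw [e2] at this
    linarith
  have C2 := Finset.sum_le_sum C1
  rw [Finset.sum_add_distrib, ← Finset.sum_mul, ← Finset.sum_mul] at C2
  have S := sum_E hN heP
  have C3 : ∑ i ∈ Finset.range N, D N e i * f3 (X N i) ≤ (∑ i ∈ Finset.range N, E N e i) * (M * h) := by
    have := by_parts (fun i => e (X N i)) (fun i => f3 (X N i)) N
    simp only [D]
    rw [this, X_N hN, X_zero, b0, b1, sub_zero, zero_sub, ← Finset.sum_neg_distrib, Finset.sum_mul]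
    refine Finset.sum_le_sum fun i hi => ?_
    have hi := Finset.mem_range.1 hi
    refine (neg_le_abs _).trans ?_
    rw [abs_mul]
    have hx1 := X_mem hN (Nat.succ_le_of_lt hi)
    have A := hf.t1 _ (X_mem hN hi.le) (X N (i+1)) ⟨X_mono N (by omega), hx1.2⟩
    have B := PL_bound hN heP hi (X N (i+1)) (by rw [X_succ]; exact ⟨by linarith, le_rfl⟩)
    rw [X_succ, add_sub_cancel_left, ← hh] at A
    rw [X_succ, ← hh] at B ⊢
    have := E_nonneg N e i
    gcongr
  have C4 : (∑ i ∈ Finset.range N, E N e i) * (M * h) ≤ 6 * M * nrm e := by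
    calc _ ≤ (6 * N * nrm e) * (M * h) := by gcongr
      _ = _ := by linear_combination (6 * M * nrm e) * hNh
  have C5 : (∑ i ∈ Finset.range N, E N e i) * (3 * M * h^5) ≤ 18 * M * h^4 * nrm e := by
    calc _ ≤ (6 * N * nrm e) * (3 * M * h^5) := by gcongr
      _ = _ := by linear_combination (18 * M * h^4 * nrm e) * hNh
  have C6 : (∑ i ∈ Finset.range N, D N e i * f3 (X N i)) * (h^4/180) ≤ (6 * M * nrm e) * (h^4/180) := by
    have := C3.trans C4
    gcongr
  have C7 : nrm e ^ 2 ≤ (19 * M * h^4) * nrm e := by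
    have : 0 ≤ M * nrm e * h^4 := by positivity
    rw [E1] 
    linarith
  by_contra hc
  push Not at hc
  have : 0 < nrm e := lt_of_le_of_lt (by positivity) hc
  nlinarith

lemma cell_ibp {f f1 f2 f3 v v1 : ℝ → ℝ} {M K : ℝ} (hf : Data4 f f1 f2 f3 M) (hv : Data2 v v1 K)
    {N : ℕ} (hN : 0 < N) {P z : ℝ → ℝ} (hP : P ∈ PL N) (hz : z ∈ PL N) {i : ℕ} (hi : i < N) :
    IntervalIntegrable (fun y => deriv (fun y => v y * (f y - P y)) y * z y)
      MeasureTheory.volume (X N i) (X N i + 1/N) ∧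
    ∫ y in (X N i)..(X N i + 1/N), deriv (fun y => v y * (f y - P y)) y * z y
      = v (X N (i+1)) * (f (X N (i+1)) - P (X N (i+1))) * z (X N (i+1))
        - v (X N i) * (f (X N i) - P (X N i)) * z (X N i)
        - D N z i * N * ∫ y in (X N i)..(X N i + 1/N), v y * (f y - P y) := by
  have hp : (0:ℝ) < N := by positivity
  have hle : X N i ≤ X N i + 1/N := by
    have : (0:ℝ) ≤ 1/N := by positivity
    linarith
  have hs := cell_sub hN hi
  have rP := PL_rep hN hP hi
  have rz := PL_rep hN hz hi
  rw [X_succ]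
  have PLd : ∀ φ : ℝ → ℝ, ∀ a b : ℝ, (∀ y ∈ Icc (X N i) (X N i + 1/N), φ y = a + b * (y - X N i)) →
      ∀ y ∈ Ioo (X N i) (X N i + 1/N), HasDerivAt φ b y := by
    intro φ a b hφ y hy
    have h1 : HasDerivAt (fun y => a + b * (y - X N i)) b y := by
      simpa using (((hasDerivAt_id y).sub_const (X N i)).const_mul b).const_add a
    refine h1.congr_of_eventuallyEq ?_
    filter_upwards [Icc_mem_nhds hy.1 hy.2] with t ht using hφ t ht
  have Id : ∀ g g' : ℝ → ℝ, (∀ x ∈ Icc (0:ℝ) 1, HasDerivWithinAt g (g' x) (Icc (0:ℝ) 1) x) →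
      ∀ y ∈ Ioo (X N i) (X N i + 1/N), HasDerivAt g (g' y) y := fun g g' h y hy =>
    (h y (hs (Ioo_subset_Icc_self hy))).hasDerivAt
      (Filter.mem_of_superset (Icc_mem_nhds hy.1 hy.2) hs)
  set dF : ℝ → ℝ := fun y => v1 y * (f y - P y) + v y * (f1 y - D N P i * N) with hdF
  have hFd : ∀ y ∈ Ioo (X N i) (X N i + 1/N), HasDerivAt (fun y => v y * (f y - P y)) (dF y) y :=
    fun y hy => (Id v v1 hv.hd y hy).mul ((Id f f1 hf.hd y hy).sub (PLd P _ _ rP y hy))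
  have cv := hv.cont.mono hs
  have cv1 := hv.c1.mono hs
  have cf := hf.cont.mono hs
  have cf1 := hf.c1.mono hs
  have cP := hP.1.mono hs
  have cz := hz.1.mono hs
  have cF : ContinuousOn (fun y => v y * (f y - P y)) (Icc (X N i) (X N i + 1/N)) :=
    cv.mul (cf.sub cP)
  have cdF : ContinuousOn dF (Icc (X N i) (X N i + 1/N)) :=
    (cv1.mul (cf.sub cP)).add (cv.mul (cf1.sub continuousOn_const))
  have i1 : IntervalIntegrable (fun y => dF y * z y) MeasureTheory.volume (X N i) (X N i + 1/N) :=
    (cdF.mul cz).intervalIntegrable_of_Icc hle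
  have i2 : IntervalIntegrable (fun y => (v y * (f y - P y)) * (D N z i * N)) MeasureTheory.volume
      (X N i) (X N i + 1/N) := (cF.mul continuousOn_const).intervalIntegrable_of_Icc hle
  have FT := intervalIntegral.integral_eq_sub_of_hasDerivAt_of_le hle (cF.mul cz)
    (fun y hy => (hFd y hy).mul (PLd z _ _ rz y hy)) (i1.add i2)
  have cong : EqOn (fun y => deriv (fun y => v y * (f y - P y)) y * z y) (fun y => dF y * z y)
      (uIoo (X N i) (X N i + 1/N)) := by
    intro y hy
    rw [uIoo_of_le hle] at hy
    simp only [(hFd y hy).deriv]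
  refine ⟨i1.congr_uIoo cong.symm, ?_⟩
  rw [intervalIntegral.integral_congr_uIoo cong]
  rw [intervalIntegral.integral_add i1 i2, intervalIntegral.integral_mul_const] at FT
  simp only [Pi.mul_apply] at FT
  linarith

lemma core {f f1 f2 f3 v v1 : ℝ → ℝ} {M K : ℝ} (hf : Data4 f f1 f2 f3 M) (hv : Data2 v v1 K)
    {N : ℕ} (hN : 0 < N) {P e z : ℝ → ℝ} (hP : P ∈ PL N)
    (he : e = fun y => P y - interp N (gq N f f2) y)
    (ho : ip (fun y => f y - P y) e = 0) (b0 : e 0 * f3 0 = 0) (b1 : e 1 * f3 1 = 0)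
    (hz : z ∈ PL N) (hzz : ip z z = ip (deriv (fun y => v y * (f y - P y))) z)
    (z0 : v 0 * (f 0 - P 0) * z 0 = 0) (z1 : v 1 * (f 1 - P 1) * z 1 = 0) :
    nrm z ≤ (638 * M * K) * (1/(N:ℝ))^3 := by
  have hM := hf.nonneg
  have hK := hv.nonneg
  have hp : (0:ℝ) < N := by positivity
  have hNh : (N:ℝ) * (1/N) = 1 := by field_simp
  have hq := interp_PL hN (gq N f f2)
  have heP : e ∈ PL N := by rw [he]; exact PL_sub hP hq
  have hen := proj_err hf hN hP he ho b0 b1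
  set q := interp N (gq N f f2) with hqdef
  have hn := nrm_nonneg z
  have hn' := nrm_nonneg e
  have E1 : nrm z ^ 2 = ∫ y in (0:ℝ)..1, deriv (fun y => v y * (f y - P y)) y * z y := by
    rw [nrm_sq]
    unfold ip at hzz
    rw [← hzz]
    simp only [sq]
  rw [sum_cells_s11 hN (fun i hi => (cell_ibp hf hv hN hP hz hi).1),
    Finset.sum_congr rfl (fun i hi => (cell_ibp hf hv hN hP hz (Finset.mem_range.1 hi)).2),
    Finset.sum_sub_distrib,
    Finset.sum_range_sub (fun i => v (X N i) * (f (X N i) - P (X N i)) * z (X N i)),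
    X_N hN, X_zero, z0, z1, sub_zero, zero_sub, ← Finset.sum_neg_distrib] at E1
  set h : ℝ := 1/N with hh
  have h0 : 0 ≤ h := by positivity
  have C1 : ∀ i ∈ Finset.range N, -(D N z i * N * ∫ y in (X N i)..(X N i + h), v y * (f y - P y))
      ≤ E N z i * (5 * M * K * h^4) + (E N z i * E N e i) * K := by
    intro i hi
    have hi := Finset.mem_range.1 hi
    have hs := cell_sub hN hi
    have hx := X_mem hN hi.le
    have hle : X N i ≤ X N i + h := by linarith
    rw [← hh] at hs
    have A := cell_int hf hN hi (ω := v) (α := v (X N i)) (β := v1 (X N i)) (W := K) (δ := K * h^2)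
      (hv.cont.mono hs) (fun y hy => hv.b0 y (hs hy))
      (fun y hy => by
        have := hv.t2 _ hx y ⟨hy.1, (hs hy).2⟩
        rw [sub_sub] at this
        refine this.trans ?_
        have h1 : 0 ≤ y - X N i := by linarith [hy.1]
        have h2 : y - X N i ≤ h := by linarith [hy.2]
        gcongr)
    rw [← hh, ← hqdef] at A
    have B := intervalIntegral.norm_integral_le_of_norm_le_const (a := X N i) (b := X N i + h)
      (C := K * E N e i) (f := fun y => v y * e y) (fun y hy => by
        rw [uIoc_of_le hle] at hy
        have hy' : y ∈ Icc (X N i) (X N i + h) := ⟨hy.1.le, hy.2⟩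
        rw [Real.norm_eq_abs, abs_mul]
        have := hv.b0 y (hs hy')
        have := PL_bound hN heP hi y hy'
        gcongr)
    rw [add_sub_cancel_left, abs_of_nonneg h0, Real.norm_eq_abs] at B
    have J : ∫ y in (X N i)..(X N i + h), v y * (f y - P y)
        = (∫ y in (X N i)..(X N i + h), (f y - q y) * v y)
          - ∫ y in (X N i)..(X N i + h), v y * e y := by
      rw [← intervalIntegral.integral_sub]
      · refine intervalIntegral.integral_congr fun y _ => ?_
        simp only [he]; ring
      · exact ((((hf.cont.sub hq.1).mul hv.cont).mono hs).intervalIntegrable_of_Icc hle)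
      · exact (((hv.cont.mul heP.1).mono hs).intervalIntegrable_of_Icc hle)
    have A2 : |v1 (X N i) * f3 (X N i) * h^5/180| ≤ K * M * h^5/180 := by
      rw [abs_div, abs_mul, abs_mul, abs_of_nonneg (pow_nonneg h0 5)]
      have := hv.b1 _ hx
      have := hf.b3 _ hx
      rw [abs_of_pos (by norm_num : (0:ℝ) < 180)]
      gcongr
    have A3 : |∫ y in (X N i)..(X N i + h), v y * (f y - P y)| ≤ 5 * M * K * h^5 + K * E N e i * h := by
      rw [J]
      set I1 := ∫ y in (X N i)..(X N i + h), (f y - q y) * v y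
      set I2 := ∫ y in (X N i)..(X N i + h), v y * e y
      have : 0 ≤ M * K * h^5 := by positivity
      rw [abs_le] at A A2 B ⊢
      constructor <;> nlinarith
    refine (neg_le_abs _).trans ?_
    rw [abs_mul, abs_mul, abs_of_pos hp]
    have dz : |D N z i| ≤ E N z i := by unfold E; linarith [abs_nonneg (z (X N i))]
    have := E_nonneg N z i
    calc _ ≤ E N z i * N * (5 * M * K * h^5 + K * E N e i * h) := by gcongr
      _ = _ := by linear_combination (E N z i * (5 * M * K * h^4 + K * E N e i)) * hNh
  have C2 := Finset.sum_le_sum C1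
  rw [← E1, Finset.sum_add_distrib, ← Finset.sum_mul, ← Finset.sum_mul] at C2
  have S1 : (∑ i ∈ Finset.range N, E N z i) * (5 * M * K * h^4) ≤ 30 * M * K * h^3 * nrm z := by
    have := sum_E hN hz
    calc _ ≤ (6 * N * nrm z) * (5 * M * K * h^4) := by gcongr
      _ = _ := by linear_combination (30 * M * K * h^3 * nrm z) * hNh
  have S2 : (∑ i ∈ Finset.range N, E N z i * E N e i) * K ≤ 608 * M * K * h^3 * nrm z := by
    have := sum_EE hN hz heP
    calc _ ≤ (32 * N * nrm z * nrm e) * K := by gcongr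
      _ ≤ (32 * N * nrm z * (19 * M * h^4)) * K := by gcongr
      _ = _ := by linear_combination (608 * M * K * h^3 * nrm z) * hNh
  have C7 : nrm z ^ 2 ≤ (638 * M * K * h^3) * nrm z := by linarith
  by_contra hc
  push Not at hc
  have : 0 < nrm z := lt_of_le_of_lt (by positivity) hc
  nlinarith

/-- **`O(h³)` bounds for L² projections of derivatives of projection errors.** -/
theorem stmt_11 (w v η u : ℝ → ℝ)
    (hw : ContDiffOn ℝ 2 w (Icc (0:ℝ) 1)) (hw0 : w 0 = 0) (hw1 : w 1 = 0)
    (hv : ContDiffOn ℝ 2 v (Icc (0:ℝ) 1))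
    (hη : ContDiffOn ℝ 4 η (Icc (0:ℝ) 1))
    (hη10 : iteratedDerivWithin 1 η (Icc (0:ℝ) 1) 0 = 0)
    (hη11 : iteratedDerivWithin 1 η (Icc (0:ℝ) 1) 1 = 0)
    (hη30 : iteratedDerivWithin 3 η (Icc (0:ℝ) 1) 0 = 0)
    (hη31 : iteratedDerivWithin 3 η (Icc (0:ℝ) 1) 1 = 0)
    (hu : ContDiffOn ℝ 4 u (Icc (0:ℝ) 1)) (hu0 : u 0 = 0) (hu1 : u 1 = 0)
    (hu20 : iteratedDerivWithin 2 u (Icc (0:ℝ) 1) 0 = 0)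
    (hu21 : iteratedDerivWithin 2 u (Icc (0:ℝ) 1) 1 = 0) :
    ∃ C : ℝ, ∀ (N : ℕ), 2 ≤ N → ∀ Pη Pu : ℝ → ℝ,
      IsL2ProjOn (PL N) η Pη → IsL2ProjOn (PL0 N) u Pu →
      ((∀ z₁ ∈ PL0 N,
          (∀ χ ∈ PL0 N, ip z₁ χ = ip (deriv (fun y => η y - Pη y)) χ) →
          nrm z₁ ≤ C * ((1:ℝ)/N) ^ 3) ∧
       (∀ z₂ ∈ PL N,
          (∀ φ ∈ PL N, ip z₂ φ = ip (deriv (fun y => u y - Pu y)) φ) →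
          nrm z₂ ≤ C * ((1:ℝ)/N) ^ 3) ∧
       (∀ z₃ ∈ PL N,
          (∀ φ ∈ PL N, ip z₃ φ = ip (deriv (fun y => w y * (η y - Pη y))) φ) →
          nrm z₃ ≤ C * ((1:ℝ)/N) ^ 3) ∧
       (∀ z₄ ∈ PL N,
          (∀ φ ∈ PL N, ip z₄ φ = ip (deriv (fun y => v y * (u y - Pu y))) φ) →
          nrm z₄ ≤ C * ((1:ℝ)/N) ^ 3) ∧
       (∀ z₅ ∈ PL0 N,
          (∀ χ ∈ PL0 N, ip z₅ χ = ip (deriv (fun y => v y * (u y - Pu y))) χ) →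
          nrm z₅ ≤ C * ((1:ℝ)/N) ^ 3) ∧
       (∀ z₆ ∈ PL0 N,
          (∀ χ ∈ PL0 N, ip z₆ χ = ip (deriv (fun y => v y * (η y - Pη y))) χ) →
          nrm z₆ ≤ C * ((1:ℝ)/N) ^ 3)) := by
  obtain ⟨Mη, dη⟩ := exists_data4 hη
  obtain ⟨Mu, du⟩ := exists_data4 hu
  obtain ⟨Kw, dw⟩ := exists_data2 hw
  obtain ⟨Kv, dv⟩ := exists_data2 hv
  obtain ⟨K1, d1⟩ := exists_data2 (f := fun _ => (1:ℝ)) contDiffOn_const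
  have pη := dη.nonneg
  have pu := du.nonneg
  have pw := dw.nonneg
  have pv := dv.nonneg
  have p1 := d1.nonneg
  refine ⟨638 * (Mη + Mu) * (Kw + Kv + K1), fun N hN2 Pη Pu hPη hPu => ?_⟩
  have hN : 0 < N := by omega
  have up : ∀ {M K x : ℝ}, 0 ≤ M → M ≤ Mη + Mu → 0 ≤ K → K ≤ Kw + Kv + K1 →
      x ≤ (638 * M * K) * (1/(N:ℝ))^3 →
      x ≤ (638 * (Mη + Mu) * (Kw + Kv + K1)) * (1/(N:ℝ))^3 := by
    intro M K x hM hM' hK hK' hx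
    refine hx.trans ?_
    gcongr
  obtain ⟨hPη1, hPη2⟩ := hPη
  obtain ⟨hPu1, hPu2⟩ := hPu
  set eη : ℝ → ℝ := fun y => Pη y
    - interp N (gq N η (iteratedDerivWithin 2 η (Icc (0:ℝ) 1))) y with heη
  set eu : ℝ → ℝ := fun y => Pu y
    - interp N (gq N u (iteratedDerivWithin 2 u (Icc (0:ℝ) 1))) y with heu
  have eu0 : eu 0 = 0 := by
    simp only [heu, interp_zero hN, gq, hu0, hu20, hPu1.2.1]; ring
  have eu1 : eu 1 = 0 := by
    simp only [heu, interp_one hN, gq, hu1, hu21, hPu1.2.2]; ring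
  have oη := hPη2 eη (PL_sub hPη1 (interp_PL hN _))
  have ou := hPu2 eu ⟨PL_sub hPu1.1 (interp_PL hN _), eu0, eu1⟩
  have Cη := fun {v v1 : ℝ → ℝ} {K : ℝ} (hv : Data2 v v1 K) {z : ℝ → ℝ} =>
    core (z := z) dη hv hN hPη1 heη oη (by rw [hη30, mul_zero]) (by rw [hη31, mul_zero])
  have Cu := fun {v v1 : ℝ → ℝ} {K : ℝ} (hv : Data2 v v1 K) {z : ℝ → ℝ} =>
    core (z := z) du hv hN hPu1.1 heu ou (by rw [eu0, zero_mul]) (by rw [eu1, zero_mul])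
  refine ⟨?_, ?_, ?_, ?_, ?_, ?_⟩
  · intro z hz h
    refine up pη (by linarith) p1 (by linarith) (Cη d1 hz.1 ?_ ?_ ?_)
    · simpa only [one_mul] using h z hz
    · rw [hz.2.1, mul_zero]
    · rw [hz.2.2, mul_zero]
  · intro z hz h
    refine up pu (by linarith) p1 (by linarith) (Cu d1 hz ?_ ?_ ?_)
    · simpa only [one_mul] using h z hz
    · rw [hu0, hPu1.2.1]; ring
    · rw [hu1, hPu1.2.2]; ring
  · intro z hz h
    refine up pη (by linarith) pw (by linarith) (Cη dw hz (h z hz) ?_ ?_)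
    · rw [hw0]; ring
    · rw [hw1]; ring
  · intro z hz h
    refine up pu (by linarith) pv (by linarith) (Cu dv hz (h z hz) ?_ ?_)
    · rw [hu0, hPu1.2.1]; ring
    · rw [hu1, hPu1.2.2]; ring
  · intro z hz h
    refine up pu (by linarith) pv (by linarith) (Cu dv hz.1 (h z hz) ?_ ?_)
    · rw [hu0, hPu1.2.1]; ring
    · rw [hu1, hPu1.2.2]; ring
  · intro z hz h
    refine up pη (by linarith) pv (by linarith) (Cη dv hz.1 (h z hz) ?_ ?_)
    · rw [hz.2.1, mul_zero]
    · rw [hz.2.2, mul_zero]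
end
end
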